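/- Let G be a group with a nilpotent normal subgroup N of finite rank. Set π equal to the spectrum of N and Q = G/N. Suppose that N has a G-invariant central series of finite length in which each infinite factor, viewed as a ℤQ-module, is a quotient of some ℤQ-module whose underlying abelian group is torsion-free of finite rank and π-spectral. Then for every n ≥ 0 the integral homology H_n(N), endowed with the ℤQ-module structure coming from the conjugation action of G on N, belongs to the class 𝔠(Q,π). -/

import Mathlib

/-!
Statement 17: Proposition 3.7 of the paper.  The integral homology `H_n(N)` of a
normal subgroup `N` of `G` is defined functorially via the simplicial
classifying space, and the conjugation action of `G` on `N` induces an action on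
`H_n(N)`; the proposition asserts that this action factors through `Q = G/N` and
that the resulting `ℤQ`-module belongs to `𝔠(Q, π)`.
-/

open CategoryTheory AlgebraicTopology

noncomputable section




/-- The rational circle `ℚ/ℤ`. -/
abbrev RatCircle : Type := ℚ ⧸ AddSubgroup.zmultiples (1 : ℚ)

/-- The quasicyclic (Prüfer) `p`-group, realized as the `p`-primary part of `ℚ/ℤ`. -/
def pruferSubgroup (p : ℕ) : AddSubgroup RatCircle where
  carrier := {x | ∃ n : ℕ, (p ^ n : ℕ) • x = 0}
  zero_mem' := ⟨0, smul_zero _⟩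
  add_mem' := by
    rintro a b ⟨m, hm⟩ ⟨n, hn⟩
    refine ⟨m + n, ?_⟩
    have ha : (p ^ m * p ^ n) • a = 0 := by rw [mul_comm, mul_smul, hm, smul_zero]
    have hb : (p ^ m * p ^ n) • b = 0 := by rw [mul_smul, hn, smul_zero]
    rw [smul_add, pow_add, ha, hb, add_zero]
  neg_mem' := by
    rintro a ⟨m, hm⟩
    exact ⟨m, by rw [smul_neg, hm, neg_zero]⟩

/-- A group has a quasicyclic `p`-section if some quotient of a subgroup is
isomorphic to the Prüfer `p`-group. -/
def HasQuasicyclicSection (G : Type*) [Group G] (p : ℕ) : Prop :=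
  ∃ (H : Subgroup G) (K : Subgroup H) (_ : K.Normal),
    Nonempty ((H ⧸ K) ≃* Multiplicative (pruferSubgroup p))

/-- The spectrum of a group: the set of primes `p` such that the group has a
section isomorphic to the quasicyclic `p`-group. -/
def groupSpectrum (G : Type*) [Group G] : Set ℕ :=
  {p | p.Prime ∧ HasQuasicyclicSection G p}

/-- The spectrum of an (additive) abelian group, via `Multiplicative`. -/
abbrev addSpectrum (A : Type*) [AddGroup A] : Set ℕ :=
  groupSpectrum (Multiplicative A)

/-- An abelian group has finite rank if its torsion-free rank and all of its
`p`-ranks are finite. -/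
def FiniteRankAbelian (A : Type*) [AddCommGroup A] : Prop :=
  (∃ n : ℕ, ∀ k : ℕ, (∃ f : (Fin k →₀ ℤ) →+ A, Function.Injective f) → k ≤ n) ∧
  ∀ p : ℕ, p.Prime → {a : A | (p : ℕ) • a = 0}.Finite

/-- A group has finite rank (in the sense appropriate for abelian groups:
finite torsion-free rank and finite `p`-ranks). -/
def FiniteRankGroup (G : Type*) [Group G] : Prop :=
  (∃ n : ℕ, ∀ k : ℕ,
    (∃ f : Multiplicative (Fin k →₀ ℤ) →* G, Function.Injective f) → k ≤ n) ∧
  ∀ p : ℕ, p.Prime → {g : G | g ^ p = 1}.Finite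

/-- A solvable group of finite rank: a solvable group all of whose abelian
sections have finite rank. -/
def SolvableOfFiniteRank (G : Type*) [Group G] : Prop :=
  IsSolvable G ∧
    ∀ (H : Subgroup G) (K : Subgroup H) (_ : K.Normal),
      (∀ x y : H ⧸ K, x * y = y * x) → FiniteRankGroup (H ⧸ K)

/-- A group is virtually abelian. -/
def VirtuallyAbelian (G : Type*) [Group G] : Prop :=
  ∃ H : Subgroup G, H.index ≠ 0 ∧ ∀ x y : H, x * y = y * x

/-- A `ℤG`-module (given as an object of `Rep ℤ G`) whose underlying abelian group
is torsion-free, of finite rank, and `π`-spectral. -/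
def NiceRep {G : Type} [Group G] (π : Set ℕ) (M : Rep.{0} ℤ G) : Prop :=
  (∀ m : M, m ≠ 0 → ¬IsOfFinAddOrder m) ∧ FiniteRankAbelian M ∧ addSpectrum M ⊆ π

/-- The class `𝒰` of solvable groups of finite rank. -/
def MemClassU (G : Type) [Group G] : Prop :=
  SolvableOfFiniteRank G ∧
  ∃ (N : Subgroup G) (_ : N.Normal),
    Group.IsNilpotent N ∧
    Group.FG (G ⧸ N) ∧ VirtuallyAbelian (G ⧸ N) ∧
    ∃ (r : ℕ) (T : Fin (r + 1) → Subgroup G),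
      Monotone T ∧ T 0 = ⊥ ∧
      ((T (Fin.last r) : Set G) = {g : G | g ∈ N ∧ IsOfFinOrder g}) ∧
      (∀ (i : Fin (r + 1)) (g t : G), t ∈ T i → g * t * g⁻¹ ∈ T i) ∧
      (∀ (i : Fin r) (n t : G), n ∈ N → t ∈ T i.succ →
        n * t * n⁻¹ * t⁻¹ ∈ T i.castSucc) ∧
      (∀ i : Fin r, (T i.castSucc).relIndex (T i.succ) = 0 →
        ∃ M : Rep ℤ (G ⧸ N), NiceRep (groupSpectrum G) M ∧
          ∃ φ : M → G,
            (∀ m : M, φ m ∈ T i.succ) ∧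
            (∀ m m' : M, (φ (m + m'))⁻¹ * (φ m * φ m') ∈ T i.castSucc) ∧
            (∀ t : G, t ∈ T i.succ → ∃ m : M, (φ m)⁻¹ * t ∈ T i.castSucc) ∧
            (∀ (g : G) (m : M),
              (φ (M.ρ (QuotientGroup.mk g) m))⁻¹ * (g * φ m * g⁻¹) ∈ T i.castSucc))

/-- The class `𝔠(G, π)`: the smallest class of `ℤG`-modules containing every
finite `ℤG`-module and every `ℤG`-module whose underlying abelian group is
torsion-free of finite rank and `π`-spectral, and closed under forming
`ℤG`-module quotients and extensions. -/
inductive MemC (G : Type) [Group G] (π : Set ℕ) : Rep ℤ G → Prop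
  | of_finite (A : Rep ℤ G) (h : Finite (A : Type)) : MemC G π A
  | of_nice (A : Rep ℤ G) (h : NiceRep π A) : MemC G π A
  | quot (A B : Rep ℤ G) (f : A ⟶ B) (hf : Function.Surjective f.hom)
      (hA : MemC G π A) : MemC G π B
  | ext (A B C : Rep ℤ G) (f : A ⟶ B) (g : B ⟶ C)
      (hinj : Function.Injective f.hom) (hsurj : Function.Surjective g.hom)
      (hexact : ∀ b : (B : Type), g.hom b = 0 ↔ ∃ a : (A : Type), f.hom a = b)
      (hA : MemC G π A) (hC : MemC G π C) : MemC G π B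


def groupHomologyFunctor (n : ℕ) : MonCat ⥤ ModuleCat ℤ :=
  MonCat.toCat ⋙ nerveFunctor ⋙
    (SimplicialObject.whiskering _ _).obj (ModuleCat.free ℤ) ⋙
    alternatingFaceMapComplex (ModuleCat ℤ) ⋙
    HomologicalComplex.homologyFunctor (ModuleCat ℤ) (ComplexShape.down ℕ) n

/-- A `ModuleCat ℤ`-endomorphism as a `ℤ`-linear endomorphism of the carrier. -/
def endOfHom {M : ModuleCat ℤ} (f : M ⟶ M) : Module.End ℤ (M : Type) :=
  { AddMonoidHom.mk' (fun x => f x) (fun a b => by exact map_add f.hom a b) with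
    map_smul' := fun c x => by exact f.hom.map_smul' c x }

variable {G : Type} [Group G]

/-- The action of `g` on the underlying abelian group of a representation, as an
endomorphism of the corresponding multiplicative group. -/
def multHom (A : Rep ℤ G) (g : G) :
    Multiplicative (A : Type) →* Multiplicative (A : Type) :=
  AddMonoidHom.toMultiplicative
    (AddMonoidHom.mk' (fun a => A.ρ g a) (fun a b => map_add (A.ρ g) a b))

/-- The `ℤG`-module structure on `H_n` of the underlying abelian group of a
representation, induced by functoriality of group homology. -/
def homologyDiagRep (A : Rep ℤ G) (n : ℕ) :
    Representation ℤ G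
      ((groupHomologyFunctor n).obj (MonCat.of (Multiplicative (A : Type)))) where
  toFun g := endOfHom ((groupHomologyFunctor n).map (MonCat.ofHom (multHom A g)))
  map_one' := by
    have h1 : MonCat.ofHom (multHom A 1) = 𝟙 (MonCat.of (Multiplicative (A : Type))) := by
      apply MonCat.hom_ext
      apply MonoidHom.ext
      intro a
      show Multiplicative.ofAdd (A.ρ 1 (Multiplicative.toAdd a)) = a
      simp
    rw [h1, CategoryTheory.Functor.map_id]
    apply LinearMap.ext
    intro x
    rfl
  map_mul' g h := by
    have h2 : MonCat.ofHom (multHom A (g * h)) =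
        MonCat.ofHom (multHom A h) ≫ MonCat.ofHom (multHom A g) := by
      apply MonCat.hom_ext
      apply MonoidHom.ext
      intro a
      show Multiplicative.ofAdd (A.ρ (g * h) (Multiplicative.toAdd a)) = _
      simp [map_mul]
      rfl
    rw [h2, CategoryTheory.Functor.map_comp]
    apply LinearMap.ext
    intro x
    rfl


namespace HNil
open CategoryTheory.Limits ZeroObject

section Abs
universe v u v' u'
variable {C : Type u} [Category.{v} C] [Abelian C]
variable {D : Type u'} [Category.{v'} D] [Abelian D]

theorem homology_prop_of_factor (P : ObjectProperty D) [P.IsSerreClass] (S : ShortComplex D)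
    {A B Q : D} (a : S.X₁ ⟶ A) (b : A ⟶ S.X₂) (c' : S.X₂ ⟶ B) (c : B ⟶ S.X₃) (q : A ⟶ Q)
    (hf : a ≫ b = S.f) (hg : c' ≫ c = S.g) (hbc : b ≫ c' = 0)
    (hex : (ShortComplex.mk b c' hbc).Exact) (haq : a ≫ q = 0)
    (hq : (ShortComplex.mk a q haq).Exact)
    (hQ : P Q) (hc : P (kernel c)) : P S.homology := by
  have hfc : S.f ≫ c' = 0 := by rw [← hf, Category.assoc, hbc, comp_zero]
  have hbg : b ≫ S.g = 0 := by rw [← hg, ← Category.assoc, hbc, zero_comp]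
  let u : cokernel a ⟶ S.homology := cokernel.desc a (S.liftCycles b hbg ≫ S.homologyπ) (by
    have : a ≫ S.liftCycles b hbg = S.toCycles := by
      rw [← cancel_mono S.iCycles]; simp [hf]
    rw [← Category.assoc, this]; simp)
  let w : S.homology ⟶ kernel c := kernel.lift c (S.homologyι ≫ S.descOpcycles c' hfc) (by
    have : S.descOpcycles c' hfc ≫ c = S.fromOpcycles := by
      rw [← cancel_epi S.pOpcycles]; simp [hg]
    rw [Category.assoc, this]; simp)
  have huw : u ≫ w = 0 := by
    rw [← cancel_epi (cokernel.π a), ← cancel_mono (kernel.ι c)]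
    simp [u, w, hbc]
  have hE : (ShortComplex.mk u w huw).Exact := by
    rw [ShortComplex.exact_iff_exact_up_to_refinements]
    intro T x hx
    obtain ⟨T', π, hπ, z, hz, e⟩ := S.eq_liftCycles_homologyπ_up_to_refinements x
    have hx' : x ≫ w ≫ kernel.ι c = 0 := by
      have := congrArg (· ≫ kernel.ι c) hx
      simpa using this
    have hz' : z ≫ c' = 0 := by
      have := congrArg (fun t => π ≫ t) hx'
      simp only [w, kernel.lift_ι, comp_zero] at this
      rw [← Category.assoc, e] at this
      simpa using this
    obtain ⟨T'', π', hπ', y, hy⟩ := hex.exact_up_to_refinements z hz'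
    dsimp at y hy
    refine ⟨T'', π' ≫ π, inferInstance, y ≫ cokernel.π a, ?_⟩
    simp only [Category.assoc, e, u, cokernel.π_desc]
    have : π' ≫ S.liftCycles z hz = y ≫ S.liftCycles b hbg := by
      rw [← cancel_mono S.iCycles]; simp [hy]
    rw [reassoc_of% this]
  refine P.prop_X₂_of_exact hE ?_ hc
  let v : cokernel a ⟶ Q := cokernel.desc a q haq
  have hv : Mono v := by
    exact (ShortComplex.exact_iff_mono_cokernel_desc _).1 hq
  exact P.prop_of_mono v hQ

theorem kernel_prop_of_homology (P : ObjectProperty D) [P.IsSerreClass] (S : ShortComplex D)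
    {A Q : D} (e : S.X₂ ⟶ A) (b : A ⟶ S.X₃) (q : A ⟶ Q)
    (hfe : S.f ≫ e = 0) (hg : e ≫ b = S.g) (heq : e ≫ q = 0)
    (hq : (ShortComplex.mk e q heq).Exact)
    (hQ : P Q) (hS : P S.homology) : P (kernel b) := by
  let w : S.homology ⟶ kernel b := kernel.lift b (S.homologyι ≫ S.descOpcycles e hfe) (by
    have : S.descOpcycles e hfe ≫ b = S.fromOpcycles := by
      rw [← cancel_epi S.pOpcycles]; simp [hg]
    rw [Category.assoc, this]; simp)
  have hw : w ≫ (kernel.ι b ≫ q) = 0 := by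
    rw [← cancel_epi S.homologyπ]
    simp [w, heq]
  have hE : (ShortComplex.mk w (kernel.ι b ≫ q) hw).Exact := by
    rw [ShortComplex.exact_iff_exact_up_to_refinements]
    intro T x hx
    dsimp at x hx
    obtain ⟨T', π, hπ, y, hy⟩ := hq.exact_up_to_refinements (x ≫ kernel.ι b) (by simpa using hx)
    dsimp at y hy
    have hyg : y ≫ S.g = 0 := by
      rw [← hg, ← Category.assoc, ← hy]; simp
    refine ⟨T', π, hπ, S.liftCycles y hyg ≫ S.homologyπ, ?_⟩
    rw [← cancel_mono (kernel.ι b)]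
    simp [w, hy]
  exact P.prop_X₂_of_exact hE hS hQ

theorem kernel_comp_prop (P : ObjectProperty D) [P.IsSerreClass] {X Y Z : D} (f : X ⟶ Y)
    (g : Y ⟶ Z) (hf : P (kernel f)) (hg : P (kernel g)) : P (kernel (f ≫ g)) := by
  let a : kernel f ⟶ kernel (f ≫ g) := kernel.lift _ (kernel.ι f) (by simp)
  let b : kernel (f ≫ g) ⟶ kernel g := kernel.lift _ (kernel.ι _ ≫ f) (by simp)
  have hab : a ≫ b = 0 := by rw [← cancel_mono (kernel.ι g)]; simp [a, b]
  have hE : (ShortComplex.mk a b hab).Exact := by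
    rw [ShortComplex.exact_iff_exact_up_to_refinements]
    intro T x hx
    dsimp at x hx
    have hx' := congrArg (· ≫ kernel.ι g) hx
    refine ⟨T, 𝟙 _, inferInstance, kernel.lift f (x ≫ kernel.ι _) ?_, ?_⟩
    · simpa [b] using hx'
    · rw [← cancel_mono (kernel.ι _)]; simp [a]
  exact P.prop_X₂_of_exact hE hf hg

theorem homology_prop_of_factor' (P : ObjectProperty D) [P.IsSerreClass] {X₁ X₂ X₃ : D}
    (f : X₁ ⟶ X₂) (g : X₂ ⟶ X₃) (hfg : f ≫ g = 0)
    {A B Q : D} (a : X₁ ⟶ A) (b : A ⟶ X₂) (c' : X₂ ⟶ B) (c : B ⟶ X₃) (q : A ⟶ Q)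
    (hf : a ≫ b = f) (hg : c' ≫ c = g) (hbc : b ≫ c' = 0)
    (hex : (ShortComplex.mk b c' hbc).Exact) (haq : a ≫ q = 0)
    (hq : (ShortComplex.mk a q haq).Exact)
    (hQ : P Q) (hc : P (kernel c)) : P (ShortComplex.mk f g hfg).homology :=
  homology_prop_of_factor P (ShortComplex.mk f g hfg) a b c' c q hf hg hbc hex haq hq hQ hc

theorem kernel_prop_of_homology' (P : ObjectProperty D) [P.IsSerreClass] {X₁ X₂ X₃ : D}
    (f : X₁ ⟶ X₂) (g : X₂ ⟶ X₃) (hfg : f ≫ g = 0)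
    {A Q : D} (e : X₂ ⟶ A) (b : A ⟶ X₃) (q : A ⟶ Q)
    (hfe : f ≫ e = 0) (hg : e ≫ b = g) (heq : e ≫ q = 0)
    (hq : (ShortComplex.mk e q heq).Exact)
    (hQ : P Q) (hS : P (ShortComplex.mk f g hfg).homology) : P (kernel b) :=
  kernel_prop_of_homology P (ShortComplex.mk f g hfg) e b q hfe hg heq hq hQ hS

/-- kernel of a map in `P` when there is an exact sequence from an object in `P` -/
theorem kernel_prop_of_exact (P : ObjectProperty D) [P.IsSerreClass] {X Y Z : D} (f : X ⟶ Y)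
    (g : Y ⟶ Z) (w : f ≫ g = 0) (h : (ShortComplex.mk f g w).Exact) (hX : P X) :
    P (kernel g) := by
  have : Epi (kernel.lift g f w) := (ShortComplex.exact_iff_epi_kernel_lift _).1 h
  exact P.prop_of_epi (kernel.lift g f w) hX

/-- boundaries -/
def Bd (K : ChainComplex C ℕ) (q : ℕ) : C := kernel (K.homologyπ q)

def bdι (K : ChainComplex C ℕ) (q : ℕ) : Bd K q ⟶ K.cycles q := kernel.ι _

def toBd (K : ChainComplex C ℕ) (q : ℕ) : K.X (q + 1) ⟶ Bd K q :=
  kernel.lift _ (K.toCycles (q + 1) q) (by simp)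

theorem toBd_bdι (K : ChainComplex C ℕ) (q : ℕ) :
    toBd K q ≫ bdι K q = K.toCycles (q + 1) q := kernel.lift_ι _ _ _

theorem toBd_bdι_assoc (K : ChainComplex C ℕ) (q : ℕ) {Z : C} (h : K.cycles q ⟶ Z) :
    toBd K q ≫ bdι K q ≫ h = K.toCycles (q + 1) q ≫ h := by
  rw [← Category.assoc, toBd_bdι]

theorem bdι_π (K : ChainComplex C ℕ) (q : ℕ) : bdι K q ≫ K.homologyπ q = 0 :=
  kernel.condition _

instance (K : ChainComplex C ℕ) (q : ℕ) : Mono (bdι K q) := by unfold bdι Bd; infer_instance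

instance (K : ChainComplex C ℕ) (q : ℕ) : Epi (toBd K q) := by
  rw [epi_iff_surjective_up_to_refinements]
  intro A y
  have h := (K.comp_homologyπ_eq_zero_iff_up_to_refinements (q + 1) q (by simp) (y ≫ bdι K q)).1
    (by rw [Category.assoc, bdι_π, comp_zero])
  obtain ⟨A', π, hπ, x, hx⟩ := h
  refine ⟨A', π, hπ, x, ?_⟩
  rw [← cancel_mono (bdι K q)]
  simp [toBd_bdι, hx]

theorem iCycles_toBd (K : ChainComplex C ℕ) (q : ℕ) : K.iCycles (q + 1) ≫ toBd K q = 0 := by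
  rw [← cancel_mono (bdι K q), Category.assoc, toBd_bdι, ← cancel_mono (K.iCycles q)]
  simp

theorem bd_shortExact₁ (K : ChainComplex C ℕ) (q : ℕ) :
    (ShortComplex.mk _ _ (bdι_π K q)).ShortExact where
  exact := ShortComplex.exact_of_f_is_kernel _ (kernelIsKernel _)
  mono_f := by dsimp; infer_instance
  epi_g := by dsimp; infer_instance

theorem bd_shortExact₂ (K : ChainComplex C ℕ) (q : ℕ) :
    (ShortComplex.mk _ _ (iCycles_toBd K q)).ShortExact where
  exact := by
    rw [ShortComplex.exact_iff_exact_up_to_refinements]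
    intro T x hx
    dsimp at x hx
    have hx' := congrArg (· ≫ bdι K q ≫ K.iCycles q) hx
    simp only [Category.assoc, toBd_bdι_assoc, HomologicalComplex.toCycles_i, zero_comp] at hx'
    exact ⟨T, 𝟙 _, inferInstance, K.liftCycles x q (by simp) hx', by simp⟩
  mono_f := by dsimp; infer_instance
  epi_g := by dsimp; infer_instance

variable (X : C ⥤ ChainComplex D ℕ) [X.Additive]

/-- the homological functor -/
def HF (p : ℕ) : C ⥤ D := X ⋙ HomologicalComplex.homologyFunctor D (ComplexShape.down ℕ) p

instance (p : ℕ) : (HF X p).Additive := by unfold HF; infer_instance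

/-- the short complex `H_0` of three consecutive terms -/
def hsc (K : ChainComplex C ℕ) (a b c : ℕ) : ShortComplex D :=
  ShortComplex.mk ((HF X 0).map (K.d a b)) ((HF X 0).map (K.d b c))
    (by rw [← Functor.map_comp, K.d_comp_d]; exact Functor.map_zero _ _ _)

def hscIso (K : ChainComplex C ℕ) (a b c : ℕ) (ha : (ComplexShape.down ℕ).prev b = a)
    (hc : (ComplexShape.down ℕ).next b = c) :
    (((HF X 0).mapHomologicalComplex (ComplexShape.down ℕ)).obj K).homology b ≅
      (hsc X K a b c).homology :=
  ShortComplex.homologyMapIso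
    ((((HF X 0).mapHomologicalComplex (ComplexShape.down ℕ)).obj K).isoSc' a b c ha hc)

/-- exactness of a complex-valued functor -/
def ExactF : Prop := ∀ S : ShortComplex C, S.ShortExact → (S.map X).ShortExact

variable {X}

theorem HF_mid (hX : ExactF X) (p : ℕ) {S : ShortComplex C} (hS : S.ShortExact) :
    (S.map (HF X p)).Exact := (hX S hS).homology_exact₂ p

theorem HF_epi (hX : ExactF X) {S : ShortComplex C} (hS : S.ShortExact) : Epi ((HF X 0).map S.g) := by
  have := (hX S hS).epi_g
  have h2 : Epi (HomologicalComplex.homologyMap (X.map S.g) 0) := by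
    have : ∀ i, Epi ((X.map S.g).f i) := fun i => by
      have := (hX S hS).epi_g
      change Epi ((HomologicalComplex.eval D _ i).map (S.map X).g)
      infer_instance
    rw [HomologicalComplex.epi_homologyMap_iff_up_to_refinements _ 1 0 0 (by simp) (by simp)]
    intro A x hx
    obtain ⟨A', π, hπ, y, hy⟩ := surjective_up_to_refinements_of_epi ((X.map S.g).f 0) x
    exact ⟨A', π, hπ, y, by simp, 0, by simp [hy]⟩
  exact h2

/-- connecting map -/
def HFδ (hX : ExactF X) (p : ℕ) {S : ShortComplex C} (hS : S.ShortExact) :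
    (HF X (p + 1)).obj S.X₃ ⟶ (HF X p).obj S.X₁ := (hX S hS).δ (p + 1) p (by simp)

theorem HFδ_comp (hX : ExactF X) (p : ℕ) {S : ShortComplex C} (hS : S.ShortExact) :
    HFδ hX p hS ≫ (HF X p).map S.f = 0 := (hX S hS).δ_comp (p + 1) p (by simp)

theorem HFcomp_δ (hX : ExactF X) (p : ℕ) {S : ShortComplex C} (hS : S.ShortExact) :
    (HF X (p + 1)).map S.g ≫ HFδ hX p hS = 0 := (hX S hS).comp_δ (p + 1) p (by simp)

theorem HF_exact₁ (hX : ExactF X) (p : ℕ) {S : ShortComplex C} (hS : S.ShortExact) :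
    (ShortComplex.mk _ _ (HFδ_comp hX p hS)).Exact :=
  (hX S hS).homology_exact₁ (p + 1) p (by simp)

theorem HF_exact₃ (hX : ExactF X) (p : ℕ) {S : ShortComplex C} (hS : S.ShortExact) :
    (ShortComplex.mk _ _ (HFcomp_δ hX p hS)).Exact :=
  (hX S hS).homology_exact₃ (p + 1) p (by simp)

theorem exact_CZH (hX : ExactF X) (K : ChainComplex C ℕ) (q : ℕ) : (ShortComplex.mk ((HF X 0).map (K.toCycles (q + 1) q))
    ((HF X 0).map (K.homologyπ q)) (by rw [← Functor.map_comp]; simp)).Exact := by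
  have h := HF_mid hX 0 (bd_shortExact₁ K q)
  have he := HF_epi hX (bd_shortExact₂ K q)
  rw [ShortComplex.exact_iff_exact_up_to_refinements] at h ⊢
  intro A x hx
  obtain ⟨A', π, hπ, y, hy⟩ := h x hx
  dsimp only [ShortComplex.map] at x y hy he
  obtain ⟨A'', π', hπ', z, hz⟩ := surjective_up_to_refinements_of_epi
    ((HF X 0).map (toBd K q)) y
  refine ⟨A'', π' ≫ π, inferInstance, z, ?_⟩
  dsimp
  rw [Category.assoc, hy, reassoc_of% hz, ← toBd_bdι, Functor.map_comp]



/-- `H_{p+1}(Z_q)` and `H_{p+1}(B_q)` lie in `P`. -/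
theorem HF_cycles (hX : ExactF X) (P : ObjectProperty D) [P.IsSerreClass]
    (K : ChainComplex C ℕ) (hK : ∀ p q, IsZero ((HF X (p + 1)).obj (K.X q)))
    (hR : ∀ p q, P ((HF X p).obj (K.homology q))) (q : ℕ) :
    ∀ p, P ((HF X (p + 1)).obj (K.cycles q)) ∧ P ((HF X (p + 1)).obj (Bd K q)) := by
  have hB : ∀ q p, P ((HF X (p + 1)).obj (K.cycles q)) →
      P ((HF X (p + 1)).obj (Bd K q)) := fun q p h =>
    P.prop_X₂_of_exact (HF_exact₁ hX (p + 1) (bd_shortExact₁ K q)) (hR _ _) h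
  induction q with
  | zero =>
    intro p
    have h0 : P ((HF X (p + 1)).obj (K.cycles 0)) := by
      have : IsIso (K.iCycles 0) := K.isIso_iCycles 0 0 (by simp) (by simp)
      exact P.prop_of_isZero ((hK p 0).of_iso ((HF X (p + 1)).mapIso (asIso (K.iCycles 0))))
    exact ⟨h0, hB 0 p h0⟩
  | succ q ih =>
    intro p
    have h0 : P ((HF X (p + 1)).obj (K.cycles (q + 1))) :=
      P.prop_X₂_of_exact (HF_exact₁ hX (p + 1) (bd_shortExact₂ K q)) (ih (p + 1)).2
        (P.prop_of_isZero (hK p (q + 1)))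
    exact ⟨h0, hB (q + 1) p h0⟩

theorem collapse_one (hX : ExactF X) (P : ObjectProperty D) [P.IsSerreClass]
    (K : ChainComplex C ℕ) (hK : ∀ p q, IsZero ((HF X (p + 1)).obj (K.X q)))
    (hR : ∀ p q, P ((HF X p).obj (K.homology q))) (n : ℕ) :
    P ((((HF X 0).mapHomologicalComplex _).obj K).homology n) := by
  set L := ((HF X 0).mapHomologicalComplex (ComplexShape.down ℕ)).obj K with hL
  cases n with
  | zero =>
    have : IsIso (K.iCycles 0) := K.isIso_iCycles 0 0 (by simp) (by simp)
    refine P.prop_of_iso (hscIso X K 1 0 0 (by simp) (by simp)).symm ?_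
    refine homology_prop_of_factor' P _ _ _ (A := (HF X 0).obj (K.cycles 0)) (B := 0)
      (Q := (HF X 0).obj (K.homology 0)) ((HF X 0).map (K.toCycles 1 0))
      ((HF X 0).map (K.iCycles 0)) 0 0 ((HF X 0).map (K.homologyπ 0)) ?_ ?_ ?_ ?_ ?_
      (exact_CZH hX K 0) (hR _ _) ?_
    · rw [← Functor.map_comp]; simp
    · rw [K.shape 0 0 (by simp), comp_zero]; exact (Functor.map_zero _ _ _).symm
    · exact comp_zero
    · rw [ShortComplex.exact_iff_epi _ rfl]
      dsimp
      infer_instance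
    · rw [← Functor.map_comp, HomologicalComplex.toCycles_comp_homologyπ]; exact Functor.map_zero _ _ _
    · exact P.prop_of_isZero (IsZero.of_mono (kernel.ι (0 : (0 : D) ⟶ _)) (isZero_zero _))
  | succ n =>
    refine P.prop_of_iso (hscIso X K (n + 2) (n + 1) n (by simp) (by simp)).symm ?_
    refine homology_prop_of_factor' P _ _ _
      (A := (HF X 0).obj (K.cycles (n + 1))) (B := (HF X 0).obj (Bd K n))
      (Q := (HF X 0).obj (K.homology (n + 1))) ((HF X 0).map (K.toCycles (n + 2) (n + 1)))
      ((HF X 0).map (K.iCycles (n + 1))) ((HF X 0).map (toBd K n))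
      ((HF X 0).map (bdι K n) ≫ (HF X 0).map (K.iCycles n))
      ((HF X 0).map (K.homologyπ (n + 1))) ?_ ?_ ?_ (HF_mid hX 0 (bd_shortExact₂ K n)) ?_
      (exact_CZH hX K (n + 1)) (hR _ _) ?_
    · change _ = (HF X 0).map (K.d (n + 2) (n + 1))
      rw [← Functor.map_comp]; simp
    · rw [← Functor.map_comp, ← Functor.map_comp, toBd_bdι_assoc]; simp
    · rw [← Functor.map_comp, ← Functor.map_zero (HF X 0)]
      exact congrArg _ (iCycles_toBd K n)
    · rw [← Functor.map_comp, HomologicalComplex.toCycles_comp_homologyπ]; exact Functor.map_zero _ _ _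
    · apply kernel_comp_prop
      · exact kernel_prop_of_exact P _ _ _ (HF_exact₁ hX 0 (bd_shortExact₁ K n)) (hR _ _)
      · cases n with
        | zero =>
          have : IsIso (K.iCycles 0) := K.isIso_iCycles 0 0 (by simp) (by simp)
          exact P.prop_of_isZero (isZero_kernel_of_mono _)
        | succ n =>
          exact kernel_prop_of_exact P _ _ _ (HF_exact₁ hX 0 (bd_shortExact₂ K n))
            (HF_cycles hX P K hK hR n 0).2

theorem collapse_two (hX : ExactF X) (P : ObjectProperty D) [P.IsSerreClass]
    (K : ChainComplex C ℕ) (hK : ∀ p q, IsZero ((HF X (p + 1)).obj (K.X q)))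
    (n : ℕ) (hR : ∀ p q, p < n + 1 → P ((HF X p).obj (K.homology q)))
    (hT : ∀ m, P ((((HF X 0).mapHomologicalComplex _).obj K).homology m)) :
    P ((HF X (n + 1)).obj (K.homology 0)) := by
  set L := ((HF X 0).mapHomologicalComplex (ComplexShape.down ℕ)).obj K with hL
  have hT' : P (hsc X K (n + 2) (n + 1) n).homology :=
    P.prop_of_iso (hscIso X K (n + 2) (n + 1) n (by simp) (by simp)) (hT (n + 1))
  have : IsIso (K.iCycles 0) := K.isIso_iCycles 0 0 (by simp) (by simp)
  have hz : ∀ p, IsZero ((HF X (p + 1)).obj (K.cycles 0)) := fun p =>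
    (hK p 0).of_iso ((HF X (p + 1)).mapIso (asIso (K.iCycles 0)))
  have key : ∀ (n : ℕ), (∀ p q, p < n + 1 → P ((HF X p).obj (K.homology q))) →
      (∀ j k, j + 1 + k = n → P ((HF X (j + 1)).obj (Bd K k))) → 
      1 ≤ n → P ((HF X (n + 1)).obj (K.homology 0)) := by
    intro n _ h hn
    obtain ⟨n, rfl⟩ := Nat.exists_eq_add_of_le' hn
    exact P.prop_X₂_of_exact (HF_exact₃ hX (n + 1) (bd_shortExact₁ K 0))
      (P.prop_of_isZero (hz _)) (h n 0 (by omega))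
  cases n with
  | zero =>
    -- kernel of H_0(B_0) → H_0(Z_0)
    have hk : P (kernel ((HF X 0).map (bdι K 0) ≫ (HF X 0).map (K.iCycles 0))) := by
      refine kernel_prop_of_homology' P _ _ _ ((HF X 0).map (toBd K 0)) _
        (Q := 0) 0 ?_ ?_ ?_ ?_ (P.prop_of_isZero (isZero_zero _)) hT'
      · rw [← Functor.map_comp]
        have : K.d 2 1 ≫ toBd K 0 = 0 := by
          rw [← cancel_mono (bdι K 0), Category.assoc, toBd_bdι]
          simp
        rw [this]; exact Functor.map_zero _ _ _
      · rw [← Functor.map_comp, ← Functor.map_comp, toBd_bdι_assoc]; simp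
      · exact comp_zero
      · rw [ShortComplex.exact_iff_epi _ rfl]
        exact HF_epi hX (bd_shortExact₂ K 0)
    have hk' : P (kernel ((HF X 0).map (bdι K 0))) := 
      P.prop_of_iso (kernelCompMono _ _) hk
    let w : (HF X 1).obj (K.homology 0) ⟶ kernel ((HF X 0).map (bdι K 0)) :=
      kernel.lift _ _ (HFδ_comp hX 0 (bd_shortExact₁ K 0))
    have hm : Mono w := by
      have e3 := HF_exact₃ hX 0 (bd_shortExact₁ K 0)
      have hm2 := (ShortComplex.exact_iff_mono _ ((hz 0).eq_of_src _ _)).1 e3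
      dsimp at hm2
      have : w ≫ kernel.ι _ = HFδ hX 0 (bd_shortExact₁ K 0) := kernel.lift_ι _ _ _
      rw [← this] at hm2
      exact mono_of_mono w (kernel.ι _)
    exact P.prop_of_mono w hk'
  | succ n =>
    refine key _ hR ?_ (by omega)
    have h1 : P ((HF X 1).obj (Bd K n)) := by
      have hk : P (kernel ((HF X 0).map (K.iCycles (n + 1)))) := by
        refine kernel_prop_of_homology' P _ _ _
          ((HF X 0).map (K.toCycles (n + 2) (n + 1))) _ _ ?_ ?_ _ (exact_CZH hX K (n + 1))
          (hR _ _ (by omega)) hT'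
        · rw [← Functor.map_comp, HomologicalComplex.d_toCycles]; exact Functor.map_zero _ _ _
        · change _ = (HF X 0).map (K.d (n + 2) (n + 1))
          rw [← Functor.map_comp]; simp
      let w : (HF X 1).obj (Bd K n) ⟶ kernel ((HF X 0).map (K.iCycles (n + 1))) :=
        kernel.lift _ _ (HFδ_comp hX 0 (bd_shortExact₂ K n))
      have hm : Mono w := by
        have e3 := HF_exact₃ hX 0 (bd_shortExact₂ K n)
        have hm2 := (ShortComplex.exact_iff_mono _ ((hK 0 (n + 1)).eq_of_src _ _)).1 e3
        dsimp at hm2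
        have : w ≫ kernel.ι _ = HFδ hX 0 (bd_shortExact₂ K n) := kernel.lift_ι _ _ _
        rw [← this] at hm2
        exact mono_of_mono w (kernel.ι _)
      exact P.prop_of_mono w hk
    intro j
    induction j with
    | zero =>
      intro k hk
      obtain rfl : k = n := by omega
      exact h1
    | succ j ih =>
      intro k hk
      have hb := ih (k + 1) (by omega)
      have hc : P ((HF X (j + 1)).obj (K.cycles (k + 1))) :=
        P.prop_X₂_of_exact (HF_mid hX (j + 1) (bd_shortExact₁ K (k + 1))) hb
          (hR _ _ (by omega))
      exact P.prop_X₂_of_exact (HF_exact₃ hX (j + 1) (bd_shortExact₂ K k))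
        (P.prop_of_isZero (hK _ _)) hc

end Abs
end HNil

namespace HNil

section Nice

/-- `X` is, up to `U`-torsion, finitely generated. -/
def WFG (U : Set ℕ) (X : Type) [AddCommGroup X] : Prop :=
  ∃ L : AddSubgroup X, L.FG ∧ ∀ x : X, ∃ u ∈ U, u • x ∈ L

/-- the set of naturals prime to `p` -/
def Ucop (p : ℕ) : Set ℕ := {n | n.Coprime p}
/-- the set of positive naturals -/
def Upos : Set ℕ := {n | 0 < n}

structure UMul (U : Set ℕ) : Prop where
  one : 1 ∈ U
  mul : ∀ a ∈ U, ∀ b ∈ U, a * b ∈ U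

theorem umul_cop (p : ℕ) : UMul (Ucop p) :=
  ⟨Nat.coprime_one_left p, fun _ ha _ hb => Nat.Coprime.mul_left ha hb⟩
theorem umul_pos : UMul Upos := ⟨Nat.one_pos, fun _ ha _ hb => Nat.mul_pos ha hb⟩

structure NiceAb (π : Set ℕ) (X : Type) [AddCommGroup X] : Prop where
  tf : ∀ (n : ℕ) (x : X), n ≠ 0 → n • x = 0 → x = 0
  w0 : WFG Upos X
  wp : ∀ p : ℕ, p.Prime → p ∉ π → WFG (Ucop p) X

variable {X Y : Type} [AddCommGroup X] [AddCommGroup Y]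

theorem fg_iff_sub (L : AddSubgroup X) : L.FG ↔ (AddSubgroup.toIntSubmodule L).FG := by
  rw [Submodule.fg_iff_addSubgroup_fg, AddSubgroup.toIntSubmodule_toAddSubgroup]

theorem fg_of_le {L L' : AddSubgroup X} (h : L.FG) (hle : L' ≤ L) : L'.FG := by
  rw [fg_iff_sub] at h ⊢
  exact Submodule.FG.of_le h hle

theorem fg_comap {L : AddSubgroup X} (h : L.FG) (f : Y →+ X) (hf : Function.Injective f) :
    (L.comap f).FG := by
  have h1 : (L ⊓ f.range).FG := fg_of_le h inf_le_left
  rw [fg_iff_sub] at h1 ⊢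
  refine Submodule.fg_of_fg_map_injective f.toIntLinearMap hf ?_
  convert h1 using 1
  ext x
  constructor
  · rintro ⟨y, hy, rfl⟩; exact ⟨hy, y, rfl⟩
  · rintro ⟨hx, y, rfl⟩; exact ⟨y, hx, rfl⟩

theorem WFG.of_injective {U : Set ℕ} (h : WFG U X) (f : Y →+ X) (hf : Function.Injective f) :
    WFG U Y := by
  obtain ⟨L, hL, h⟩ := h
  refine ⟨L.comap f, fg_comap hL f hf, fun y => ?_⟩
  obtain ⟨u, hu, h⟩ := h (f y)
  exact ⟨u, hu, by simpa using h⟩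

theorem NiceAb.of_injective {π : Set ℕ} (h : NiceAb π X) (f : Y →+ X)
    (hf : Function.Injective f) : NiceAb π Y where
  tf n x hn hx := hf (by
    rw [map_zero]
    exact h.tf n _ hn (by rw [← map_nsmul, hx, map_zero]))
  w0 := h.w0.of_injective f hf
  wp p hp hpi := (h.wp p hp hpi).of_injective f hf

section
variable [mX : Module ℤ X] [mY : Module ℤ Y]

def tmulL (y : Y) : X →+ TensorProduct ℤ X Y :=
  AddMonoidHom.mk' (fun x => TensorProduct.tmul ℤ x y) (fun a b => TensorProduct.add_tmul a b y)

theorem nsmul_tmul' (n : ℕ) (x : X) (y : Y) : TensorProduct.tmul ℤ (n • x) y =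
    n • TensorProduct.tmul ℤ x y := map_nsmul (tmulL y) n x

theorem tmul_nsmul' (n : ℕ) (x : X) (y : Y) : TensorProduct.tmul ℤ x (n • y) =
    n • TensorProduct.tmul ℤ x y := map_nsmul ((TensorProduct.mk ℤ X Y) x) n y

theorem WFG.tensor {U : Set ℕ} (hU : UMul U) (hX : WFG U X) (hY : WFG U Y) :
    WFG U (TensorProduct ℤ X Y) := by
  obtain ⟨L, hL, h1⟩ := hX
  obtain ⟨L', hL', h2⟩ := hY
  obtain ⟨S, rfl, hS⟩ := (AddSubgroup.fg_iff _).1 hL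
  obtain ⟨S', rfl, hS'⟩ := (AddSubgroup.fg_iff _).1 hL'
  let M : AddSubgroup (TensorProduct ℤ X Y) :=
    AddSubgroup.closure (Set.image2 (fun x y => TensorProduct.tmul ℤ x y) S S')
  have key : ∀ x ∈ AddSubgroup.closure S, ∀ y ∈ AddSubgroup.closure S',
      TensorProduct.tmul ℤ x y ∈ M := by
    intro x hx y hy
    have e1 : AddSubgroup.closure S ≤ M.comap (tmulL y) := by
      rw [AddSubgroup.closure_le]
      intro s hs
      have e2 : AddSubgroup.closure S' ≤ M.comap 
          (TensorProduct.mk ℤ X Y s).toAddMonoidHom := by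
        rw [AddSubgroup.closure_le]
        intro s' hs'
        exact AddSubgroup.subset_closure ⟨s, hs, s', hs', rfl⟩
      exact e2 hy
    exact e1 hx
  refine ⟨M, (AddSubgroup.fg_iff _).2 ⟨_, rfl, hS.image2 _ hS'⟩, fun z => ?_⟩
  induction z using TensorProduct.induction_on with
  | zero => exact ⟨1, hU.one, by simp⟩
  | tmul x y =>
    obtain ⟨u, hu, hu'⟩ := h1 x
    obtain ⟨v, hv, hv'⟩ := h2 y
    refine ⟨u * v, hU.mul _ hu _ hv, ?_⟩
    have : (u * v) • (TensorProduct.tmul ℤ x y) = TensorProduct.tmul ℤ (u • x) (v • y) := by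
      rw [nsmul_tmul', tmul_nsmul', mul_smul]
    rw [this]
    exact key _ hu' _ hv'
  | add x y hx hy =>
    obtain ⟨u, hu, hu'⟩ := hx
    obtain ⟨v, hv, hv'⟩ := hy
    refine ⟨u * v, hU.mul _ hu _ hv, ?_⟩
    rw [smul_add]
    refine add_mem ?_ ?_
    · rw [mul_comm, mul_smul]; exact nsmul_mem hu' v
    · rw [mul_smul]; exact nsmul_mem hv' u

theorem torsionFree_of_tf (h : ∀ (n : ℕ) (x : X), n ≠ 0 → n • x = 0 → x = 0) :
    @Module.IsTorsionFree ℤ X _ _ mX := by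
  obtain rfl : mX = AddCommGroup.toIntModule X := Subsingleton.elim _ _
  refine ⟨fun {n} hn => ?_⟩
  intro x y hxy
  have hn0 : n ≠ 0 := hn.ne_zero
  have h0 : n • (x - y) = 0 := by
    exact (smul_sub n x y).trans (sub_eq_zero.2 hxy)
  have : (n.natAbs) • (x - y) = 0 := by
    rcases Int.natAbs_eq n with h1 | h1
    · rw [h1] at h0
      rwa [natCast_zsmul] at h0
    · rw [h1, neg_smul, neg_eq_zero] at h0
      rwa [natCast_zsmul] at h0
  exact sub_eq_zero.1 (h _ _ (Int.natAbs_ne_zero.2 hn0) this)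

theorem tf_of_torsionFree [h : @Module.IsTorsionFree ℤ X _ _ mX] :
    ∀ (n : ℕ) (x : X), n ≠ 0 → n • x = 0 → x = 0 := by
  obtain rfl : mX = AddCommGroup.toIntModule X := Subsingleton.elim _ _
  intro n x hn h
  rw [← natCast_zsmul] at h
  exact (smul_eq_zero.1 h).resolve_left (by exact_mod_cast hn)

theorem NiceAb.flat {π : Set ℕ} (h : NiceAb π X) : @Module.Flat ℤ X _ _ mX := by
  have := torsionFree_of_tf h.tf
  infer_instance

theorem NiceAb.tensor {π : Set ℕ} (hX : NiceAb π X) (hY : NiceAb π Y) :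
    NiceAb π (TensorProduct ℤ X Y) where
  tf := by
    have h1 : @Module.Flat ℤ X _ _ mX := hX.flat
    have h2 : @Module.Flat ℤ Y _ _ mY := hY.flat
    have h3 : @Module.Flat ℤ (TensorProduct ℤ X Y) _ _ TensorProduct.instModule := by
      obtain rfl : mX = AddCommGroup.toIntModule X := Subsingleton.elim _ _
      infer_instance
    exact tf_of_torsionFree (mX := TensorProduct.instModule)
  w0 := hX.w0.tensor umul_pos hY.w0
  wp p hp hpi := (hX.wp p hp hpi).tensor (umul_cop p) (hY.wp p hp hpi)
end

/-- finitely generated torsion-free groups are nice -/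
theorem NiceAb.of_fg {π : Set ℕ} (hfg : AddGroup.FG X)
    (h : ∀ (n : ℕ) (x : X), n ≠ 0 → n • x = 0 → x = 0) : NiceAb π X where
  tf := h
  w0 := ⟨⊤, AddGroup.fg_def.1 hfg, fun _ => ⟨1, umul_pos.one, trivial⟩⟩
  wp p _ _ := ⟨⊤, AddGroup.fg_def.1 hfg, fun _ => ⟨1, (umul_cop p).one, trivial⟩⟩

end Nice
end HNil

namespace HNil

section Nice2
variable {X : Type} [AddCommGroup X] 

theorem w0_of_rank
    (hr : ∃ n : ℕ, ∀ k : ℕ, (∃ f : (Fin k →₀ ℤ) →+ X, Function.Injective f) → k ≤ n) :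
    WFG Upos X := by
  classical
  obtain ⟨n, hn⟩ := hr
  have hli : ∀ k, ∀ v : Fin k → X, LinearIndependent ℤ v → k ≤ n := fun k v hv =>
    hn k ⟨(Finsupp.linearCombination ℤ v).toAddMonoidHom, hv⟩
  obtain ⟨k, ⟨v, hv⟩, hk⟩ : ∃ k, (∃ v : Fin k → X, LinearIndependent ℤ v) ∧
      ¬ ∃ v : Fin (k + 1) → X, LinearIndependent ℤ v := by
    by_contra hcon
    push Not at hcon
    have : ∀ k, ∃ v : Fin k → X, LinearIndependent ℤ v := by
      intro k
      induction k with
      | zero => exact ⟨Fin.elim0, linearIndependent_empty_type⟩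
      | succ k ih => exact hcon k ih
    obtain ⟨v, hv⟩ := this (n + 1)
    have := hli _ v hv
    omega
  refine ⟨(Submodule.span ℤ (Set.range v)).toAddSubgroup, ?_, ?_⟩
  · rw [← Submodule.fg_iff_addSubgroup_fg]
    exact Submodule.fg_span (Set.finite_range v)
  · intro x
    by_contra hcon
    push Not at hcon
    apply hk
    refine ⟨_, LinearIndependent.finCons' x v hv ?_⟩
    intro c y hy hcy
    by_contra hc
    apply hcon c.natAbs (Int.natAbs_pos.2 hc)
    have h1 : c • x ∈ Submodule.span ℤ (Set.range v) := by
      rw [eq_neg_of_add_eq_zero_left hcy]; exact neg_mem hy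
    change c.natAbs • x ∈ Submodule.span ℤ (Set.range v)
    rw [← natCast_zsmul]
    rcases Int.natAbs_eq c with h | h
    · rw [← h]; exact h1
    · have : (c.natAbs : ℤ) = - c := by omega
      rw [this, neg_smul]; exact neg_mem h1

/-- `{x | p^k x ∈ L}` -/
def Lk (L : AddSubgroup X) (p k : ℕ) : AddSubgroup X := L.comap (nsmulAddMonoidHom (p ^ k))

theorem mem_Lk {L : AddSubgroup X} {p k : ℕ} {x : X} : x ∈ Lk L p k ↔ p ^ k • x ∈ L := Iff.rfl

theorem Lk_fg (htf : ∀ (n : ℕ) (x : X), n ≠ 0 → n • x = 0 → x = 0) {L : AddSubgroup X}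
    (hL : L.FG) {p : ℕ} (hp : p ≠ 0) (k : ℕ) : (Lk L p k).FG :=
  fg_comap hL _ (by
    rw [injective_iff_map_eq_zero]
    exact fun x hx => htf (p ^ k) x (pow_ne_zero _ hp) hx)

theorem Lk_mono (L : AddSubgroup X) (p k : ℕ) : Lk L p k ≤ Lk L p (k + 1) := fun x hx => by
  rw [mem_Lk] at *
  rw [pow_succ', mul_smul]
  exact nsmul_mem hx _

theorem Lk_finite (htf : ∀ (n : ℕ) (x : X), n ≠ 0 → n • x = 0 → x = 0) {L : AddSubgroup X}
    (hL : L.FG) {p : ℕ} (hp : p ≠ 0) (k : ℕ) :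
    {y : X ⧸ L | p ^ k • y = 0}.Finite := by
  have h1 := Lk_fg htf hL hp k
  have h2 : ((Lk L p k).map (QuotientAddGroup.mk' L)).FG := by
    obtain ⟨S, hS, hf⟩ := (AddSubgroup.fg_iff _).1 h1
    refine (AddSubgroup.fg_iff _).2 ⟨(QuotientAddGroup.mk' L) '' S, ?_, hf.image _⟩
    rw [← AddMonoidHom.map_closure, hS]
  set T := (Lk L p k).map (QuotientAddGroup.mk' L) with hT
  have h3 : Module.Finite ℤ T := by
    rw [Module.Finite.iff_addGroup_fg]
    exact (AddGroup.fg_iff_addSubgroup_fg T).2 h2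
  have hker : ∀ t ∈ T, p ^ k • t = 0 := by
    rintro t ⟨x, hx, rfl⟩
    rw [← map_nsmul]
    exact (QuotientAddGroup.eq_zero_iff _).2 hx
  have h4 : Finite T := by
    apply Module.finite_of_fg_torsion
    intro t
    refine ⟨⟨(p ^ k : ℕ), mem_nonZeroDivisors_of_ne_zero (by exact_mod_cast pow_ne_zero _ hp)⟩, ?_⟩
    apply Subtype.ext
    change (((p ^ k : ℕ) : ℤ) • (t : X ⧸ L)) = 0
    rw [natCast_zsmul]
    exact hker t t.2
  refine (Set.toFinite (T : Set (X ⧸ L))).subset ?_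
  intro y hy
  obtain ⟨x, rfl⟩ := QuotientAddGroup.mk_surjective y
  exact ⟨x, (QuotientAddGroup.eq_zero_iff (p ^ k • x)).1 hy, rfl⟩

theorem exists_seq (htf : ∀ (n : ℕ) (x : X), n ≠ 0 → n • x = 0 → x = 0) {L : AddSubgroup X}
    (hL : L.FG) {p : ℕ} (hp : p ≠ 0) (hne : ∀ k, Lk L p k ≠ Lk L p (k + 1)) :
    ∃ y : ℕ → X ⧸ L, y 0 ≠ 0 ∧ p • y 0 = 0 ∧ ∀ k, p • y (k + 1) = y k := by
  let F : ℕ → Type := fun k => {y : X ⧸ L // p ^ (k + 1) • y = 0 ∧ p ^ k • y ≠ 0}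
  let m : ∀ k, F (k + 1) → F k := fun k y => ⟨p • y.1, by
    rw [← mul_smul, ← pow_succ]; exact y.2.1, by
    rw [← mul_smul, ← pow_succ]; exact y.2.2⟩
  have hfin : ∀ k, Finite (F k) := fun k => by
    have := Lk_finite htf hL hp (k + 1)
    exact (this.subset (fun y (hy : p ^ (k + 1) • y = 0 ∧ p ^ k • y ≠ 0) => hy.1)).to_subtype
  have hnon : ∀ k, Nonempty (F k) := fun k => by
    have : ∃ x ∈ Lk L p (k + 1), x ∉ Lk L p k := by
      by_contra hcon
      push Not at hcon
      exact hne k (le_antisymm (Lk_mono L p k) hcon)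
    obtain ⟨x, h1, h2⟩ := this
    exact ⟨⟨QuotientAddGroup.mk x, (QuotientAddGroup.eq_zero_iff _).2 h1,
      fun h => h2 ((QuotientAddGroup.eq_zero_iff (p ^ k • x)).1 h)⟩⟩
  let Φ : ℕᵒᵖ ⥤ Type := Functor.ofOpSequence (X := F) (fun k => ↾(m k))
  have i1 : ∀ j, Finite (Φ.obj j) := fun j => hfin _
  have i2 : ∀ j, Nonempty (Φ.obj j) := fun j => hnon _
  obtain ⟨s, hs⟩ := nonempty_sections_of_finite_inverse_system Φ
  refine ⟨fun k => (s (Opposite.op k)).1, ?_, ?_, ?_⟩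
  · have := (s (Opposite.op 0)).2.2
    simpa using this
  · have := (s (Opposite.op 0)).2.1
    simpa using this
  · intro k
    have := hs (homOfLE (Nat.le_succ k)).op
    have e : Φ.map (homOfLE (Nat.le_succ k)).op = ↾(m k) := Functor.ofOpSequence_map_homOfLE_succ _ k
    rw [e] at this
    exact congrArg Subtype.val this

theorem circ_prufer {p : ℕ} (hp : p.Prime) (k : ℕ) (y b : RatCircle) (hy : p ^ (k + 1) • y = 0)
    (hb : p ^ (k + 1) • b = 0) (hb' : p ^ k • b ≠ 0) : ∃ c : ℤ, y = c • b := by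
  have hp0 : (p : ℚ) ≠ 0 := by exact_mod_cast hp.ne_zero
  have hrep : ∀ z : RatCircle, p ^ (k + 1) • z = 0 → ∃ a : ℤ,
      z = QuotientAddGroup.mk ((a : ℚ) / (p : ℚ) ^ (k + 1)) := by
    intro z hz
    obtain ⟨q, rfl⟩ := QuotientAddGroup.mk_surjective z
    have := (QuotientAddGroup.eq_zero_iff _).1 (show ((p ^ (k + 1) • q : ℚ) : RatCircle) = 0 from hz)
    obtain ⟨a, ha⟩ := AddSubgroup.mem_zmultiples_iff.1 this
    refine ⟨a, ?_⟩
    congr 1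
    field_simp
    simp at ha
    rw [ha]
    ring
  obtain ⟨a, rfl⟩ := hrep y hy
  obtain ⟨d, rfl⟩ := hrep b hb
  have hd : ¬ (p : ℤ) ∣ d := by
    rintro ⟨e, rfl⟩
    apply hb'
    refine (QuotientAddGroup.eq_zero_iff _).2 (AddSubgroup.mem_zmultiples_iff.2 ⟨e, ?_⟩)
    simp
    field_simp
    ring
  have hcop : IsCoprime d ((p : ℤ) ^ (k + 1)) := by
    apply IsCoprime.pow_right
    exact ((Nat.prime_iff_prime_int.1 hp).coprime_iff_not_dvd.2 hd).symm
  obtain ⟨u, v, huv⟩ := hcop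
  refine ⟨a * u, ?_⟩
  have : ((a * u : ℤ) • (((d : ℚ) / (p : ℚ) ^ (k + 1) : ℚ) : RatCircle)) =
    (((a * u : ℤ) • ((d : ℚ) / (p : ℚ) ^ (k + 1)) : ℚ) : RatCircle) := rfl
  rw [this, QuotientAddGroup.eq]
  refine AddSubgroup.mem_zmultiples_iff.2 ⟨- a * v, ?_⟩
  have huv' : (u : ℚ) * d + v * (p : ℚ) ^ (k + 1) = 1 := by exact_mod_cast huv
  simp
  field_simp
  linear_combination (- a : ℚ) * huv'

theorem section_of_hom {p : ℕ} (c : X →+ RatCircle) (h : ∀ y ∈ pruferSubgroup p, ∃ x, c x = y) :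
    HasQuasicyclicSection (Multiplicative X) p := by
  let H : Subgroup (Multiplicative X) := AddSubgroup.toSubgroup ((pruferSubgroup p).comap c)
  let f0 : ((pruferSubgroup p).comap c) →+ pruferSubgroup p :=
    (c.comp (AddSubgroup.subtype _)).codRestrict _ (fun x => x.2)
  let f : H →* Multiplicative (pruferSubgroup p) := 
    { toFun := fun x => Multiplicative.ofAdd (f0 ⟨Multiplicative.toAdd x.1, x.2⟩)
      map_one' := congrArg Multiplicative.ofAdd (map_zero f0)
      map_mul' := fun a b => congrArg Multiplicative.ofAdd
        (map_add f0 ⟨Multiplicative.toAdd a.1, a.2⟩ ⟨Multiplicative.toAdd b.1, b.2⟩) }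
  have hf : Function.Surjective f := by
    intro y
    obtain ⟨x, hx⟩ := h _ (Multiplicative.toAdd y).2
    refine ⟨⟨Multiplicative.ofAdd x, ?_⟩, ?_⟩
    · change c x ∈ pruferSubgroup p
      rw [hx]; exact (Multiplicative.toAdd y).2
    · exact congrArg Multiplicative.ofAdd (Subtype.ext hx)
  exact ⟨H, f.ker, inferInstance, ⟨QuotientGroup.quotientKerEquivOfSurjective f hf⟩⟩

theorem niceAb_of {π : Set ℕ} (htf' : ∀ m : X, m ≠ 0 → ¬IsOfFinAddOrder m)
    (hr : FiniteRankAbelian X) (hs : addSpectrum X ⊆ π) : NiceAb π X := by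
  have htf : ∀ (n : ℕ) (x : X), n ≠ 0 → n • x = 0 → x = 0 := fun n x hn hx => by
    by_contra h
    exact htf' x h (isOfFinAddOrder_iff_nsmul_eq_zero.2 ⟨n, Nat.pos_of_ne_zero hn, hx⟩)
  have w0 := w0_of_rank hr.1
  refine ⟨htf, w0, fun p hp hpi => ?_⟩
  obtain ⟨L, hL, h⟩ := w0
  by_cases hst : ∃ k, Lk L p k = Lk L p (k + 1)
  · obtain ⟨k, hk⟩ := hst
    refine ⟨Lk L p k, Lk_fg htf hL hp.ne_zero k, fun x => ?_⟩
    have hall : ∀ j, Lk L p (k + j) = Lk L p k := by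
      intro j
      induction j with
      | zero => rfl
      | succ j ih =>
        rw [← ih]
        ext x
        constructor
        · intro hx
          have : p ^ j • x ∈ Lk L p (k + 1) := by
            rw [mem_Lk] at *
            rw [← mul_smul, ← pow_add]
            convert hx using 3; ring
          rw [← hk, mem_Lk, ← mul_smul, ← pow_add] at this
          exact this
        · exact fun hx => Lk_mono L p _ hx
    obtain ⟨u, hu, hx⟩ := h x
    obtain ⟨e, v, hv, rfl⟩ := Nat.exists_eq_pow_mul_and_not_dvd (n := u)
      (Nat.pos_iff_ne_zero.1 hu) p hp.ne_one
    refine ⟨v, (hp.coprime_iff_not_dvd.2 hv).symm, ?_⟩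
    have h1 : v • x ∈ Lk L p (k + e) := by
      rw [mem_Lk, pow_add, mul_smul, ← mul_smul (p ^ e)]
      exact nsmul_mem hx _
    rwa [hall] at h1
  · exfalso
    push Not at hst
    obtain ⟨y, hy0, hy1, hy⟩ := exists_seq htf hL hp.ne_zero hst
    obtain ⟨c, hc⟩ := CharacterModule.exists_character_apply_ne_zero_of_ne_zero hy0
    apply hpi
    apply hs
    refine ⟨hp, section_of_hom (AddMonoidHom.comp (c : (X ⧸ L) →+ RatCircle) (QuotientAddGroup.mk' L)) ?_⟩
    rintro z ⟨k, hz⟩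
    have hy2 : ∀ k, p ^ k • y k = y 0 := by
      intro k
      induction k with
      | zero => simp
      | succ k ih => rw [pow_succ, mul_smul, hy, ih]
    have e1 : p ^ k • c (y k) = c (y 0) := by rw [← map_nsmul, hy2]
    obtain ⟨d, hd⟩ := circ_prufer hp k z (c (y k)) (by rw [pow_succ', mul_smul, hz, smul_zero])
      (by rw [pow_succ', mul_smul, e1, ← map_nsmul, hy1, map_zero]) (by rw [e1]; exact hc)
    obtain ⟨x, hx⟩ := QuotientAddGroup.mk_surjective (d • y k)
    refine ⟨x, ?_⟩
    change c (QuotientAddGroup.mk x) = z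
    rw [hx, map_zsmul, hd]

theorem niceAb_tors {π : Set ℕ} (h : NiceAb π X) : ∀ m : X, m ≠ 0 → ¬IsOfFinAddOrder m := by
  intro m hm hf
  obtain ⟨n, hn, hnm⟩ := isOfFinAddOrder_iff_nsmul_eq_zero.1 hf
  exact hm (h.tf n m hn.ne' hnm)

theorem niceAb_rank {π : Set ℕ} (h : NiceAb π X) : FiniteRankAbelian X := by
  constructor
  · obtain ⟨L, hL, hu⟩ := h.w0
    have hLf : Module.Finite ℤ L := by
      rw [Module.Finite.iff_addGroup_fg]
      exact (AddGroup.fg_iff_addSubgroup_fg L).2 hL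
    refine ⟨Module.finrank ℤ L, fun k ⟨f, hf⟩ => ?_⟩
    choose u hu hx using hu
    let v : Fin k → L := fun i => ⟨u (f (Finsupp.single i 1)) • f (Finsupp.single i 1), hx _⟩
    have hv : LinearIndependent ℤ v := by
      rw [Fintype.linearIndependent_iff]
      intro g hg i
      have h1 : f (∑ i, Finsupp.single i (g i * (u (f (Finsupp.single i 1)) : ℤ))) = 0 := by
        have h2 := congrArg (fun z : L => (z : X)) hg
        simp only [AddSubgroup.coe_zero, AddSubgroup.val_finsetSum, AddSubgroup.coe_zsmul] at h2
        rw [map_sum, ← h2]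
        refine Finset.sum_congr rfl fun j _ => ?_
        change _ = g j • (u (f (Finsupp.single j 1)) • f (Finsupp.single j 1))
        rw [← natCast_zsmul, ← mul_smul, ← map_zsmul, Finsupp.smul_single, smul_eq_mul, mul_one]
      have h2 := (injective_iff_map_eq_zero f).1 hf _ h1
      have h3 := congrArg (fun z => z i) h2
      simp only [Finsupp.finsetSum_apply, Finsupp.single_apply] at h3
      simp at h3
      rcases h3 with h3 | h3
      · exact h3
      · have := hu (f (Finsupp.single i 1)); rw [h3] at this; exact absurd this (lt_irrefl 0)
    simpa using hv.fintype_card_le_finrank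
  · intro p hp
    refine (Set.finite_singleton (0 : X)).subset fun a ha => ?_
    exact h.tf p a hp.ne_zero ha

theorem niceAb_spec {π : Set ℕ} (h : NiceAb π X) : addSpectrum X ⊆ π := by
  rintro p ⟨hp, H, K, hK, ⟨e⟩⟩
  by_contra hpi
  obtain ⟨L, hL, hu⟩ := h.wp p hp hpi
  let c : H →* Multiplicative (pruferSubgroup p) := e.toMonoidHom.comp (QuotientGroup.mk' K)
  have hc : Function.Surjective c := e.surjective.comp (QuotientGroup.mk'_surjective K)
  let H' : AddSubgroup X := Subgroup.toAddSubgroup' H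
  let c' : H' →+ pruferSubgroup p := 
    { toFun := fun x => Multiplicative.toAdd (c ⟨Multiplicative.ofAdd x.1, x.2⟩)
      map_zero' := congrArg Multiplicative.toAdd (map_one c)
      map_add' := fun a b => congrArg Multiplicative.toAdd
        (map_mul c ⟨Multiplicative.ofAdd a.1, a.2⟩ ⟨Multiplicative.ofAdd b.1, b.2⟩) }
  have hc' : Function.Surjective c' := fun y => by
    obtain ⟨x, hx⟩ := hc (Multiplicative.ofAdd y)
    exact ⟨⟨Multiplicative.toAdd x.1, x.2⟩, congrArg Multiplicative.toAdd hx⟩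
  have hLH : (L.comap H'.subtype).FG := fg_comap hL _ Subtype.val_injective
  obtain ⟨S, hS, hSf⟩ := (AddSubgroup.fg_iff _).1 hLH
  have hexp : ∃ k : ℕ, ∀ s ∈ S, p ^ k • (c' s : RatCircle) = 0 := by
    have : ∀ s : S, ∃ k : ℕ, p ^ k • (c' s : RatCircle) = 0 := fun s => (c' s).2
    choose k hk using this
    have := hSf.fintype
    refine ⟨∑ s, k s, fun s hs => ?_⟩
    obtain ⟨d, hd⟩ := pow_dvd_pow p (Finset.single_le_sum (f := k) (fun _ _ => Nat.zero_le _)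
      (Finset.mem_univ (⟨s, hs⟩ : S)))
    rw [hd, mul_comm, mul_smul, hk ⟨s, hs⟩, smul_zero]
  obtain ⟨k, hk⟩ := hexp
  have hk' : ∀ x ∈ L.comap H'.subtype, p ^ k • (c' x : RatCircle) = 0 := by
    rw [← hS]
    intro x hx
    induction hx using AddSubgroup.closure_induction with
    | mem x hx => exact hk x hx
    | zero => simp
    | add x y _ _ hx hy => rw [map_add, AddSubgroup.coe_add, smul_add, hx, hy, add_zero]
    | neg x _ hx => rw [map_neg, AddSubgroup.coe_neg, smul_neg, hx, neg_zero]
  have hp0 : (p : ℚ) ≠ 0 := by exact_mod_cast hp.ne_zero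
  obtain ⟨x, hx⟩ := hc' ⟨QuotientAddGroup.mk (1 / (p : ℚ) ^ (k + 1)), k + 1,
    (QuotientAddGroup.eq_zero_iff _).2 (AddSubgroup.mem_zmultiples_iff.2 ⟨1, by
      simp; field_simp⟩)⟩
  obtain ⟨u, hu1, hu2⟩ := hu x.1
  have := hk' (u • x) (show (u • x : H').1 ∈ L from hu2)
  rw [map_nsmul, hx] at this
  have h2 := (QuotientAddGroup.eq_zero_iff _).1 (show ((p ^ k • (u • (1 / (p : ℚ) ^ (k + 1))) : ℚ) :
    RatCircle) = 0 from this)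
  obtain ⟨a, ha⟩ := AddSubgroup.mem_zmultiples_iff.1 h2
  have h3 : (u : ℤ) = a * p := by
    have : (u : ℚ) = a * p := by
      simp at ha
      rw [ha]
      field_simp
      ring
    exact_mod_cast this
  have h4 : p ∣ u := by
    have : (p : ℤ) ∣ u := ⟨a, by rw [h3]; ring⟩
    exact_mod_cast this
  exact (hp.coprime_iff_not_dvd.1 (Nat.Coprime.symm hu1)) h4

end Nice2
end HNil

namespace HNil
open CategoryTheory.Limits

section PCsec
variable {G : Type} [Group G]
local instance (priority := 2000) repMod (A : Rep.{0} ℤ G) : Module ℤ A.V := A.hV2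
open ZeroObject


theorem rep_exact_iff (S : ShortComplex (Rep.{0} ℤ G)) :
    S.Exact ↔ ∀ x : S.X₂, S.g.hom x = 0 → ∃ y : S.X₁, S.f.hom y = x := by
  rw [← ShortComplex.exact_map_iff_of_faithful S (forget₂ (Rep.{0} ℤ G) (ModuleCat ℤ)),
    ShortComplex.moduleCat_exact_iff]
  rfl

theorem rep_shortExact_iff (S : ShortComplex (Rep.{0} ℤ G)) :
    S.ShortExact ↔ (∀ x : S.X₂, S.g.hom x = 0 → ∃ y : S.X₁, S.f.hom y = x) ∧
      Function.Injective S.f.hom ∧ Function.Surjective S.g.hom := by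
  rw [← rep_exact_iff, ← Rep.epi_iff_surjective, ← Rep.mono_iff_injective]
  exact ⟨fun h => ⟨h.exact, h.mono_f, h.epi_g⟩, fun h => { exact := h.1, mono_f := h.2.1, epi_g := h.2.2 }⟩

/-- `N` acts trivially -/
def NTriv (N : Subgroup G) (A : Rep.{0} ℤ G) : Prop := ∀ g ∈ N, ∀ a : A, A.ρ g a = a

/-- smallest class of reps of `G` containing the nice `N`-trivial ones closed under quotients
and extensions. -/
inductive PC (N : Subgroup G) (π : Set ℕ) : Rep.{0} ℤ G → Prop
  | nice (A : Rep.{0} ℤ G) (h : NiceAb π A) (ht : NTriv N A) : PC N π A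
  | quot (A B : Rep.{0} ℤ G) (f : A ⟶ B) (hf : Epi f) (hA : PC N π A) : PC N π B
  | ext (S : ShortComplex (Rep.{0} ℤ G)) (hS : S.ShortExact) (h1 : PC N π S.X₁)
      (h3 : PC N π S.X₃) : PC N π S.X₂

variable {N : Subgroup G} {π : Set ℕ}

theorem NTriv.of_mono {A B : Rep.{0} ℤ G} (h : NTriv N B) (f : A ⟶ B) [Mono f] : NTriv N A := by
  intro g hg a
  have hf := (Rep.mono_iff_injective f).1 inferInstance
  apply hf
  rw [Rep.hom_comm_apply, h g hg]

theorem NTriv.of_epi {A B : Rep.{0} ℤ G} (h : NTriv N A) (f : A ⟶ B) [Epi f] : NTriv N B := by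
  intro g hg b
  have hf := (Rep.epi_iff_surjective f).1 inferInstance
  obtain ⟨a, rfl⟩ := hf b
  rw [← Rep.hom_comm_apply, h g hg]

theorem nice_of_mono {A B : Rep.{0} ℤ G} (h : NiceAb π B) (f : A ⟶ B) [Mono f] : NiceAb π A :=
  h.of_injective f.hom.toLinearMap.toAddMonoidHom ((Rep.mono_iff_injective f).1 inferInstance)

section
variable {C : Type*} [Category C] [Abelian C]

/-- kernel of `i ≫ g` maps monomorphically to `X₁`. -/
theorem sub_ext {S : ShortComplex C} (hS : S.ShortExact) {U : C} (i : U ⟶ S.X₂) [Mono i] :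
    ∃ (j : kernel (i ≫ S.g) ⟶ S.X₁) (l : Abelian.image (i ≫ S.g) ⟶ S.X₃), Mono j ∧ Mono l := by
  have := hS.mono_f
  refine ⟨hS.exact.lift (kernel.ι (i ≫ S.g) ≫ i) (by simp), Abelian.image.ι _, ?_, inferInstance⟩
  have h : hS.exact.lift (kernel.ι (i ≫ S.g) ≫ i) (by simp) ≫ S.f = kernel.ι (i ≫ S.g) ≫ i :=
    hS.exact.lift_f _ _
  have : Mono (hS.exact.lift (kernel.ι (i ≫ S.g) ≫ i) (by simp) ≫ S.f) := by
    rw [h]; infer_instance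
  exact mono_of_mono _ S.f

/-- the standard short exact sequence `ker → U → im`. -/
theorem ker_im_shortExact {U V : C} (f : U ⟶ V) :
    (ShortComplex.mk (kernel.ι f) (Abelian.factorThruImage f) (by
      rw [← cancel_mono (Abelian.image.ι f)]; simp)).ShortExact where
  exact := by
    apply ShortComplex.exact_of_f_is_kernel
    refine KernelFork.IsLimit.ofι _ _ (fun {W} k hk => kernel.lift f k (by
      rw [← Abelian.image.fac f, reassoc_of% hk, zero_comp])) (fun k hk => kernel.lift_ι _ _ _) ?_
    intro W k hk m hm
    rw [← cancel_mono (kernel.ι f), hm, kernel.lift_ι]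
  mono_f := inferInstance
  epi_g := inferInstance
end

theorem PC.of_mono {B : Rep.{0} ℤ G} (hB : PC N π B) :
    ∀ {A : Rep.{0} ℤ G} (i : A ⟶ B), Mono i → PC N π A := by
  induction hB with
  | nice B h ht => intro A i hi; exact .nice _ (nice_of_mono h i) (ht.of_mono i)
  | quot A B f hf hA ih =>
    intro U i hi
    exact .quot (pullback f i) U (pullback.snd f i) inferInstance (ih (pullback.fst f i) inferInstance)
  | ext S hS h1 h3 ih1 ih3 =>
    intro U i hi
    obtain ⟨j, l, hj, hl⟩ := sub_ext hS i
    exact .ext _ (ker_im_shortExact (i ≫ S.g)) (ih1 j hj) (ih3 l hl)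

theorem niceAb_subsingleton {X : Type} [AddCommGroup X] [Subsingleton X] : NiceAb π X where
  tf _ _ _ _ := Subsingleton.elim _ _
  w0 := ⟨⊥, AddSubgroup.FG.bot, fun x => ⟨1, umul_pos.one, Subsingleton.elim _ _⟩⟩
  wp p _ _ := ⟨⊥, AddSubgroup.FG.bot, fun x => ⟨1, (umul_cop p).one, Subsingleton.elim _ _⟩⟩

/-- as an object property -/
def PP (N : Subgroup G) (π : Set ℕ) : ObjectProperty (Rep.{0} ℤ G) := PC N π

instance : (PP N π).IsSerreClass where
  toContainsZero := ⟨⟨0, isZero_zero _, by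
    have : Subsingleton (0 : Rep.{0} ℤ G) := (Rep.isZero_iff _ _ _).1 (isZero_zero _)
    exact .nice _ niceAb_subsingleton (fun g hg a => Subsingleton.elim _ _)⟩⟩
  toIsClosedUnderSubobjects := ⟨fun f hf h => h.of_mono f hf⟩
  toIsClosedUnderQuotients := ⟨fun f hf h => .quot _ _ f hf h⟩
  toIsClosedUnderExtensions := ⟨fun hS h1 h3 => .ext _ hS h1 h3⟩

/-- descent of `N`-trivial representations -/
def desc [N.Normal] (A : Rep.{0} ℤ G) (h : NTriv N A) : Rep.{0} ℤ (G ⧸ N) :=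
  Rep.of (QuotientGroup.lift N A.ρ (fun g hg => LinearMap.ext (h g hg)))

def descHom [N.Normal] {A B : Rep.{0} ℤ G} (hA : NTriv N A) (hB : NTriv N B) (f : A ⟶ B) :
    desc A hA ⟶ desc B hB :=
  Rep.ofHom ⟨f.hom.toLinearMap, fun g => by
    induction g using QuotientGroup.induction_on with
    | H g => exact LinearMap.ext fun a => Rep.hom_comm_apply f g a⟩

theorem memC_subquot [N.Normal] {X : Rep.{0} ℤ G} (hX : PC N π X) :
    ∀ {U Z : Rep.{0} ℤ G} (i : U ⟶ X) (q : U ⟶ Z) (_ : Mono i) (_ : Epi q) (hZ : NTriv N Z),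
      MemC (G ⧸ N) π (desc Z hZ) := by
  induction hX with
  | nice A h ht =>
    intro U Z i q hi hq hZ
    have hU := ht.of_mono i
    have hU' := nice_of_mono h i
    refine .quot (desc U hU) _ (descHom hU hZ q) ((Rep.epi_iff_surjective q).1 hq)
      (.of_nice _ ⟨niceAb_tors hU', niceAb_rank hU', niceAb_spec hU'⟩)
  | quot A B f hf hA ih =>
    intro U Z i q hi hq hZ
    have : Epi (pullback.snd f i) := inferInstance
    exact ih (pullback.fst f i) (pullback.snd f i ≫ q) inferInstance (epi_comp _ _) hZ
  | ext S hS h1 h3 ih1 ih3 =>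
    intro U Z i q hi hq hZ
    obtain ⟨j, l, hj, hl⟩ := sub_ext hS i
    let k := kernel.ι (i ≫ S.g) ≫ q
    have hI : NTriv N (Abelian.image k) := hZ.of_mono (Abelian.image.ι k)
    have hC : NTriv N (cokernel k) := hZ.of_epi (cokernel.π k)
    have m1 := ih1 j (Abelian.factorThruImage k) hj inferInstance hI
    -- image (i ≫ g) ↠ cokernel k
    have hE := ker_im_shortExact (i ≫ S.g)
    have hepi := hE.epi_g
    let r : Abelian.image (i ≫ S.g) ⟶ cokernel k := hE.exact.desc (q ≫ cokernel.π k) (by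
      dsimp; rw [← Category.assoc]; exact cokernel.condition k)
    have hr : Epi r := by
      have e : Abelian.factorThruImage (i ≫ S.g) ≫ r = q ≫ cokernel.π k := hE.exact.g_desc _ _
      have : Epi (Abelian.factorThruImage (i ≫ S.g) ≫ r) := by rw [e]; exact epi_comp _ _
      exact epi_of_epi (Abelian.factorThruImage (i ≫ S.g)) r
    have m3 := ih3 l r hl hr hC
    refine .ext _ _ _ (descHom hI hZ (Abelian.image.ι k)) (descHom hZ hC (cokernel.π k))
      ((Rep.mono_iff_injective (Abelian.image.ι k)).1 inferInstance)
      ((Rep.epi_iff_surjective (cokernel.π k)).1 inferInstance) ?_ m1 m3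
    have hex : (ShortComplex.mk (Abelian.image.ι k) (cokernel.π k) (kernel.condition _)).Exact :=
      ShortComplex.exact_kernel _
    intro b
    constructor
    · intro hb
      exact (rep_exact_iff _).1 hex b hb
    · rintro ⟨a, rfl⟩
      exact congrArg (fun f => f.hom a) (kernel.condition (cokernel.π k))

theorem PC.memC [N.Normal] {X : Rep.{0} ℤ G} (hX : PC N π X) (h : NTriv N X) :
    MemC (G ⧸ N) π (desc X h) :=
  memC_subquot hX (𝟙 X) (𝟙 X) inferInstance inferInstance h

end PCsec
end HNil

namespace HNil
open CategoryTheory.Limits MonoidalCategory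

section tens
variable {k : Type} [CommRing k] {G : Type} [Group G]

theorem rep_exact_iff' (S : ShortComplex (Rep.{0} k G)) :
    S.Exact ↔ ∀ x : S.X₂, S.g.hom x = 0 → ∃ y : S.X₁, S.f.hom y = x := by
  rw [← ShortComplex.exact_map_iff_of_faithful S (forget₂ (Rep.{0} k G) (ModuleCat k)),
    ShortComplex.moduleCat_exact_iff]
  rfl

theorem rep_shortExact_iff' (S : ShortComplex (Rep.{0} k G)) :
    S.ShortExact ↔ (∀ x : S.X₂, S.g.hom x = 0 → ∃ y : S.X₁, S.f.hom y = x) ∧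
      Function.Injective S.f.hom ∧ Function.Surjective S.g.hom := by
  rw [← rep_exact_iff', ← Rep.epi_iff_surjective, ← Rep.mono_iff_injective]
  exact ⟨fun h => ⟨h.exact, h.mono_f, h.epi_g⟩, fun h => { exact := h.1, mono_f := h.2.1, epi_g := h.2.2 }⟩

theorem tensor_shortExact (X : Rep.{0} k G) [Module.Flat k X.V] (S : ShortComplex (Rep.{0} k G))
    (hS : S.ShortExact) : (S.map (tensorLeft X)).ShortExact := by
  obtain ⟨h1, h2, h3⟩ := (rep_shortExact_iff' S).1 hS
  refine (rep_shortExact_iff' _).2 ⟨?_, ?_, ?_⟩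
  · have hex : Function.Exact S.f.hom.toLinearMap S.g.hom.toLinearMap := by
      intro y
      refine ⟨fun h => h1 y h, ?_⟩
      rintro ⟨x, rfl⟩
      exact congrArg (fun f => f.hom x) S.zero
    have := lTensor_exact X.V hex h3
    intro x hx
    exact (this x).1 hx
  · exact Module.Flat.lTensor_preserves_injective_linearMap S.f.hom.toLinearMap h2
  · exact LinearMap.lTensor_surjective X.V h3

theorem tensor_preservesHomology (X : Rep.{0} k G) [Module.Flat k X.V] :
    (tensorLeft X).PreservesHomology :=
  ((Functor.exact_tfae (tensorLeft X)).out 0 2).1 (tensor_shortExact X)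

theorem tensor_epi (X : Rep.{0} k G) {A B : Rep.{0} k G} (f : A ⟶ B) [Epi f] : Epi (X ◁ f) := by
  rw [Rep.epi_iff_surjective]
  exact LinearMap.lTensor_surjective X.V ((Rep.epi_iff_surjective f).1 inferInstance)

theorem tensor_act_triv (X A : Rep.{0} k G) (g : G) (h : ∀ a, X.ρ g a = a) (h' : ∀ a, A.ρ g a = a)
    (a : (X ⊗ A : Rep.{0} k G)) : (X ⊗ A : Rep.{0} k G).ρ g a = a := by
  change TensorProduct.map (X.ρ g) (A.ρ g) a = a
  have e1 : X.ρ g = LinearMap.id := LinearMap.ext h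
  have e2 : A.ρ g = LinearMap.id := LinearMap.ext h'
  rw [e1, e2, TensorProduct.map_id]; rfl
end tens

section
variable {G : Type} [Group G] {N : Subgroup G} {π : Set ℕ}
theorem PC.tensor {X : Rep.{0} ℤ G} (hX : NiceAb π X) (ht : NTriv N X) {Y : Rep.{0} ℤ G}
    (hY : PC N π Y) : PC N π (X ⊗ Y) := by
  have := NiceAb.flat (mX := X.hV2) hX
  induction hY with
  | nice A h ht' =>
    refine .nice _ ?_ ?_
    · exact NiceAb.tensor (mX := X.hV2) (mY := A.hV2) hX h
    · intro g hg a
      exact tensor_act_triv X A g (ht g hg) (ht' g hg) a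
  | quot A B f hf hA ih => exact .quot _ _ (X ◁ f) (tensor_epi X f) ih
  | ext S hS h1 h3 ih1 ih3 => exact .ext _ (tensor_shortExact X S hS) ih1 ih3
end
end HNil

namespace HNil
open CategoryTheory.Limits MonoidalCategory

section fsup
variable {k : Type} [CommRing k] {G : Type} [Group G]

/-- weighted map on finitely supported functions -/
def wmap {S T M M' : Type} [AddCommGroup M] [Module k M] [AddCommGroup M'] [Module k M']
    (f : S → T) (c : S → M →ₗ[k] M') : (S →₀ M) →ₗ[k] (T →₀ M') :=
  Finsupp.lsum k (fun s => Finsupp.lsingle (f s) ∘ₗ c s)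

@[simp] theorem wmap_single {S T M M' : Type} [AddCommGroup M] [Module k M] [AddCommGroup M']
    [Module k M'] (f : S → T) (c : S → M →ₗ[k] M') (s : S) (m : M) :
    wmap f c (Finsupp.single s m) = Finsupp.single (f s) (c s m) := by
  simp [wmap]

/-- the representation on `S →₀ M` -/
def fs (S : Type) [MulAction G S] (M : Rep.{0} k G) : Rep.{0} k G :=
  Rep.of (X := S →₀ M.V) (ρ :=
    { toFun := fun g => wmap (fun s => g • s) (fun _ => M.ρ g)
      map_one' := by
        refine Finsupp.lhom_ext fun s m => ?_
        simp
      map_mul' := fun g h => by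
        refine Finsupp.lhom_ext fun s m => ?_
        simp [mul_smul] })

/-- basis-type elements -/
def sg {S : Type} [MulAction G S] (M : Rep.{0} k G) (s : S) (m : M.V) : (fs S M).V :=
  (Finsupp.single s m : S →₀ M.V)

theorem fs_ρ {S : Type} [MulAction G S] {M : Rep.{0} k G} (g : G) (s : S) (m : M.V) :
    (fs S M).ρ g (sg M s m) = sg M (g • s) (M.ρ g m) := wmap_single _ _ _ _

/-- equivariant weighted maps -/
def fsHom {S T : Type} [MulAction G S] [MulAction G T] {M M' : Rep.{0} k G}
    (f : S → T) (c : S → M.V →ₗ[k] M'.V) (hf : ∀ (g : G) s, f (g • s) = g • f s)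
    (hc : ∀ (g : G) s m, c (g • s) (M.ρ g m) = M'.ρ g (c s m)) : fs S M ⟶ fs T M' :=
  Rep.ofHom ⟨wmap f c, fun g => Finsupp.lhom_ext fun s m => by
    change wmap f c (wmap _ _ _) = wmap _ _ (wmap f c _)
    rw [wmap_single, wmap_single, wmap_single, wmap_single, hf, hc]⟩

theorem fsHom_sg {S T : Type} [MulAction G S] [MulAction G T] {M M' : Rep.{0} k G}
    (f : S → T) (c : S → M.V →ₗ[k] M'.V) (hf : ∀ (g : G) s, f (g • s) = g • f s)
    (hc : ∀ (g : G) s m, c (g • s) (M.ρ g m) = M'.ρ g (c s m)) (s : S) (m : M.V) :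
    (fsHom f c hf hc).hom (sg M s m) = sg M' (f s) (c s m) := wmap_single _ _ _ _

theorem fs_ext {S : Type} [MulAction G S] {M A : Rep.{0} k G} {f g : fs S M ⟶ A}
    (h : ∀ s m, f.hom (sg M s m) = g.hom (sg M s m)) : f = g := by
  apply Rep.hom_ext
  apply Representation.IntertwiningMap.ext
  have : f.hom.toLinearMap = g.hom.toLinearMap := Finsupp.lhom_ext fun s m => h s m
  exact this

theorem rep_comp {A B C : Rep.{0} k G} (f : A ⟶ B) (g : B ⟶ C) (x : A) :
    (f ≫ g).hom x = g.hom (f.hom x) := rfl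

theorem rep_id {A : Rep.{0} k G} (x : A) : (𝟙 A : A ⟶ A).hom x = x := rfl
end fsup

section Smodel
variable {G : Type} [Group G] {E : Type} [Group E] [MulDistribMulAction G E]

/-- normalized simplices -/
def Sx (E : Type) [Group E] (n : ℕ) : Type := {w : Fin (n + 1) → E // w 0 = 1}

theorem Sx.ext {n : ℕ} {x y : Sx E n} (h : ∀ i, x.1 i = y.1 i) : x = y := Subtype.ext (funext h)

instance {n : ℕ} : MulAction G (Sx E n) where
  smul g x := ⟨fun i => g • x.1 i, by change g • x.1 0 = 1; rw [x.2, smul_one]⟩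
  one_smul x := Sx.ext fun i => one_smul _ _
  mul_smul g h x := Sx.ext fun i => mul_smul _ _ _

theorem Sx.smul_val {n : ℕ} (g : G) (x : Sx E n) (i) : (g • x).1 i = g • x.1 i := rfl

def nrm {n : ℕ} (w : Fin (n + 1) → E) : Sx E n := ⟨fun i => (w 0)⁻¹ * w i, by simp⟩

theorem nrm_val {n : ℕ} (w : Fin (n + 1) → E) (i) : (nrm w).1 i = (w 0)⁻¹ * w i := rfl

theorem nrm_self {n : ℕ} (x : Sx E n) : nrm x.1 = x := Sx.ext fun i => by
  rw [nrm_val, x.2, inv_one, one_mul]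

theorem nrm_mul {n : ℕ} (e : E) (w : Fin (n + 1) → E) : nrm (fun i => e * w i) = nrm w :=
  Sx.ext fun i => by rw [nrm_val, nrm_val, mul_inv_rev, mul_assoc, inv_mul_cancel_left]

theorem nrm_smul {n : ℕ} (g : G) (w : Fin (n + 1) → E) : nrm (fun i => g • w i) = g • nrm w :=
  Sx.ext fun i => by rw [nrm_val, Sx.smul_val, nrm_val, smul_mul', smul_inv']

def pullS {m n : ℕ} (θ : Fin (m + 1) → Fin (n + 1)) (x : Sx E n) : Sx E m := nrm (x.1 ∘ θ)

theorem pullS_val {m n : ℕ} (θ : Fin (m + 1) → Fin (n + 1)) (x : Sx E n) (i) :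
    (pullS θ x).1 i = (x.1 (θ 0))⁻¹ * x.1 (θ i) := rfl

theorem pullS_id {n : ℕ} (x : Sx E n) : pullS id x = x := nrm_self x

theorem pullS_comp {l m n : ℕ} (θ : Fin (m + 1) → Fin (n + 1)) (ψ : Fin (l + 1) → Fin (m + 1))
    (x : Sx E n) : pullS (θ ∘ ψ) x = pullS ψ (pullS θ x) := Sx.ext fun i => by
  simp only [pullS_val, Function.comp, mul_inv_rev, inv_inv, mul_assoc, mul_inv_cancel_left]

theorem pullS_smul {m n : ℕ} (θ : Fin (m + 1) → Fin (n + 1)) (g : G) (x : Sx E n) :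
    pullS θ (g • x) = g • pullS θ x := nrm_smul g (x.1 ∘ θ)

/-- semidirect product -/
abbrev Sd (G E : Type) [Group G] [Group E] [MulDistribMulAction G E] : Type :=
  E ⋊[MulDistribMulAction.toMulAut G E] G

def sinl (G : Type) {E : Type} [Group G] [Group E] [MulDistribMulAction G E] : E →* Sd G E :=
  SemidirectProduct.inl
def sinr {G : Type} (E : Type) [Group G] [Group E] [MulDistribMulAction G E] : G →* Sd G E :=
  SemidirectProduct.inr

theorem sinl_smul (g : G) (e : E) : sinl G (g • e) * sinr E g = sinr E g * sinl G e := by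
  have := SemidirectProduct.inl_aut (φ := MulDistribMulAction.toMulAut G E) g e
  change SemidirectProduct.inl ((MulDistribMulAction.toMulAut G E) g e) * _ = _
  rw [this]
  simp [sinl, sinr]

variable {k : Type} [CommRing k]

theorem ρ_inl_inr (M : Rep.{0} k (Sd G E)) (g : G) (e : E) (m : M.V) :
    M.ρ (sinl G (g • e)) (M.ρ (sinr E g) m) = M.ρ (sinr E g) (M.ρ (sinl G e) m) := by
  rw [← Module.End.mul_apply, ← Module.End.mul_apply, ← map_mul, ← map_mul, sinl_smul]

/-- the simplicial object computing the homology of `E` with coefficients in `M` -/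
def XsObj (M : Rep.{0} k (Sd G E)) : SimplicialObject (Rep.{0} k G) where
  obj Δ := fs (Sx E Δ.unop.len) (Rep.res (sinr E) M)
  map θ := fsHom (pullS θ.unop.toOrderHom)
    (fun w => M.ρ (sinl G (w.1 (θ.unop.toOrderHom 0))⁻¹))
    (fun g w => pullS_smul _ g w)
    (fun g w m => by
      rw [Sx.smul_val, ← smul_inv']
      exact ρ_inl_inr M g _ m)
  map_id Δ := fs_ext fun w m => by
    rw [fsHom_sg]
    change sg (Rep.res (sinr E) M) (pullS id w) (M.ρ (sinl G (w.1 0)⁻¹) m) =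
      sg (Rep.res (sinr E) M) w m
    rw [pullS_id, w.2, inv_one, map_one, map_one]; rfl
  map_comp θ ψ := fs_ext fun w m => by
    rw [rep_comp, fsHom_sg, fsHom_sg, fsHom_sg]
    change sg (Rep.res (sinr E) M) (pullS (θ.unop.toOrderHom ∘ ψ.unop.toOrderHom) w) _ = _
    rw [pullS_comp]
    congr 1
    rw [pullS_val]
    change _ = (M.ρ _ * M.ρ _) m
    rw [← map_mul, ← map_mul, mul_inv_rev, inv_inv, mul_assoc, mul_inv_cancel, mul_one]
    rfl

theorem XsObj_map (M : Rep.{0} k (Sd G E)) {Δ Δ' : SimplexCategoryᵒᵖ} (θ : Δ ⟶ Δ')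
    (w : Sx E Δ.unop.len) (m : M.V) :
    ((XsObj M).map θ).hom (sg (Rep.res (sinr E) M) w m) =
      sg (Rep.res (sinr E) M) (pullS θ.unop.toOrderHom w)
        (M.ρ (sinl G (w.1 (θ.unop.toOrderHom 0))⁻¹) m) := wmap_single _ _ _ _

/-- functoriality in `M`, one degree -/
def XsApp {M M' : Rep.{0} k (Sd G E)} (f : M ⟶ M') (Δ : SimplexCategoryᵒᵖ) :
    (XsObj M).obj Δ ⟶ (XsObj M').obj Δ :=
  fsHom id (fun _ => f.hom.toLinearMap) (fun _ _ => rfl)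
        (fun g _ m => Rep.hom_comm_apply f (sinr E g) m)

theorem XsApp_sg {M M' : Rep.{0} k (Sd G E)} (f : M ⟶ M') (Δ : SimplexCategoryᵒᵖ)
    (w : Sx E Δ.unop.len) (m : M.V) :
    (XsApp f Δ).hom (sg (Rep.res (sinr E) M) w m) = sg (Rep.res (sinr E) M') w (f.hom m) :=
  fsHom_sg _ _ _ _ _ _

/-- the functor `M ↦ XsObj M` -/
def Xs (k G E : Type) [CommRing k] [Group G] [Group E] [MulDistribMulAction G E] :
    Rep.{0} k (Sd G E) ⥤ SimplicialObject (Rep.{0} k G) where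
  obj M := XsObj M
  map {M M'} f :=
    { app := XsApp f
      naturality := fun Δ Δ' θ => fs_ext fun w m =>
        (congrArg (XsApp f Δ').hom (XsObj_map M θ w m)).trans <| (XsApp_sg f Δ' _ _).trans <|
          Eq.symm <| (congrArg ((XsObj M').map θ).hom (XsApp_sg f Δ w m)).trans <|
          (XsObj_map M' θ w _).trans <| congrArg (sg _ _) (Rep.hom_comm_apply f _ m).symm }
  map_id M := by
    apply NatTrans.ext; funext Δ
    exact fs_ext fun w m => XsApp_sg _ _ _ _
  map_comp f g := by
    apply NatTrans.ext; funext Δ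
    exact fs_ext fun w m => (XsApp_sg _ _ _ _).trans <| Eq.symm <|
      (congrArg (XsApp g Δ).hom (XsApp_sg f Δ w m)).trans (XsApp_sg _ _ _ _)

instance : (Xs k G E).Additive where
  map_add {M M' f g} := by
    apply NatTrans.ext; funext Δ
    refine fs_ext fun w m => (XsApp_sg (f + g) Δ w m).trans ?_
    refine Eq.trans ?_ (congrArg₂ (· + ·) (XsApp_sg f Δ w m) (XsApp_sg g Δ w m)).symm
    exact Finsupp.single_add _ _ _

/-- chain complex version -/
def Xc (k G E : Type) [CommRing k] [Group G] [Group E] [MulDistribMulAction G E] :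
    Rep.{0} k (Sd G E) ⥤ ChainComplex (Rep.{0} k G) ℕ :=
  Xs k G E ⋙ alternatingFaceMapComplex _

instance : (Xc k G E).Additive := by unfold Xc; infer_instance

section
variable {S M M' M'' : Type} [AddCommGroup M] [Module k M] [AddCommGroup M'] [Module k M']
  [AddCommGroup M''] [Module k M'']

theorem wmap_id_eq (f : M →ₗ[k] M') :
    (wmap id (fun _ => f) : (S →₀ M) →ₗ[k] (S →₀ M')) = Finsupp.mapRange.linearMap f :=
  Finsupp.lhom_ext fun s m => by simp

theorem wmap_id_inj (f : M →ₗ[k] M') (hf : Function.Injective f) :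
    Function.Injective (wmap id (fun _ => f) : (S →₀ M) →ₗ[k] (S →₀ M')) := by
  rw [wmap_id_eq]; exact Finsupp.mapRange_injective f (map_zero f) hf

theorem wmap_id_surj (f : M →ₗ[k] M') (hf : Function.Surjective f) :
    Function.Surjective (wmap id (fun _ => f) : (S →₀ M) →ₗ[k] (S →₀ M')) := by
  rw [wmap_id_eq]; exact Finsupp.mapRange_surjective f (map_zero f) hf

theorem wmap_id_exact (f : M →ₗ[k] M') (g : M' →ₗ[k] M'') (h : ∀ x, g x = 0 → ∃ y, f y = x)
    (x : S →₀ M') (hx : wmap id (fun _ => g) x = 0) : ∃ y : S →₀ M, wmap id (fun _ => f) y = x := by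
  rw [wmap_id_eq] at hx ⊢
  have hx' : ∀ s, g (x s) = 0 := fun s => DFunLike.congr_fun hx s
  choose u hu using h
  refine ⟨x.support.sum fun s => Finsupp.single s (u (x s) (hx' s)), ?_⟩
  rw [map_sum]
  simp only [Finsupp.mapRange.linearMap_apply, Finsupp.mapRange_single, hu]
  exact Finsupp.sum_single x
end

theorem Xs_exact (S : ShortComplex (Rep.{0} k (Sd G E))) (hS : S.ShortExact) (Δ) :
    (S.map (Xs k G E ⋙ (evaluation _ _).obj Δ)).ShortExact := by
  obtain ⟨h1, h2, h3⟩ := (rep_shortExact_iff' S).1 hS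
  refine (rep_shortExact_iff' _).2 ⟨?_, ?_, ?_⟩
  · exact wmap_id_exact S.f.hom.toLinearMap S.g.hom.toLinearMap h1
  · exact wmap_id_inj S.f.hom.toLinearMap h2
  · exact wmap_id_surj S.g.hom.toLinearMap h3

theorem Xc_exact : ExactF (Xc k G E) := fun S hS =>
  HomologicalComplex.shortExact_of_degreewise_shortExact _ (fun i => Xs_exact S hS _)

end Smodel

end HNil

namespace HNil
open CategoryTheory.Limits MonoidalCategory

section uct1
instance {E : Type} [Group E] {n : ℕ} : DecidableEq (Sx E n) := Classical.decEq _
variable {k : Type} [CommRing k] {G : Type} [Group G] {E : Type} [Group E] [MulDistribMulAction G E]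

/-- projection -/
def sproj (G E : Type) [Group G] [Group E] [MulDistribMulAction G E] : Sd G E →* G :=
  SemidirectProduct.rightHom

theorem sproj_inl (e : E) : sproj G E (sinl G e) = 1 := SemidirectProduct.rightHom_inl e
theorem sproj_inr (g : G) : sproj G E (sinr E g) = g := SemidirectProduct.rightHom_inr g

/-- inflation -/
def Infl (k G E : Type) [CommRing k] [Group G] [Group E] [MulDistribMulAction G E] :
    Rep.{0} k G ⥤ Rep.{0} k (Sd G E) := Rep.resFunctor (sproj G E)

instance : (Infl k G E).Additive := by unfold Infl; infer_instance

theorem Infl_shortExact (S : ShortComplex (Rep.{0} k G)) (hS : S.ShortExact) :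
    (S.map (Infl k G E)).ShortExact :=
  (rep_shortExact_iff' _).2 ((rep_shortExact_iff' S).1 hS)

/-- trivial coefficients -/
abbrev tr (k G : Type) [CommRing k] [Group G] : Rep.{0} k G := Rep.trivial k G k

theorem tens_aux {M S : Type} [AddCommGroup M] [Module k M] [DecidableEq S]
    (a : M →ₗ[k] M) (f : S → S) (w : S) (m : M) :
    (TensorProduct.finsuppScalarRight k k M S).symm (wmap f (fun _ => a) (Finsupp.single w m)) =
      TensorProduct.map a (wmap f (fun _ => LinearMap.id))
        ((TensorProduct.finsuppScalarRight k k M S).symm (Finsupp.single w m)) := by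
  rw [wmap_single, TensorProduct.finsuppScalarRight_symm_apply_single,
        TensorProduct.finsuppScalarRight_symm_apply_single, TensorProduct.map_tmul, wmap_single]
  rfl

/-- the tensor comparison -/
def tensApp (A : Rep.{0} k G) (Δ : SimplexCategoryᵒᵖ) :
    ((Xs k G E).obj ((Infl k G E).obj A)).obj Δ ⟶
      A ⊗ ((Xs k G E).obj ((Infl k G E).obj (tr k G))).obj Δ :=
  Rep.ofHom ⟨((TensorProduct.finsuppScalarRight k k A.V (Sx E Δ.unop.len)).symm).toLinearMap,
    fun g => Finsupp.lhom_ext fun w m => by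
      exact tens_aux (A.ρ g) (fun w : Sx E Δ.unop.len => g • w) w m⟩

theorem tensApp_sg (A : Rep.{0} k G) (Δ : SimplexCategoryᵒᵖ) (w : Sx E Δ.unop.len) (m : A.V) :
    (tensApp (E := E) A Δ).hom (sg (Rep.res (sinr E) ((Infl k G E).obj A)) w m) =
      TensorProduct.tmul k m (Finsupp.single w (1 : k)) :=
  TensorProduct.finsuppScalarRight_symm_apply_single _ _

theorem tensApp_isIso (A : Rep.{0} k G) (Δ : SimplexCategoryᵒᵖ) : IsIso (tensApp (E := E) A Δ) := by
  have h : Function.Bijective (tensApp (E := E) A Δ).hom :=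
    (TensorProduct.finsuppScalarRight k k A.V (Sx E Δ.unop.len)).symm.bijective
  have := (Rep.mono_iff_injective _).2 h.1
  have := (Rep.epi_iff_surjective _).2 h.2
  exact isIso_of_mono_of_epi _

def tensIso (A : Rep.{0} k G) : (Xs k G E).obj ((Infl k G E).obj A) ≅
    ((SimplicialObject.whiskering _ _).obj (tensorLeft A)).obj
      ((Xs k G E).obj ((Infl k G E).obj (tr k G))) :=
  NatIso.ofComponents (fun Δ => @asIso _ _ _ _ _ (tensApp_isIso A Δ)) (fun {Δ Δ'} θ => fs_ext fun w m => by
    refine (congrArg (tensApp A Δ').hom (XsObj_map ((Infl k G E).obj A) θ w m)).trans ?_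
    refine (tensApp_sg A Δ' _ _).trans ?_
    refine Eq.trans ?_ (congrArg (A ◁ ((XsObj ((Infl k G E).obj (tr k G))).map θ)).hom
      (tensApp_sg A Δ w m)).symm
    change _ = TensorProduct.tmul k m (((XsObj ((Infl k G E).obj (tr k G))).map θ).hom
      (sg (Rep.res (sinr E) ((Infl k G E).obj (tr k G))) w (1 : k)))
    refine Eq.trans ?_ (congrArg (TensorProduct.tmul k m)
      (XsObj_map ((Infl k G E).obj (tr k G)) θ w (1 : k))).symm
    change TensorProduct.tmul k (A.ρ (sproj G E (sinl G _)) m) _ = _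
    rw [sproj_inl, map_one]
    rfl)

/-- homology with coefficients in a `G`-module -/
abbrev HX (k G E : Type) [CommRing k] [Group G] [Group E] [MulDistribMulAction G E] (n : ℕ) :
    Rep.{0} k G ⥤ Rep.{0} k G := Infl k G E ⋙ HF (Xc k G E) n

/-- homology of `E` -/
abbrev Hn (k G E : Type) [CommRing k] [Group G] [Group E] [MulDistribMulAction G E] (n : ℕ) :
    Rep.{0} k G := (HX k G E n).obj (tr k G)

def uctIso (A : Rep.{0} k G) [Module.Flat k A.V] (n : ℕ) :
    (HX k G E n).obj A ≅ A ⊗ Hn k G E n :=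
  have := tensor_preservesHomology A
  (HomologicalComplex.homologyFunctor _ _ n).mapIso
    ((alternatingFaceMapComplex _).mapIso (tensIso A) ≪≫
      (eqToIso (Functor.congr_obj (map_alternatingFaceMapComplex (tensorLeft A)).symm _))) ≪≫
    ShortComplex.mapHomologyIso (((Xc k G E).obj ((Infl k G E).obj (tr k G))).sc n) (tensorLeft A)
end uct1

section uct2
variable {G : Type} [Group G] {E : Type} [Group E] [MulDistribMulAction G E]
  {N : Subgroup G} {π : Set ℕ}

theorem uct (n : ℕ) : (∀ i ≤ n, PC N π (Hn ℤ G E i)) → ∀ A, PC N π A → PC N π ((HX ℤ G E n).obj A) := by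
  induction n with
  | zero =>
    intro h A hA
    induction hA with
    | nice A hA ht =>
      have := NiceAb.flat (mX := A.hV2) hA
      exact (PP N π).prop_of_iso (uctIso A 0).symm (PC.tensor hA ht (h 0 le_rfl))
    | quot A B f hf hA ih =>
      have hS : (ShortComplex.mk (kernel.ι f) f (kernel.condition f)).ShortExact :=
        { exact := ShortComplex.exact_kernel f }
      have := HF_epi (X := Xc ℤ G E) Xc_exact (Infl_shortExact (E := E) _ hS)
      exact .quot _ _ _ this ih
    | ext S hS h1 h3 ih1 ih3 =>
      exact (PP N π).prop_X₂_of_exact (HF_mid (X := Xc ℤ G E) Xc_exact 0 (Infl_shortExact (E := E) _ hS)) ih1 ih3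
  | succ n IH =>
    intro h A hA
    induction hA with
    | nice A hA ht =>
      have := NiceAb.flat (mX := A.hV2) hA
      exact (PP N π).prop_of_iso (uctIso A _).symm (PC.tensor hA ht (h _ le_rfl))
    | quot A B f hf hA ih =>
      have hS : (ShortComplex.mk (kernel.ι f) f (kernel.condition f)).ShortExact :=
        { exact := ShortComplex.exact_kernel f }
      have := HF_exact₃ (X := Xc ℤ G E) Xc_exact n (Infl_shortExact (E := E) _ hS)
      exact (PP N π).prop_X₂_of_exact this ih (IH (fun i hi => h i (by lia)) _
        (hA.of_mono (kernel.ι f) inferInstance))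
    | ext S hS h1 h3 ih1 ih3 =>
      exact (PP N π).prop_X₂_of_exact (HF_mid (X := Xc ℤ G E) Xc_exact _ (Infl_shortExact (E := E) _ hS)) ih1 ih3
end uct2
end HNil

namespace HNil
open CategoryTheory.Limits MonoidalCategory Simplicial

set_option linter.unusedVariables false
section cls
variable {k : Type} [CommRing k] {G : Type} [Group G]
variable (K L : ChainComplex (Rep.{0} k G) ℕ)

theorem cyc_exists (n : ℕ) (x : K.X n) (hx : (K.d n (n - 1)).hom x = 0) :
    ∃ z : K.cycles n, (K.iCycles n).hom z = x := by
  have h : (ComplexShape.down ℕ).next n = n - 1 := by cases n <;> simp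
  have hk := K.cyclesIsKernel n (n - 1) h
  have hex : (ShortComplex.mk (K.iCycles n) (K.d n (n - 1)) (K.iCycles_d n (n - 1))).Exact :=
    ShortComplex.exact_of_f_is_kernel _ hk
  exact (rep_exact_iff' _).1 hex x hx

theorem icyc_inj (n : ℕ) : Function.Injective (K.iCycles n).hom :=
  (Rep.mono_iff_injective _).1 inferInstance

/-- the class of a cycle -/
def cl (n : ℕ) (x : K.X n) (hx : (K.d n (n - 1)).hom x = 0) : K.homology n :=
  (K.homologyπ n).hom (cyc_exists K n x hx).choose

variable {K L}
theorem cl_eq {n : ℕ} {x : K.X n} (hx : (K.d n (n - 1)).hom x = 0) (z : K.cycles n)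
    (hz : (K.iCycles n).hom z = x) : cl K n x hx = (K.homologyπ n).hom z :=
  congrArg _ (icyc_inj K n ((cyc_exists K n x hx).choose_spec.trans hz.symm))

theorem cl_surj {n : ℕ} (h : K.homology n) : ∃ x hx, cl K n x hx = h := by
  obtain ⟨z, rfl⟩ := (Rep.epi_iff_surjective (K.homologyπ n)).1 inferInstance h
  refine ⟨(K.iCycles n).hom z, ?_, cl_eq _ z rfl⟩
  exact congrArg (fun f => f.hom z) (K.iCycles_d n (n - 1))

theorem cl_zero_iff {n : ℕ} {x : K.X n} (hx : (K.d n (n - 1)).hom x = 0) :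
    cl K n x hx = 0 ↔ ∃ y : K.X (n + 1), (K.d (n + 1) n).hom y = x := by
  obtain ⟨z, hz⟩ := cyc_exists K n x hx
  rw [cl_eq hx z hz]
  have hex := ShortComplex.exact_of_g_is_cokernel
    (ShortComplex.mk (K.toCycles (n + 1) n) (K.homologyπ n) (K.toCycles_comp_homologyπ _ _))
    (K.homologyIsCokernel (n + 1) n (by simp))
  constructor
  · intro h
    obtain ⟨y, hy⟩ := (rep_exact_iff' _).1 hex z h
    refine ⟨y, ?_⟩
    rw [← hz, ← hy]
    exact congrArg (fun f => f.hom y) (K.toCycles_i (n + 1) n).symm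
  · rintro ⟨y, hy⟩
    have : (K.toCycles (n + 1) n).hom y = z := icyc_inj K n (by
      refine Eq.trans ?_ (hy.trans hz.symm)
      exact congrArg (fun f => f.hom y) (K.toCycles_i (n + 1) n))
    rw [← this]
    exact congrArg (fun f => f.hom y) (K.toCycles_comp_homologyπ (n + 1) n)

theorem cl_congr {n : ℕ} {x y : K.X n} (h : x = y) (hx : (K.d n (n - 1)).hom x = 0)
    (hy : (K.d n (n - 1)).hom y = 0) : cl K n x hx = cl K n y hy := by subst h; rfl

theorem cyc_sub {n : ℕ} {x y : K.X n} (hx : (K.d n (n - 1)).hom x = 0)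
    (hy : (K.d n (n - 1)).hom y = 0) : (K.d n (n - 1)).hom (x - y) = 0 := by
  rw [map_sub, hx, hy, sub_zero]

theorem cl_sub {n : ℕ} {x y : K.X n} (hx : (K.d n (n - 1)).hom x = 0)
    (hy : (K.d n (n - 1)).hom y = 0) : cl K n (x - y) (cyc_sub hx hy) = cl K n x hx - cl K n y hy := by
  obtain ⟨z, hz⟩ := cyc_exists K n x hx
  obtain ⟨w, hw⟩ := cyc_exists K n y hy
  rw [cl_eq hx z hz, cl_eq hy w hw, cl_eq _ (z - w) (by rw [map_sub, hz, hw]), map_sub]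

theorem cl_eq_iff {n : ℕ} {x y : K.X n} (hx : (K.d n (n - 1)).hom x = 0)
    (hy : (K.d n (n - 1)).hom y = 0) :
    cl K n x hx = cl K n y hy ↔ ∃ b : K.X (n + 1), (K.d (n + 1) n).hom b = x - y := by
  rw [← sub_eq_zero, ← cl_sub, cl_zero_iff]

theorem map_cyc (φ : K ⟶ L) {n : ℕ} {x : K.X n} (hx : (K.d n (n - 1)).hom x = 0) :
    (L.d n (n - 1)).hom ((φ.f n).hom x) = 0 := by
  have h : (φ.f n ≫ L.d n (n - 1)).hom x = (K.d n (n - 1) ≫ φ.f (n - 1)).hom x := by rw [φ.comm]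
  refine h.trans ?_
  rw [rep_comp, hx, map_zero]

theorem cl_map (φ : K ⟶ L) {n : ℕ} {x : K.X n} (hx : (K.d n (n - 1)).hom x = 0) :
    (HomologicalComplex.homologyMap φ n).hom (cl K n x hx) = cl L n ((φ.f n).hom x) (map_cyc φ hx) := by
  obtain ⟨z, hz⟩ := cyc_exists K n x hx
  rw [cl_eq hx z hz, cl_eq _ ((HomologicalComplex.cyclesMap φ n).hom z)]
  · exact congrArg (fun f => f.hom z) (HomologicalComplex.homologyπ_naturality φ n)
  · rw [← hz]
    exact congrArg (fun f => f.hom z) (HomologicalComplex.cyclesMap_i φ n)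

theorem ρ_cyc (g : G) {n : ℕ} {x : K.X n} (hx : (K.d n (n - 1)).hom x = 0) :
    (K.d n (n - 1)).hom ((K.X n).ρ g x) = 0 := by
  rw [Rep.hom_comm_apply, hx, map_zero]

theorem cl_ρ (g : G) {n : ℕ} {x : K.X n} (hx : (K.d n (n - 1)).hom x = 0) :
    (K.homology n).ρ g (cl K n x hx) = cl K n ((K.X n).ρ g x) (ρ_cyc g hx) := by
  obtain ⟨z, hz⟩ := cyc_exists K n x hx
  rw [cl_eq hx z hz, cl_eq _ ((K.cycles n).ρ g z), Rep.hom_comm_apply]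
  rw [Rep.hom_comm_apply, hz]
end cls

/-- simplicial sets with group action -/
structure GS (H : Type) [Group H] where
  Y : ℕ → Type
  act : ∀ n, MulAction H (Y n)
  pl : ∀ {m n : ℕ}, (Fin (m + 1) →o Fin (n + 1)) → Y n → Y m
  pl_id : ∀ {n : ℕ} (y : Y n), pl OrderHom.id y = y
  pl_comp : ∀ {l m n : ℕ} (θ : Fin (m + 1) →o Fin (n + 1)) (ψ : Fin (l + 1) →o Fin (m + 1)) (y : Y n),
    pl (θ.comp ψ) y = pl ψ (pl θ y)
  pl_smul : ∀ {m n : ℕ} (θ : Fin (m + 1) →o Fin (n + 1)) (h : H) (y : Y n), pl θ (h • y) = h • pl θ y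

attribute [instance] GS.act

section lin
variable {k : Type} [CommRing k] {H : Type} [Group H]

/-- set maps -/
def fsS (k : Type) [CommRing k] {S T : Type} [MulAction H S] [MulAction H T] (f : S → T)
    (hf : ∀ (g : H) s, f (g • s) = g • f s) :
    fs S (tr k H) ⟶ fs T (tr k H) := fsHom f (fun _ => LinearMap.id) hf (fun _ _ _ => rfl)

theorem fsS_sg {S T : Type} [MulAction H S] [MulAction H T] (f : S → T)
    (hf : ∀ (g : H) s, f (g • s) = g • f s) (s : S) (a : k) :
    (fsS k f hf).hom (sg (tr k H) s a) = sg (tr k H) (f s) a := fsHom_sg _ _ _ _ _ _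

theorem fsS_eq {S T : Type} [MulAction H S] [MulAction H T] (f g : S → T)
    (hf : ∀ (g : H) s, f (g • s) = g • f s) (hg) (h : ∀ s, f s = g s) :
    fsS k f hf = fsS k g hg := by
  obtain rfl : f = g := funext h
  rfl

theorem fsS_id {S : Type} [MulAction H S] (f : S → S)
    (hf : ∀ (g : H) s, f (g • s) = g • f s) (h : ∀ s, f s = s) :
    fsS k f hf = 𝟙 _ := fs_ext fun s a => by rw [fsS_sg, h]; rfl

theorem fsS_comp {S T U : Type} [MulAction H S] [MulAction H T] [MulAction H U] (f : S → T)
    (hf : ∀ (g : H) s, f (g • s) = g • f s) (g : T → U) (hg : ∀ (x : H) s, g (x • s) = x • g s) :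
    fsS k f hf ≫ fsS k g hg = fsS k (g ∘ f) (fun x s => by simp [hf, hg]) :=
  fs_ext fun s a => by rw [rep_comp, fsS_sg, fsS_sg, fsS_sg]; rfl

/-- linearization -/
def lin (k : Type) [CommRing k] (S : GS H) : SimplicialObject (Rep.{0} k H) where
  obj Δ := fs (S.Y Δ.unop.len) (tr k H)
  map θ := fsS k (S.pl θ.unop.toOrderHom) (fun g s => S.pl_smul _ g s)
  map_id Δ := fsS_id _ _ fun s => S.pl_id s
  map_comp θ ψ := (fsS_eq _ _ _ _ fun s => S.pl_comp θ.unop.toOrderHom ψ.unop.toOrderHom s).trans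
    (fsS_comp _ _ _ _).symm

/-- maps of linearizations -/
def linMap (k : Type) [CommRing k] {S T : GS H} (f : ∀ n, S.Y n → T.Y n)
    (hf : ∀ n (g : H) s, f n (g • s) = g • f n s)
    (hn : ∀ {m n : ℕ} (θ : Fin (m + 1) →o Fin (n + 1)) (y : S.Y n), f m (S.pl θ y) = T.pl θ (f n y)) :
    lin k S ⟶ lin k T where
  app Δ := fsS k (f Δ.unop.len) (hf _)
  naturality Δ Δ' θ := fs_ext fun s a =>
    (congrArg (fsS k (f Δ'.unop.len) (hf _)).hom (fsS_sg (S.pl θ.unop.toOrderHom) (fun g s => S.pl_smul _ g s) s a)).trans <|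
      (fsS_sg (f Δ'.unop.len) (hf _) _ a).trans <| Eq.symm <|
      (congrArg (fsS k (T.pl θ.unop.toOrderHom) (fun g s => T.pl_smul _ g s)).hom (fsS_sg (f Δ.unop.len) (hf _) s a)).trans <|
      (fsS_sg (T.pl θ.unop.toOrderHom) (fun g s => T.pl_smul _ g s) _ a).trans <|
      congrArg (fun y => sg (tr k H) y a) (hn θ.unop.toOrderHom s).symm

/-- chain complex -/
def lch (k : Type) [CommRing k] (S : GS H) : ChainComplex (Rep.{0} k H) ℕ :=
  (alternatingFaceMapComplex _).obj (lin k S)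

/-- underlying simplicial set -/
def GS.ss (S : GS H) : SimplicialObject Type where
  obj Δ := S.Y Δ.unop.len
  map θ := ↾(S.pl θ.unop.toOrderHom)
  map_id Δ := by ext y; exact S.pl_id y
  map_comp θ ψ := by ext y; exact S.pl_comp _ _ y

/-- the differential -/
def GS.D (S : GS H) (k : Type) [CommRing k] (n : ℕ) : (S.Y (n + 1) →₀ k) →ₗ[k] (S.Y n →₀ k) :=
  ∑ i : Fin (n + 2), ((-1) ^ (i : ℕ) : ℤ) • wmap (S.pl (SimplexCategory.δ i).toOrderHom)
    (fun _ => LinearMap.id)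

/-- evaluation -/
def ev {A B : Rep.{0} k H} (x : A) : (A ⟶ B) →+ B.V where
  toFun f := f.hom x
  map_zero' := rfl
  map_add' _ _ := rfl

theorem lch_d (S : GS H) (n : ℕ) (x : S.Y (n + 1) →₀ k) :
    ((lch k S).d (n + 1) n).hom x = S.D k n x := by
  have h : (lch k S).d (n + 1) n = AlternatingFaceMapComplex.objD (lin k S) n :=
    AlternatingFaceMapComplex.obj_d_eq _ _
  rw [h]
  change ev (A := (lin k S).obj (Opposite.op (SimplexCategory.mk (n + 1)))) x (AlternatingFaceMapComplex.objD (lin k S) n) = _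
  unfold AlternatingFaceMapComplex.objD GS.D
  rw [map_sum, LinearMap.sum_apply]
  refine Finset.sum_congr rfl fun i _ => ?_
  rw [map_zsmul]
  rfl

/-- differential with total indexing -/
def GS.Dm (S : GS H) (k : Type) [CommRing k] (n : ℕ) : (S.Y n →₀ k) →ₗ[k] (S.Y (n - 1) →₀ k) :=
  match n with
  | 0 => 0
  | n + 1 => S.D k n

theorem lch_dm (S : GS H) (n : ℕ) (x : S.Y n →₀ k) :
    ((lch k S).d n (n - 1)).hom x = S.Dm k n x := by
  cases n with
  | zero =>
    rw [(lch k S).shape 0 (0 - 1) (by simp)]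
    rfl
  | succ n => exact lch_d S n x

/-- the class of a cycle in the linearization -/
def GS.cls (S : GS H) (n : ℕ) (x : S.Y n →₀ k) (hx : S.Dm k n x = 0) : (lch k S).homology n :=
  cl (lch k S) n x ((lch_dm S n x).trans hx)

theorem GS.cls_surj (S : GS H) {n : ℕ} (h : (lch k S).homology n) :
    ∃ (x : S.Y n →₀ k) (hx : S.Dm k n x = 0), S.cls n x hx = h := by
  obtain ⟨x, hx, h⟩ := cl_surj h
  exact ⟨x, (lch_dm S n x).symm.trans hx, h⟩

theorem GS.cls_zero_iff (S : GS H) {n : ℕ} {x : S.Y n →₀ k} (hx : S.Dm k n x = 0) :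
    S.cls n x hx = 0 ↔ ∃ y : S.Y (n + 1) →₀ k, S.D k n y = x :=
  (cl_zero_iff _).trans ⟨fun ⟨y, h⟩ => ⟨y, (lch_d S n y).symm.trans h⟩,
    fun ⟨y, h⟩ => ⟨y, (lch_d S n y).trans h⟩⟩

theorem GS.cls_eq_iff (S : GS H) {n : ℕ} {x x' : S.Y n →₀ k} (hx : S.Dm k n x = 0)
    (hx' : S.Dm k n x' = 0) :
    S.cls n x hx = S.cls n x' hx' ↔ ∃ y : S.Y (n + 1) →₀ k, S.D k n y = x - x' :=
  (cl_eq_iff _ _).trans ⟨fun ⟨y, h⟩ => ⟨y, (lch_d S n y).symm.trans h⟩,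
    fun ⟨y, h⟩ => ⟨y, (lch_d S n y).trans h⟩⟩

/-- linear extension of a set map -/
abbrev lx (k : Type) [CommRing k] {S T : Type} (f : S → T) : (S →₀ k) →ₗ[k] (T →₀ k) :=
  wmap f (fun _ => LinearMap.id)

theorem lx_comp {S T U : Type} (f : S → T) (g : T → U) (x : S →₀ k) :
    lx k g (lx k f x) = lx k (g ∘ f) x := by
  have : (lx k g) ∘ₗ (lx k f) = lx k (g ∘ f) := Finsupp.lhom_ext fun s a => by simp
  exact DFunLike.congr_fun this x

theorem lx_id {S : Type} (x : S →₀ k) : lx k (id : S → S) x = x := by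
  have : lx k (id : S → S) = LinearMap.id := Finsupp.lhom_ext fun s a => by simp
  exact DFunLike.congr_fun this x

/-- induced map of complexes -/
def lchMap (k : Type) [CommRing k] {S T : GS H} (f : ∀ n, S.Y n → T.Y n)
    (hf : ∀ n (g : H) s, f n (g • s) = g • f n s)
    (hn : ∀ {m n : ℕ} (θ : Fin (m + 1) →o Fin (n + 1)) (y : S.Y n), f m (S.pl θ y) = T.pl θ (f n y)) :
    lch k S ⟶ lch k T := (alternatingFaceMapComplex _).map (linMap k f hf hn)

theorem D_nat {H' : Type} [Group H'] {S : GS H} {T : GS H'} (f : ∀ n, S.Y n → T.Y n)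
    (hn : ∀ {m n : ℕ} (θ : Fin (m + 1) →o Fin (n + 1)) (y : S.Y n), f m (S.pl θ y) = T.pl θ (f n y))
    (n : ℕ) (x : S.Y (n + 1) →₀ k) : T.D k n (lx k (f (n + 1)) x) = lx k (f n) (S.D k n x) := by
  unfold GS.D
  rw [LinearMap.sum_apply, LinearMap.sum_apply, map_sum]
  refine Finset.sum_congr rfl fun i _ => ?_
  rw [LinearMap.smul_apply, LinearMap.smul_apply, map_zsmul]
  refine congrArg _ ?_
  refine (lx_comp _ _ _).trans (Eq.trans ?_ (lx_comp _ _ _).symm)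
  exact congrArg (fun u => lx k u x) (funext fun y => (hn _ y).symm)

theorem Dm_nat {H' : Type} [Group H'] {S : GS H} {T : GS H'} (f : ∀ n, S.Y n → T.Y n)
    (hn : ∀ {m n : ℕ} (θ : Fin (m + 1) →o Fin (n + 1)) (y : S.Y n), f m (S.pl θ y) = T.pl θ (f n y))
    (n : ℕ) (x : S.Y n →₀ k) : T.Dm k n (lx k (f n) x) = lx k (f (n - 1)) (S.Dm k n x) := by
  cases n with
  | zero => exact (map_zero (lx k (f 0))).symm
  | succ n => exact D_nat f hn n x

theorem Dm_nat0 {H' : Type} [Group H'] {S : GS H} {T : GS H'} (f : ∀ n, S.Y n → T.Y n)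
    (hn : ∀ {m n : ℕ} (θ : Fin (m + 1) →o Fin (n + 1)) (y : S.Y n), f m (S.pl θ y) = T.pl θ (f n y))
    (n : ℕ) {x : S.Y n →₀ k} (hx : S.Dm k n x = 0) : T.Dm k n (lx k (f n) x) = 0 := by
  rw [Dm_nat f hn, hx, map_zero]

theorem cls_map {S T : GS H} (f : ∀ n, S.Y n → T.Y n)
    (hf : ∀ n (g : H) s, f n (g • s) = g • f n s)
    (hn : ∀ {m n : ℕ} (θ : Fin (m + 1) →o Fin (n + 1)) (y : S.Y n), f m (S.pl θ y) = T.pl θ (f n y))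
    (n : ℕ) (x : S.Y n →₀ k) (hx : S.Dm k n x = 0) :
    (HomologicalComplex.homologyMap (lchMap k f hf hn) n).hom (S.cls n x hx) =
      T.cls n (lx k (f n) x) (Dm_nat0 f hn n hx) := cl_map _ _

theorem GS.cls_ρ (S : GS H) (g : H) {n : ℕ} {x : S.Y n →₀ k} (hx : S.Dm k n x = 0) :
    ((lch k S).homology n).ρ g (S.cls n x hx) = S.cls n (lx k (fun y => g • y) x)
      (Dm_nat0 (fun n (y : S.Y n) => g • y) (fun θ y => (S.pl_smul θ g y).symm) n hx) := cl_ρ _ _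

end lin
end HNil

namespace HNil
open CategoryTheory.Limits MonoidalCategory Simplicial
set_option linter.unusedVariables false

set_option linter.unusedSectionVars false

/-- the trivial group -/
def U1 : Type := Unit
instance : Group U1 := inferInstanceAs (Group Unit)
instance : Subsingleton U1 := inferInstanceAs (Subsingleton Unit)

section Yq
variable {Z E : Type} [Group Z] [Group E]

/-- simplices of `E` modulo `Z` -/
def YR (i : Z →* E) (n : ℕ) : Setoid (Fin (n + 1) → E) where
  r w w' := ∃ z, ∀ a, w' a = i z * w a
  iseqv :=
    { refl := fun w => ⟨1, fun a => by simp⟩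
      symm := fun {w w'} ⟨z, h⟩ => ⟨z⁻¹, fun a => by simp [h]⟩
      trans := fun {w w' w''} ⟨z, h⟩ ⟨z', h'⟩ => ⟨z' * z, fun a => by simp [h, h', mul_assoc]⟩ }

def Yq (i : Z →* E) (n : ℕ) : Type := Quotient (YR i n)

def ymk (i : Z →* E) {n : ℕ} (w : Fin (n + 1) → E) : Yq i n := Quotient.mk (YR i n) w

theorem ymk_surj (i : Z →* E) {n : ℕ} (y : Yq i n) : ∃ w, ymk i w = y := Quotient.exists_rep y

theorem ymk_eq {i : Z →* E} {n : ℕ} {w w' : Fin (n + 1) → E} (z : Z) (h : ∀ a, w' a = i z * w a) :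
    ymk i w = ymk i w' := Quotient.sound ⟨z, h⟩

theorem ymk_exact {i : Z →* E} {n : ℕ} {w w' : Fin (n + 1) → E} (h : ymk i w = ymk i w') :
    ∃ z, ∀ a, w' a = i z * w a := Quotient.exact h

/-- lifting -/
def ylift {i : Z →* E} {n : ℕ} {T : Type} (f : (Fin (n + 1) → E) → T)
    (h : ∀ z w, f (fun a => i z * w a) = f w) : Yq i n → T :=
  Quotient.lift f (fun w w' ⟨z, hz⟩ => by rw [← h z w]; exact congrArg f (funext fun a => (hz a).symm))

@[simp] theorem ylift_mk {i : Z →* E} {n : ℕ} {T : Type} (f : (Fin (n + 1) → E) → T)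
    (h : ∀ z w, f (fun a => i z * w a) = f w) (w) : ylift f h (ymk i w) = f w := rfl

/-- functoriality in set maps -/
def YC {Z' E' : Type} [Group Z'] [Group E'] (i : Z →* E) (i' : Z' →* E') (α : E → E') : Prop :=
  ∀ z, ∃ z', ∀ x, α (i z * x) = i' z' * α x

def ymap {Z' E' : Type} [Group Z'] [Group E'] {i : Z →* E} {i' : Z' →* E'} (α : E → E')
    (h : YC i i' α) (n : ℕ) : Yq i n → Yq i' n :=
  ylift (fun w => ymk i' (fun a => α (w a))) (fun z w => by
    obtain ⟨z', hz⟩ := h z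
    exact (ymk_eq z' (fun a => hz (w a))).symm)

@[simp] theorem ymap_mk {Z' E' : Type} [Group Z'] [Group E'] {i : Z →* E} {i' : Z' →* E'} (α : E → E')
    (h : YC i i' α) (n : ℕ) (w : Fin (n + 1) → E) :
    ymap α h n (ymk i w) = ymk i' (fun a => α (w a)) := rfl

def ypl {i : Z →* E} {m n : ℕ} (θ : Fin (m + 1) → Fin (n + 1)) : Yq i n → Yq i m :=
  ylift (fun w => ymk i (w ∘ θ)) (fun z w => (ymk_eq z (fun a => rfl)).symm)

@[simp] theorem ypl_mk {i : Z →* E} {m n : ℕ} (θ : Fin (m + 1) → Fin (n + 1)) (w : Fin (n + 1) → E) :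
    ypl θ (ymk i w) = ymk i (w ∘ θ) := rfl

theorem ymap_pl {Z' E' : Type} [Group Z'] [Group E'] {i : Z →* E} {i' : Z' →* E'} (α : E → E')
    (h : YC i i' α) {m n : ℕ} (θ : Fin (m + 1) → Fin (n + 1)) (y : Yq i n) :
    ymap α h m (ypl θ y) = ypl θ (ymap α h n y) := by
  obtain ⟨w, rfl⟩ := ymk_surj i y; rfl

/-- projective actions -/
structure PA (H : Type) [Group H] (i : Z →* E) where
  a : H → E → E
  c : ∀ h, YC i i (a h)
  one : ∃ z, ∀ x, x = i z * a 1 x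
  mul : ∀ g h, ∃ z, ∀ x, a g (a h x) = i z * a (g * h) x

/-- the `H`-simplicial set -/
@[reducible] def YGact {H : Type} [Group H] {i : Z →* E} (P : PA H i) (n : ℕ) : MulAction H (Yq i n) :=
    { smul := fun h => ymap (P.a h) (P.c h) n
      one_smul := fun y => by
        obtain ⟨w, rfl⟩ := ymk_surj i y
        obtain ⟨z, hz⟩ := P.one
        exact ymk_eq z (fun a => hz _)
      mul_smul := fun g h y => by
        obtain ⟨w, rfl⟩ := ymk_surj i y
        obtain ⟨z, hz⟩ := P.mul g h
        exact ymk_eq z (fun a => hz _) }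

/-- the `H`-simplicial set -/
def YG {H : Type} [Group H] {i : Z →* E} (P : PA H i) : GS H where
  Y := Yq i
  act := YGact P
  pl θ := ypl θ
  pl_id y := by obtain ⟨w, rfl⟩ := ymk_surj i y; rfl
  pl_comp θ ψ y := by obtain ⟨w, rfl⟩ := ymk_surj i y; rfl
  pl_smul θ h y := (ymap_pl (P.a h) (P.c h) θ y).symm

theorem YG_smul {H : Type} [Group H] {i : Z →* E} (P : PA H i) (h : H) {n : ℕ} (w : Fin (n + 1) → E) :
    (HSMul.hSMul h (show (YG P).Y n from ymk i w) : (YG P).Y n) = ymk i (fun a => P.a h (w a)) := rfl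

/-- trivial action -/
def PA0 (i : Z →* E) : PA U1 i where
  a _ x := x
  c _ z := ⟨z, fun _ => rfl⟩
  one := ⟨1, fun x => by simp⟩
  mul _ _ := ⟨1, fun x => by simp⟩

section htpy
variable {E' : Type} (α β : E → E')

def hh {n : ℕ} (j : Fin (n + 1)) (w : Fin (n + 1) → E) (a : Fin (n + 2)) : E' :=
  if a.val ≤ j.val then α (w ⟨if j.val < a.val then a.val - 1 else a.val, by split <;> omega⟩)
  else β (w ⟨if j.val < a.val then a.val - 1 else a.val, by split <;> omega⟩)

theorem hh_congr {n m : ℕ} {j : Fin (n + 1)} {j' : Fin (m + 1)} {w : Fin (n + 1) → E}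
    {w' : Fin (m + 1) → E} {a : Fin (n + 2)} {a' : Fin (m + 2)} (h : a.val ≤ j.val ↔ a'.val ≤ j'.val)
    (hw : ∀ b b' : ℕ, ∀ hb hb', b = (if j.val < a.val then a.val - 1 else a.val) →
      b' = (if j'.val < a'.val then a'.val - 1 else a'.val) → w ⟨b, hb⟩ = w' ⟨b', hb'⟩) :
    hh α β j w a = hh α β j' w' a' := by
  unfold hh
  rw [hw _ (if j'.val < a'.val then a'.val - 1 else a'.val) _ (by split <;> omega) rfl rfl]
  simp only [h]

end htpy

theorem val_δ {n : ℕ} (i : Fin (n + 2)) (a : Fin (n + 1)) :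
    ((SimplexCategory.δ i).toOrderHom a).val = if a.val < i.val then a.val else a.val + 1 := by
  change (i.succAbove a).val = _
  unfold Fin.succAbove
  simp only [Fin.lt_def]
  have := Fin.val_castSucc a
  split <;> split <;> simp_all <;> omega

theorem val_σ {n : ℕ} (i : Fin (n + 1)) (a : Fin (n + 2)) :
    ((SimplexCategory.σ i).toOrderHom a).val = if i.val < a.val then a.val - 1 else a.val := by
  change (i.predAbove a).val = _
  unfold Fin.predAbove
  simp only [Fin.lt_def]
  have := Fin.val_castSucc i
  split <;> split <;> simp only [Fin.val_pred, Fin.coe_castPred] <;> omega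

section htpy2
variable {Z' E' : Type} [Group Z'] [Group E'] {i : Z →* E} {i' : Z' →* E'} (α β : E → E')

/-- joint compatibility -/
def YC2 (i : Z →* E) (i' : Z' →* E') (α β : E → E') : Prop :=
  ∀ z, ∃ z', ∀ x, α (i z * x) = i' z' * α x ∧ β (i z * x) = i' z' * β x

def yh (h : YC2 i i' α β) {n : ℕ} (j : Fin (n + 1)) : Yq i n → Yq i' (n + 1) :=
  ylift (fun w => ymk i' (hh α β j w)) (fun z w => by
    obtain ⟨z', hz⟩ := h z
    refine (ymk_eq z' (fun a => ?_)).symm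
    unfold hh
    split
    · exact (hz _).1
    · exact (hz _).2)

theorem yh_pl (h : YC2 i i' α β) {m n l : ℕ} {j : Fin (n + 1)} {j' : Fin (m + 1)}
    (θ : Fin (l + 1) → Fin (n + 2)) (ψ : Fin (m + 1) → Fin (n + 1))
    (φ : Fin (l + 1) → Fin (m + 2))
    (h1 : ∀ a, (θ a).val ≤ j.val ↔ (φ a).val ≤ j'.val)
    (h2 : ∀ a, ∀ b b' : ℕ, ∀ hb hb', b = (if j.val < (θ a).val then (θ a).val - 1 else (θ a).val) →
      b' = (if j'.val < (φ a).val then (φ a).val - 1 else (φ a).val) →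
      (⟨b, hb⟩ : Fin (n + 1)) = ψ ⟨b', hb'⟩)
    (y : Yq i n) : ypl θ (yh α β h j y) = ypl φ (yh α β h j' (ypl ψ y)) := by
  obtain ⟨w, rfl⟩ := ymk_surj i y
  change ymk i' (fun a => hh α β j w (θ a)) = ymk i' (fun a => hh α β j' (w ∘ ψ) (φ a))
  congr 1
  funext a
  refine hh_congr α β (h1 a) fun b b' hb hb' e e' => ?_
  exact congrArg w (h2 a b b' hb hb' e e')

variable {k : Type} [CommRing k]

theorem fsS_sq {H S T U V : Type} [Group H] [MulAction H S] [MulAction H T] [MulAction H U] [MulAction H V]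
    (f : S → T) (hf : ∀ (x : H) s, f (x • s) = x • f s) (g : T → U) (hg : ∀ (x : H) s, g (x • s) = x • g s)
    (f' : S → V) (hf' : ∀ (x : H) s, f' (x • s) = x • f' s) (g' : V → U)
    (hg' : ∀ (x : H) s, g' (x • s) = x • g' s) (h : ∀ s, g (f s) = g' (f' s)) :
    fsS k f hf ≫ fsS k g hg = fsS k f' hf' ≫ fsS k g' hg' := by
  rw [fsS_comp, fsS_comp]
  exact fsS_eq _ _ _ _ h

theorem fsS_tr {H S T U : Type} [Group H] [MulAction H S] [MulAction H T] [MulAction H U]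
    (f : S → T) (hf : ∀ (x : H) s, f (x • s) = x • f s) (g : T → U) (hg : ∀ (x : H) s, g (x • s) = x • g s)
    (f' : S → U) (hf' : ∀ (x : H) s, f' (x • s) = x • f' s) (h : ∀ s, g (f s) = f' s) :
    fsS k f hf ≫ fsS k g hg = fsS k f' hf' := by
  rw [fsS_comp]
  exact fsS_eq _ _ _ _ h

theorem unit_eqv {S T : Type} [MulAction U1 S] [MulAction U1 T] (f : S → T)
    (g : U1) (s : S) : f (g • s) = g • f s := by
  have e : ∀ {S : Type} [MulAction U1 S] (s : S), g • s = s := fun s => by rw [Subsingleton.elim g 1, one_smul]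
  rw [e, e]

/-- set level homotopies -/
def gsHo {S T : GS U1} (f g : ∀ n, S.Y n → T.Y n)
    (hf : ∀ {m n : ℕ} (θ : Fin (m + 1) →o Fin (n + 1)) (y : S.Y n), f m (S.pl θ y) = T.pl θ (f n y))
    (hg : ∀ {m n : ℕ} (θ : Fin (m + 1) →o Fin (n + 1)) (y : S.Y n), g m (S.pl θ y) = T.pl θ (g n y))
    (h : ∀ {n : ℕ} (j : Fin (n + 1)), S.Y n → T.Y (n + 1))
    (h1 : ∀ n y, T.pl (SimplexCategory.δ (0 : Fin (n + 2))).toOrderHom (h 0 y) = g n y)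
    (h2 : ∀ n y, T.pl (SimplexCategory.δ (Fin.last (n + 1))).toOrderHom (h (Fin.last n) y) = f n y)
    (h3 : ∀ {n : ℕ} (i : Fin (n + 2)) (j : Fin (n + 1)) (hij : i ≤ j.castSucc) (y : S.Y (n + 1)),
      T.pl (SimplexCategory.δ i.castSucc).toOrderHom (h j.succ y) = h j (S.pl (SimplexCategory.δ i).toOrderHom y))
    (h4 : ∀ {n : ℕ} (j : Fin (n + 1)) (y : S.Y (n + 1)),
      T.pl (SimplexCategory.δ j.castSucc.succ).toOrderHom (h j.succ y) =
      T.pl (SimplexCategory.δ j.castSucc.succ).toOrderHom (h j.castSucc y))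
    (h5 : ∀ {n : ℕ} (i : Fin (n + 2)) (j : Fin (n + 1)) (hij : j.castSucc < i) (y : S.Y (n + 1)),
      T.pl (SimplexCategory.δ i.succ).toOrderHom (h j.castSucc y) = h j (S.pl (SimplexCategory.δ i).toOrderHom y))
    (h6 : ∀ {n : ℕ} (i j : Fin (n + 1)) (hij : i ≤ j) (y : S.Y n),
      T.pl (SimplexCategory.σ i.castSucc).toOrderHom (h j y) = h j.succ (S.pl (SimplexCategory.σ i).toOrderHom y))
    (h7 : ∀ {n : ℕ} (i j : Fin (n + 1)) (hij : j ≤ i) (y : S.Y n),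
      T.pl (SimplexCategory.σ i.succ).toOrderHom (h j y) = h j.castSucc (S.pl (SimplexCategory.σ i).toOrderHom y)) :
    SimplicialObject.Homotopy (linMap k f (fun n => unit_eqv _) hf) (linMap k g (fun n => unit_eqv _) hg) where
  h j := fsS k (h j) (unit_eqv _)
  h_zero_comp_δ_zero n := fsS_tr _ (unit_eqv _) _ (unit_eqv _) _ (unit_eqv _) (h1 n)
  h_last_comp_δ_last n := fsS_tr _ (unit_eqv _) _ (unit_eqv _) _ (unit_eqv _) (h2 n)
  h_succ_comp_δ_castSucc_of_lt i j hij :=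
    fsS_sq _ (unit_eqv _) _ (unit_eqv _) _ (unit_eqv _) _ (unit_eqv _) (h3 i j hij)
  h_succ_comp_δ_castSucc_succ j :=
    fsS_sq _ (unit_eqv _) _ (unit_eqv _) _ (unit_eqv _) _ (unit_eqv _) (h4 j)
  h_castSucc_comp_δ_succ_of_lt i j hij :=
    fsS_sq _ (unit_eqv _) _ (unit_eqv _) _ (unit_eqv _) _ (unit_eqv _) (h5 i j hij)
  h_comp_σ_castSucc_of_le i j hij :=
    fsS_sq _ (unit_eqv _) _ (unit_eqv _) _ (unit_eqv _) _ (unit_eqv _) (h6 i j hij)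
  h_comp_σ_succ_of_lt i j hij :=
    fsS_sq _ (unit_eqv _) _ (unit_eqv _) _ (unit_eqv _) _ (unit_eqv _) (h7 i j hij)

def yMap0 (k : Type) [CommRing k] (h : YC i i' α) : lin k (YG (PA0 i)) ⟶ lin k (YG (PA0 i')) :=
  linMap k (S := YG (PA0 i)) (T := YG (PA0 i')) (fun n => ymap α h n) (fun n => unit_eqv _) (fun θ y => ymap_pl α h θ y)

theorem YC2.left {α β : E → E'} (h : YC2 i i' α β) : YC i i' α := fun z => by
  obtain ⟨z', h⟩ := h z
  exact ⟨z', fun x => (h x).1⟩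
theorem YC2.right {α β : E → E'} (h : YC2 i i' α β) : YC i i' β := fun z => by
  obtain ⟨z', h⟩ := h z
  exact ⟨z', fun x => (h x).2⟩

theorem ypl_id' {n : ℕ} (y : Yq i n) : ypl (fun a => a) y = y := by
  obtain ⟨w, rfl⟩ := ymk_surj i y; rfl

def yHo (h : YC2 i i' α β) :
    SimplicialObject.Homotopy (yMap0 α k h.left) (yMap0 β k h.right) := by
  refine gsHo (S := YG (PA0 i)) (T := YG (PA0 i')) _ _ (fun θ y => ymap_pl α h.left θ y)
    (fun θ y => ymap_pl β h.right θ y) (fun j => yh α β h j)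
    ?_ ?_ ?_ ?_ ?_ ?_ ?_
  · intro n y
    obtain ⟨w, rfl⟩ := ymk_surj i y
    refine congrArg (ymk i') (funext fun a => ?_)
    have := val_δ (0 : Fin (n + 2)) a
    change hh α β 0 w ((SimplexCategory.δ (0 : Fin (n + 2))).toOrderHom a) = β (w a)
    unfold hh
    rw [if_neg (by rw [this]; simp)]
    congr 2
  · intro n y
    obtain ⟨w, rfl⟩ := ymk_surj i y
    refine congrArg (ymk i') (funext fun a => ?_)
    have := val_δ (Fin.last (n + 1)) a
    rw [if_pos (by have := a.2; simp at this ⊢; omega)] at this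
    change hh α β (Fin.last n) w ((SimplexCategory.δ (Fin.last (n + 1))).toOrderHom a) = α (w a)
    unfold hh
    rw [if_pos (by have := a.2; simp at this; simp_all)]
    congr 2
    ext
    simp [this]
    omega
  · intro n i j hij y
    refine (yh_pl α β h (SimplexCategory.δ i.castSucc).toOrderHom (SimplexCategory.δ i).toOrderHom
      (fun a => a) ?_ ?_ y).trans (ypl_id' _)
    · intro a
      rw [val_δ]
      simp only [Fin.le_def, Fin.val_succ, Fin.val_castSucc] at hij ⊢
      split <;> omega
    · intro a b b' hb hb' e e'
      ext
      rw [val_δ] at e ⊢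
      simp only [Fin.le_def, Fin.val_succ, Fin.val_castSucc] at hij e e' ⊢
      grind
  · intro n j y
    refine (yh_pl α β h (SimplexCategory.δ j.castSucc.succ).toOrderHom (fun a => a)
      (SimplexCategory.δ j.castSucc.succ).toOrderHom ?_ ?_ y).trans (congrArg _ (congrArg _ (ypl_id' _)))
    · intro a
      rw [val_δ]
      simp
      split <;> omega
    · intro a b b' hb hb' e e'
      ext
      rw [val_δ] at e e'
      simp at e e' ⊢
      grind
  · intro n i j hij y
    refine (yh_pl α β h (SimplexCategory.δ i.succ).toOrderHom (SimplexCategory.δ i).toOrderHom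
      (fun a => a) ?_ ?_ y).trans (ypl_id' _)
    · intro a
      rw [val_δ]
      simp [Fin.lt_def] at hij ⊢
      split <;> omega
    · intro a b b' hb hb' e e'
      ext
      rw [val_δ] at e ⊢
      simp [Fin.lt_def] at hij e e' ⊢
      grind
  · intro n i j hij y
    refine (yh_pl α β h (SimplexCategory.σ i.castSucc).toOrderHom (SimplexCategory.σ i).toOrderHom
      (fun a => a) ?_ ?_ y).trans (ypl_id' _)
    · intro a
      rw [val_σ]
      simp only [Fin.le_def, Fin.val_succ, Fin.val_castSucc] at hij ⊢
      split <;> omega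
    · intro a b b' hb hb' e e'
      ext
      rw [val_σ] at e ⊢
      simp only [Fin.le_def, Fin.val_succ, Fin.val_castSucc] at hij e e' ⊢
      grind
  · intro n i j hij y
    refine (yh_pl α β h (SimplexCategory.σ i.succ).toOrderHom (SimplexCategory.σ i).toOrderHom
      (fun a => a) ?_ ?_ y).trans (ypl_id' _)
    · intro a
      rw [val_σ]
      simp only [Fin.le_def, Fin.val_succ, Fin.val_castSucc] at hij ⊢
      split <;> omega
    · intro a b b' hb hb' e e'
      ext
      rw [val_σ] at e ⊢
      simp only [Fin.le_def, Fin.val_succ, Fin.val_castSucc] at hij e e' ⊢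
      grind

theorem yHo_cls (h : YC2 i i' α β) (n : ℕ) (x : Yq i n →₀ k) (hx : (YG (PA0 i)).Dm k n x = 0) :
    ∃ b : Yq i' (n + 1) →₀ k, (YG (PA0 i')).D k n b = lx k (ymap α h.left n) x - lx k (ymap β h.right n) x := by
  have := (yHo α β (k := k) h).map_homology_eq n
  have := congrArg (fun f => f.hom ((YG (PA0 i)).cls n x hx)) this
  refine (GS.cls_eq_iff (YG (PA0 i')) ?_ ?_).1 ?_; rotate_left 2
  · exact ((cls_map (S := YG (PA0 i)) (T := YG (PA0 i')) (fun n => ymap α h.left n) (fun n => unit_eqv _) (fun θ y => ymap_pl α _ θ y) n x hx).symm.trans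
      this).trans (cls_map (S := YG (PA0 i)) (T := YG (PA0 i')) (fun n => ymap β h.right n) (fun n => unit_eqv _) (fun θ y => ymap_pl β _ θ y) n x hx)
  · exact Dm_nat0 (S := YG (PA0 i)) (T := YG (PA0 i')) (fun n => ymap β h.right n) (fun θ y => ymap_pl β _ θ y) n hx

end htpy2
end Yq
end HNil

namespace HNil
open CategoryTheory.Limits MonoidalCategory Simplicial
set_option linter.unusedVariables false
set_option linter.unusedSectionVars false

section clsiso
variable {k : Type} [CommRing k] {H : Type} [Group H]

theorem cl_add {G : Type} [Group G] {K : ChainComplex (Rep.{0} k G) ℕ} {n : ℕ} {x y : K.X n} (hx : (K.d n (n - 1)).hom x = 0)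
    (hy : (K.d n (n - 1)).hom y = 0) (hxy : (K.d n (n - 1)).hom (x + y) = 0) :
    cl K n (x + y) hxy = cl K n x hx + cl K n y hy := by
  obtain ⟨z, hz⟩ := cyc_exists K n x hx
  obtain ⟨w, hw⟩ := cyc_exists K n y hy
  rw [cl_eq hx z hz, cl_eq hy w hw, cl_eq _ (z + w) (by rw [map_add, hz, hw]), map_add]

theorem cl_smul {G : Type} [Group G] {K : ChainComplex (Rep.{0} k G) ℕ} {n : ℕ} (c : k) {x : K.X n} (hx : (K.d n (n - 1)).hom x = 0)
    (hxy : (K.d n (n - 1)).hom (c • x) = 0) :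
    cl K n (c • x) hxy = c • cl K n x hx := by
  obtain ⟨z, hz⟩ := cyc_exists K n x hx
  rw [cl_eq hx z hz, cl_eq _ (c • z) (by rw [map_smul, hz]), map_smul]

theorem GS.cls_add (S : GS H) {n : ℕ} {x y : S.Y n →₀ k} (hx : S.Dm k n x = 0) (hy : S.Dm k n y = 0)
    (hxy : S.Dm k n (x + y) = 0) : S.cls n (x + y) hxy = S.cls n x hx + S.cls n y hy := cl_add _ _ _

theorem GS.cls_smul (S : GS H) {n : ℕ} (c : k) {x : S.Y n →₀ k} (hx : S.Dm k n x = 0)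
    (hxy : S.Dm k n (c • x) = 0) : S.cls n (c • x) hxy = c • S.cls n x hx := cl_smul _ _ _

variable {H' : Type} [Group H'] (S : GS H) (T : GS H')

variable {S T}
/-- comparison function -/
def clsFun (k : Type) [CommRing k] (f : ∀ n, S.Y n → T.Y n)
    (hn : ∀ {m n : ℕ} (θ : Fin (m + 1) →o Fin (n + 1)) (y : S.Y n), f m (S.pl θ y) = T.pl θ (f n y))
    (n : ℕ) (h : ((lch k S).homology n).V) : ((lch k T).homology n).V :=
  T.cls n (lx k (f n) (S.cls_surj h).choose) (Dm_nat0 f hn n (S.cls_surj h).choose_spec.choose)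

theorem clsFun_cls (f : ∀ n, S.Y n → T.Y n)
    (hn : ∀ {m n : ℕ} (θ : Fin (m + 1) →o Fin (n + 1)) (y : S.Y n), f m (S.pl θ y) = T.pl θ (f n y))
    (n : ℕ) (x : S.Y n →₀ k) (hx : S.Dm k n x = 0) :
    clsFun k f hn n (S.cls n x hx) = T.cls n (lx k (f n) x) (Dm_nat0 f hn n hx) := by
  refine (T.cls_eq_iff (Dm_nat0 f hn n (S.cls_surj _).choose_spec.choose) (Dm_nat0 f hn n hx)).2 ?_
  obtain ⟨b, hb⟩ := (S.cls_eq_iff (S.cls_surj _).choose_spec.choose hx).1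
    (S.cls_surj (S.cls n x hx)).choose_spec.choose_spec
  exact ⟨lx k (f _) b, by rw [D_nat f hn, hb, map_sub]⟩

/-- comparison map on homology -/
def clsMap (S : GS H) (T : GS H') (k : Type) [CommRing k] (f : ∀ n, S.Y n → T.Y n)
    (hn : ∀ {m n : ℕ} (θ : Fin (m + 1) →o Fin (n + 1)) (y : S.Y n), f m (S.pl θ y) = T.pl θ (f n y))
    (n : ℕ) : ((lch k S).homology n).V →ₗ[k] ((lch k T).homology n).V where
  toFun := clsFun k f hn n
  map_add' h h' := by
    obtain ⟨x, hx, rfl⟩ := S.cls_surj h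
    obtain ⟨y, hy, rfl⟩ := S.cls_surj h'
    have hxy : S.Dm k n (x + y) = 0 := by rw [map_add, hx, hy, add_zero]
    rw [← S.cls_add hx hy hxy, clsFun_cls, clsFun_cls, clsFun_cls,
      ← T.cls_add _ _ (by rw [← map_add]; exact Dm_nat0 f hn n hxy)]
    congr 1
    exact map_add _ _ _
  map_smul' c h := by
    obtain ⟨x, hx, rfl⟩ := S.cls_surj h
    have hxy : S.Dm k n (c • x) = 0 := by rw [map_smul, hx, smul_zero]
    rw [RingHom.id_apply, ← S.cls_smul c hx hxy, clsFun_cls, clsFun_cls,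
      ← T.cls_smul c _ (by rw [← map_smul]; exact Dm_nat0 f hn n hxy)]
    congr 1
    exact map_smul _ _ _

theorem clsMap_cls (f : ∀ n, S.Y n → T.Y n)
    (hn : ∀ {m n : ℕ} (θ : Fin (m + 1) →o Fin (n + 1)) (y : S.Y n), f m (S.pl θ y) = T.pl θ (f n y))
    (n : ℕ) (x : S.Y n →₀ k) (hx : S.Dm k n x = 0) :
    clsMap S T k f hn n (S.cls n x hx) = T.cls n (lx k (f n) x) (Dm_nat0 f hn n hx) := clsFun_cls f hn n x hx

theorem clsMap_ρ (f : ∀ n, S.Y n → T.Y n)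
    (hn : ∀ {m n : ℕ} (θ : Fin (m + 1) →o Fin (n + 1)) (y : S.Y n), f m (S.pl θ y) = T.pl θ (f n y))
    (n : ℕ) (g : H) (g' : H') (hg : ∀ y, f n (g • y) = g' • f n y) (h) :
    clsMap S T k f hn n (((lch k S).homology n).ρ g h) = ((lch k T).homology n).ρ g' (clsMap S T k f hn n h) := by
  obtain ⟨x, hx, rfl⟩ := S.cls_surj h
  rw [S.cls_ρ, clsMap_cls, clsMap_cls, T.cls_ρ]
  congr 1
  rw [lx_comp, lx_comp]
  exact congrArg (fun u => lx k u x) (funext hg)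

theorem clsMap_inj (f : ∀ n, S.Y n → T.Y n)
    (hn : ∀ {m n : ℕ} (θ : Fin (m + 1) →o Fin (n + 1)) (y : S.Y n), f m (S.pl θ y) = T.pl θ (f n y))
    (n : ℕ) (h : ∀ x b, S.Dm k n x = 0 → T.D k n b = lx k (f n) x → ∃ b', S.D k n b' = x) :
    Function.Injective (clsMap S T k f hn n) := by
  refine (injective_iff_map_eq_zero _).2 fun c hc => ?_
  obtain ⟨x, hx, rfl⟩ := S.cls_surj c
  rw [clsMap_cls, T.cls_zero_iff] at hc
  obtain ⟨b, hb⟩ := hc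
  exact (S.cls_zero_iff hx).2 (h x b hx hb)

theorem clsMap_surj (f : ∀ n, S.Y n → T.Y n)
    (hn : ∀ {m n : ℕ} (θ : Fin (m + 1) →o Fin (n + 1)) (y : S.Y n), f m (S.pl θ y) = T.pl θ (f n y))
    (n : ℕ) (h : ∀ y, T.Dm k n y = 0 → ∃ x, S.Dm k n x = 0 ∧ ∃ b, T.D k n b = lx k (f n) x - y) :
    Function.Surjective (clsMap S T k f hn n) := by
  intro c
  obtain ⟨y, hy, rfl⟩ := T.cls_surj c
  obtain ⟨x, hx, hb⟩ := h y hy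
  exact ⟨S.cls n x hx, (clsMap_cls f hn n x hx).trans ((T.cls_eq_iff _ _).2 hb)⟩

theorem clsMap_bij_of_bij (f : ∀ n, S.Y n → T.Y n)
    (hn : ∀ {m n : ℕ} (θ : Fin (m + 1) →o Fin (n + 1)) (y : S.Y n), f m (S.pl θ y) = T.pl θ (f n y))
    (r : ∀ n, T.Y n → S.Y n) (h1 : ∀ n y, r n (f n y) = y) (h2 : ∀ n y, f n (r n y) = y) (n : ℕ) :
    Function.Bijective (clsMap S T k f hn n) := by
  have hr : ∀ {m n : ℕ} (θ : Fin (m + 1) →o Fin (n + 1)) (y : T.Y n), r m (T.pl θ y) = S.pl θ (r n y) := by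
    intro m n θ y
    rw [← h1 m (S.pl θ (r n y)), hn, h2]
  have e1 : ∀ n x, lx k (r n) (lx k (f n) x) = x := fun n x => by
    rw [lx_comp]; refine Eq.trans ?_ (lx_id x); congr 2; funext y; exact h1 n y
  have e2 : ∀ n x, lx k (f n) (lx k (r n) x) = x := fun n x => by
    rw [lx_comp]; refine Eq.trans ?_ (lx_id x); congr 2; funext y; exact h2 n y
  constructor
  · refine clsMap_inj f hn n fun x b hx hb => ⟨lx k (r _) b, ?_⟩
    rw [D_nat r hr, hb, e1]
  · refine clsMap_surj f hn n fun y hy => ⟨lx k (r n) y, Dm_nat0 r hr n hy, 0, ?_⟩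
    rw [e2, map_zero, sub_self]
end clsiso

section PAs
variable {k : Type} [CommRing k]
variable {G Z E E' : Type} [Group G] [Group Z] [Group E] [Group E'] [MulDistribMulAction G Z]
  [MulDistribMulAction G E] [MulDistribMulAction G E']

/-- the diagonal action -/
def PAG {i : Z →* E} (hi : ∀ (g : G) z, i (g • z) = g • i z) : PA G i where
  a g x := g • x
  c g z := ⟨g • z, fun x => by beta_reduce; rw [hi, smul_mul']⟩
  one := ⟨1, fun x => by simp⟩
  mul g h := ⟨1, fun x => by simp [mul_smul]⟩

/-- central extensions of groups with `G`-action -/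
structure CExt (G : Type) [Group G] [MulDistribMulAction G Z]
  [MulDistribMulAction G E] [MulDistribMulAction G E'] (i : Z →* E) (f : E →* E') : Prop where
  hi : ∀ (g : G) z, i (g • z) = g • i z
  hf : ∀ (g : G) z, f (g • z) = g • f z
  inj : Function.Injective i
  surj : Function.Surjective f
  comp : ∀ z, f (i z) = 1
  ker : ∀ x, f x = 1 → ∃ z, i z = x
  cen : ∀ z x, i z * x = x * i z

variable {i : Z →* E} {f : E →* E'} (C : CExt G i f)

theorem CExt.ker2 (C : CExt G i f) {x y : E} (h : f x = f y) : ∃ z, x = i z * y := by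
  obtain ⟨z, hz⟩ := C.ker (x * y⁻¹) (by rw [map_mul, map_inv, h, mul_inv_cancel])
  exact ⟨z, by rw [hz, inv_mul_cancel_right]⟩

/-- section -/
def CExt.s (C : CExt G i f) : E' → E := Function.surjInv C.surj
theorem CExt.fs (C : CExt G i f) (e : E') : f (C.s e) = e := Function.surjInv_eq C.surj e

/-- the action of the semidirect product -/
def PAS (C : CExt G i f) : PA (Sd G E') i where
  a h x := C.s h.left * (h.right • x)
  c h z := ⟨h.right • z, fun x => by
    beta_reduce
    rw [smul_mul', ← C.hi, ← mul_assoc, ← C.cen, mul_assoc]⟩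
  one := by
    obtain ⟨z, hz⟩ := C.ker2 (x := 1) (y := C.s 1) (by rw [C.fs, map_one])
    refine ⟨z, fun x => ?_⟩
    change x = i z * (C.s 1 * ((1 : G) • x))
    rw [one_smul, ← mul_assoc, ← hz, one_mul]
  mul g h := by
    obtain ⟨z, hz⟩ := C.ker2 (x := C.s g.left * (g.right • C.s h.left)) (y := C.s (g * h).left) (by
      rw [C.fs, map_mul, C.hf, C.fs, C.fs]; rfl)
    refine ⟨z, fun x => ?_⟩
    change C.s g.left * (g.right • (C.s h.left * (h.right • x))) =
      i z * (C.s (g * h).left * ((g.right * h.right) • x))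
    rw [smul_mul', ← mul_assoc, hz, mul_smul, mul_assoc]

theorem PAS_inl (e : E') (n : ℕ) (h) : ((lch k (YG (PAS C))).homology n).ρ (sinl G e) h = h := by
  obtain ⟨x, hx, rfl⟩ := (YG (PAS C)).cls_surj h
  rw [GS.cls_ρ]
  have h2 : YC2 i i (fun x => C.s e * ((1 : G) • x)) id := fun z => ⟨z, fun x => ⟨by
    beta_reduce
    rw [one_smul, one_smul, ← mul_assoc, ← C.cen, mul_assoc], rfl⟩⟩
  obtain ⟨b, hb⟩ := yHo_cls (k := k) _ _ h2 n x hx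
  refine (GS.cls_eq_iff (YG (PAS C)) _ hx).2 ⟨b, hb.trans ?_⟩
  congr 1
  refine Eq.trans (congrArg (fun u => lx k u x) ?_) (lx_id x)
  funext y
  obtain ⟨w, rfl⟩ := ymk_surj i y
  rfl

/-- retraction -/
theorem CExt.retr (C : CExt G i f) : ∃ r : E → Z, ∀ z x, r (i z * x) = z * r x := by
  choose r hr using fun x => C.ker2 (x := x) (y := C.s (f x)) (C.fs _).symm
  refine ⟨r, fun z x => C.inj ?_⟩
  have := hr (i z * x)
  rw [map_mul f, C.comp, one_mul] at this
  nth_rewrite 1 [hr x] at this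
  rw [← mul_assoc] at this
  rw [map_mul, mul_right_cancel this]

theorem fib_bij {H₁ H₂ : Type} [Group H₁] [Group H₂] (P : PA H₁ (MonoidHom.id Z)) (P' : PA H₂ i)
    (r : E → Z) (hr : ∀ z x, r (i z * x) = z * r x) (n : ℕ)
    (h : YC (MonoidHom.id Z) i i := fun z => ⟨z, fun x => map_mul i z x⟩) :
    Function.Bijective (clsMap (YG P) (YG P') k (fun n => ymap i h n) (fun θ y => ymap_pl i h θ y) n) := by
  have hr' : YC i (MonoidHom.id Z) r := fun z => ⟨z, fun x => hr z x⟩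
  have h1 : YC2 (MonoidHom.id Z) (MonoidHom.id Z) (fun z => r (i z)) id := fun z => ⟨z, fun x =>
    ⟨(congrArg r (map_mul i z x)).trans (hr z _), rfl⟩⟩
  have h2 : YC2 i i (fun z => i (r z)) id := fun z => ⟨z, fun x =>
    ⟨(congrArg i (hr z x)).trans (map_mul i _ _), rfl⟩⟩
  constructor
  · refine clsMap_inj (S := YG P) (T := YG P') _ _ n fun x b hx hb => ?_
    obtain ⟨b', hb'⟩ := yHo_cls (k := k) _ _ h1 n x hx
    refine ⟨lx k (ymap r hr' (n + 1)) b - b', ?_⟩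
    refine (map_sub ((YG P).D k n) _ _).trans ?_
    have e := (D_nat (S := YG P') (T := YG P) (k := k) (fun n => ymap r hr' n) (fun θ y => ymap_pl r hr' θ y) n b).trans
      ((congrArg _ hb).trans (lx_comp _ _ x))
    have hb2 : (YG P).D k n b' = (show (YG P).Y n →₀ k from lx k (ymap (fun z => r (i z)) h1.left n) x -
      lx k (ymap id h1.right n) x) := hb'
    refine (congrArg₂ (fun u v : (YG P).Y n →₀ k => u - v) e hb2).trans ?_
    have e1 : (ymap r hr' n : _ → (YG P).Y n) ∘ ymap i h n = ymap (fun z => r (i z)) h1.left n := by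
      funext y; obtain ⟨w, rfl⟩ := ymk_surj _ y; rfl
    have e2 : lx k (ymap id h1.right n) x = x := by
      refine Eq.trans (congrArg (fun u => lx k u x) ?_) (lx_id x)
      funext y; obtain ⟨w, rfl⟩ := ymk_surj _ y; rfl
    refine (congrArg₂ (fun u v => lx k u x - (lx k (ymap (fun z => r (i z)) h1.left n) x - v)) e1 e2).trans ?_
    exact sub_sub_cancel _ _
  · refine clsMap_surj (S := YG P) (T := YG P') _ _ n fun y hy => ?_
    obtain ⟨b', hb'⟩ := yHo_cls (k := k) _ _ h2 n y hy
    refine ⟨lx k (ymap r hr' n) y, Dm_nat0 (S := YG P') (T := YG P) (fun n => ymap r hr' n) (fun θ y => ymap_pl r hr' θ y) n hy,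
      b', hb'.trans ?_⟩
    have e1 : (ymap i h n : _ → (YG P').Y n) ∘ ymap r hr' n = ymap (fun z => i (r z)) h2.left n := by
      funext y; obtain ⟨w, rfl⟩ := ymk_surj _ y; rfl
    have e2 : lx k (ymap id h2.right n) y = y := by
      refine Eq.trans (congrArg (fun u => lx k u y) ?_) (lx_id y)
      funext y; obtain ⟨w, rfl⟩ := ymk_surj _ y; rfl
    exact (congrArg₂ (fun u v => lx k u y - v) e1.symm e2).trans (congrArg (· - y) (lx_comp _ _ _).symm)

/-- the diagonal action on homogeneous simplices -/
def PAE (G E : Type) [Group G] [Group E] [MulDistribMulAction G E] : PA G (MonoidHom.id E) :=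
  PAG (i := MonoidHom.id E) (fun _ _ => rfl)

/-- inner automorphisms act trivially -/
theorem PAE_inner (g : G) (e : E) (hg : ∀ x : E, g • x = e * x * e⁻¹) (n : ℕ) (h) :
    ((lch k (YG (PAE G E))).homology n).ρ g h = h := by
  obtain ⟨x, hx, rfl⟩ := (YG (PAE G E)).cls_surj h
  rw [GS.cls_ρ]
  have h2 : YC2 (MonoidHom.id E) (MonoidHom.id E) (fun x => g • x) (fun x => e * x) := fun z => ⟨e * z * e⁻¹, fun x => by
    simp [hg, mul_assoc]⟩
  obtain ⟨b, hb⟩ := yHo_cls (k := k) _ _ h2 n x hx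
  refine (GS.cls_eq_iff (YG (PAE G E)) _ hx).2 ⟨b, hb.trans ?_⟩
  congr 1
  refine Eq.trans (congrArg (fun u => lx k u x) ?_) (lx_id x)
  funext y
  obtain ⟨w, rfl⟩ := ymk_surj _ y
  exact (ymk_eq e (fun a => rfl)).symm

/-- the normalized model -/
def SG (G E : Type) [Group G] [Group E] [MulDistribMulAction G E] : GS G where
  Y n := Sx E n
  act n := inferInstance
  pl θ := pullS θ
  pl_id y := pullS_id y
  pl_comp θ ψ y := pullS_comp θ ψ y
  pl_smul θ h y := pullS_smul θ h y

def ynrm {n : ℕ} : Yq (MonoidHom.id E) n → Sx E n := ylift nrm (fun z w => nrm_mul z w)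

theorem ynrm_pl {m n : ℕ} (θ : Fin (m + 1) →o Fin (n + 1)) (y : Yq (MonoidHom.id E) n) :
    ynrm (ypl θ y) = pullS θ (ynrm y) := by
  obtain ⟨w, rfl⟩ := ymk_surj _ y
  change nrm (w ∘ θ) = nrm (fun i => (w 0)⁻¹ * (w ∘ θ) i)
  rw [nrm_mul]

theorem ynrm_bij {H₁ H₂ : Type} [Group H₁] [Group H₂] (P : PA H₁ (MonoidHom.id E)) [MulDistribMulAction H₂ E] (n : ℕ) :
    Function.Bijective (clsMap (YG P) (SG H₂ E) k (fun n => ynrm) ynrm_pl n) := by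
  refine clsMap_bij_of_bij (S := YG P) (T := SG H₂ E) _ _ (fun n x => ymk _ x.1) (fun n y => ?_) (fun n y => ?_) n
  · obtain ⟨w, rfl⟩ := ymk_surj _ y
    exact (ymk_eq (w 0)⁻¹ (fun a => rfl)).symm
  · exact nrm_self y

theorem ynrm_smul (g : G) {n : ℕ} (y : (YG (PAE G E)).Y n) : (ynrm (g • y) : (SG G E).Y n) = g • (ynrm y : (SG G E).Y n) := by
  obtain ⟨w, rfl⟩ := ymk_surj _ y
  exact nrm_smul g w
end PAs
end HNil

namespace HNil
open CategoryTheory.Limits MonoidalCategory Simplicial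
set_option linter.unusedVariables false
set_option linter.unusedSectionVars false

section hdesc
variable {k : Type} [CommRing k] {G : Type} [Group G]
/-- maps out of `H_0` -/
def hdesc (K : ChainComplex (Rep.{0} k G) ℕ) {A : Rep.{0} k G} (ε : K.X 0 ⟶ A) (h : K.d 1 0 ≫ ε = 0) :
    K.homology 0 ⟶ A := K.homologyι 0 ≫ K.descOpcycles ε 1 (by simp) h

theorem hdesc_cl (K : ChainComplex (Rep.{0} k G) ℕ) {A : Rep.{0} k G} (ε : K.X 0 ⟶ A) (h : K.d 1 0 ≫ ε = 0)
    (x : K.X 0) (hx) : (hdesc K ε h).hom (cl K 0 x hx) = ε.hom x := by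
  obtain ⟨z, hz⟩ := cyc_exists K 0 x hx
  rw [cl_eq hx z hz]
  have : K.homologyπ 0 ≫ hdesc K ε h = K.iCycles 0 ≫ ε := by
    unfold hdesc
    rw [HomologicalComplex.homology_π_ι_assoc, HomologicalComplex.p_descOpcycles]
  rw [← hz]
  exact congrArg (fun f => f.hom z) this

theorem hdesc_iso (K : ChainComplex (Rep.{0} k G) ℕ) {A : Rep.{0} k G} (ε : K.X 0 ⟶ A) (h : K.d 1 0 ≫ ε = 0)
    (hs : Function.Surjective ε.hom) (hi : ∀ x : K.X 0, ε.hom x = 0 → ∃ y, (K.d 1 0).hom y = x) :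
    IsIso (hdesc K ε h) := by
  have := (Rep.epi_iff_surjective (hdesc K ε h)).2 (fun a => by
    obtain ⟨x, rfl⟩ := hs a
    have hx : (K.d 0 (0 - 1)).hom x = 0 := by rw [K.shape 0 (0 - 1) (by simp)]; rfl
    exact ⟨cl K 0 x hx, hdesc_cl K ε h x hx⟩)
  have := (Rep.mono_iff_injective (hdesc K ε h)).2 ((injective_iff_map_eq_zero _).2 fun c hc => by
    obtain ⟨x, hx, rfl⟩ := cl_surj c
    rw [hdesc_cl] at hc
    exact (cl_zero_iff hx).2 (hi x hc))
  exact isIso_of_mono_of_epi _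
end hdesc

section bx
variable {k : Type} [CommRing k]
/-- linear extension on two-variable finsupps -/
def bx (k : Type) [CommRing k] {S Y S' Y' : Type} (f : S → Y → S') (g : S → Y → Y') :
    (S →₀ Y →₀ k) →ₗ[k] (S' →₀ Y' →₀ k) :=
  Finsupp.lsum k fun w => Finsupp.lsum k fun y => (Finsupp.lsingle (f w y)) ∘ₗ (Finsupp.lsingle (g w y))

theorem bx_single {S Y S' Y' : Type} (f : S → Y → S') (g : S → Y → Y') (w y) (a : k) :
    bx k f g (Finsupp.single w (Finsupp.single y a)) = Finsupp.single (f w y) (Finsupp.single (g w y) a) := by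
  unfold bx
  refine (Finsupp.lsum_single _ _ _ _).trans ((Finsupp.lsum_single _ _ _ _).trans rfl)

theorem bx_ext {S Y M : Type} [AddCommMonoid M] [Module k M] {f g : (S →₀ Y →₀ k) →ₗ[k] M}
    (h : ∀ w y a, f (Finsupp.single w (Finsupp.single y a)) = g (Finsupp.single w (Finsupp.single y a))) : f = g :=
  Finsupp.lhom_ext' fun w => Finsupp.lhom_ext fun y a => h w y a

end bx

section acyc
variable {k : Type} [CommRing k] {G F : Type} [Group G] [Group F] [MulDistribMulAction G F]

/-- the differential on elements -/
theorem Xc_d (M : Rep.{0} k (Sd G F)) (n : ℕ) (x : ((Xc k G F).obj M).X (n + 1)) :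
    (((Xc k G F).obj M).d (n + 1) n).hom x = ∑ i : Fin (n + 2), ((-1) ^ (i : ℕ) : ℤ) •
      (((XsObj M).map (SimplexCategory.δ i).op).hom x : ((XsObj M).obj (Opposite.op (SimplexCategory.mk n))).V) := by
  have h : ((Xc k G F).obj M).d (n + 1) n = AlternatingFaceMapComplex.objD (XsObj M) n :=
    AlternatingFaceMapComplex.obj_d_eq _ _
  rw [h]
  change ev (A := (XsObj M).obj (Opposite.op (SimplexCategory.mk (n + 1)))) x (AlternatingFaceMapComplex.objD (XsObj M) n) = _
  unfold AlternatingFaceMapComplex.objD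
  rw [map_sum]
  refine Finset.sum_congr rfl fun i _ => ?_
  rw [map_zsmul]
  rfl

variable {Y T : Type} [MulAction (Sd G F) Y] [MulAction G T]

/-- a free `F`-set with a slice -/
structure Slice (G F : Type) [Group G] [Group F] [MulDistribMulAction G F] (Y T : Type)
    [MulAction (Sd G F) Y] [MulAction G T] where
  v : Y → F
  q : Y → T
  s : T → Y
  vl : ∀ (e : F) y, v (sinl G e • y) = e * v y
  ql : ∀ (e : F) y, q (sinl G e • y) = q y
  qr : ∀ (g : G) y, q (sinr F g • y) = g • q y
  qs : ∀ t, q (s t) = t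
  vs : ∀ t, v (s t) = 1
  dec : ∀ y, sinl G (v y) • s (q y) = y

theorem Slice.eq_of (L : Slice G F Y T) {y y' : Y} (h1 : L.v y = L.v y') (h2 : L.q y = L.q y') : y = y' := by
  rw [← L.dec y, h1, h2, L.dec]

/-- face maps -/
abbrev fc {Y : Type} [MulAction (Sd G F) Y] (k : Type) [CommRing k] (n : ℕ) (i : Fin (n + 2)) : (Sx F (n + 1) →₀ Y →₀ k) →ₗ[k] (Sx F n →₀ Y →₀ k) :=
  bx k (fun w y => pullS (SimplexCategory.δ i).toOrderHom w)
    (fun w y => sinl G (w.1 ((SimplexCategory.δ i).toOrderHom 0))⁻¹ • y)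

theorem Xs_fc (n : ℕ) (i : Fin (n + 2)) (x : Sx F (n + 1) →₀ Y →₀ k) :
    ((XsObj (fs Y (tr k (Sd G F)))).map (SimplexCategory.δ i).op).hom x = fc (G := G) (Y := Y) k n i x := by
  have : ((XsObj (fs Y (tr k (Sd G F)))).map (SimplexCategory.δ i).op).hom.toLinearMap = fc (G := G) (Y := Y) k n i := by
    refine bx_ext fun w y a => ?_
    refine (XsObj_map (fs Y (tr k (Sd G F))) (SimplexCategory.δ i).op w (Finsupp.single y a)).trans ?_
    refine Eq.trans ?_ (bx_single _ _ w y a).symm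
    refine congrArg (Finsupp.single _) ?_
    exact wmap_single _ _ _ _
  exact DFunLike.congr_fun this x

/-- the contracting simplex -/
def cone {n : ℕ} (e : F) (w : Sx F n) : Sx F (n + 1) := ⟨Fin.cons 1 (fun i => e⁻¹ * w.1 i), rfl⟩

/-- the contraction -/
abbrev ct (L : Slice G F Y T) (k : Type) [CommRing k] (n : ℕ) : (Sx F n →₀ Y →₀ k) →ₗ[k] (Sx F (n + 1) →₀ Y →₀ k) :=
  bx k (fun w y => cone (L.v y) w) (fun w y => L.s (L.q y))

theorem cone_zero {n : ℕ} (e : F) (w : Sx F n) :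
    pullS (SimplexCategory.δ (0 : Fin (n + 2))).toOrderHom (cone e w) = w := Sx.ext fun i => by
  change (e⁻¹ * w.1 0)⁻¹ * (e⁻¹ * w.1 i) = w.1 i
  rw [w.2]; simp

theorem cone_succ {n : ℕ} (e : F) (w : Sx F (n + 1)) (i : Fin (n + 2)) :
    pullS (SimplexCategory.δ i.succ).toOrderHom (cone e w) =
      cone ((w.1 ((SimplexCategory.δ i).toOrderHom 0))⁻¹ * e) (pullS (SimplexCategory.δ i).toOrderHom w) := Sx.ext fun j => by
  have h0 : (SimplexCategory.δ i.succ).toOrderHom 0 = (0 : Fin (n + 3)) := Fin.succ_succAbove_zero i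
  refine (pullS_val _ (cone e w) j).trans ?_
  refine (congrArg₂ (fun a b => ((cone e w).1 a)⁻¹ * b) h0 rfl).trans ?_
  refine (congrArg (fun a => a⁻¹ * _) (cone e w).2).trans ?_
  rw [inv_one, one_mul]
  refine Fin.cases ?_ (fun j => ?_) j
  · exact (congrArg (cone e w).1 h0).trans (cone e w).2
  · have h1 : (SimplexCategory.δ i.succ).toOrderHom j.succ = ((SimplexCategory.δ i).toOrderHom j).succ :=
      Fin.succ_succAbove_succ i j
    refine (congrArg (cone e w).1 h1).trans ?_
    change e⁻¹ * w.1 ((SimplexCategory.δ i).toOrderHom j) = ((w.1 ((SimplexCategory.δ i).toOrderHom 0))⁻¹ * e)⁻¹ *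
      ((w.1 ((SimplexCategory.δ i).toOrderHom 0))⁻¹ * w.1 ((SimplexCategory.δ i).toOrderHom j))
    generalize w.1 ((SimplexCategory.δ i).toOrderHom j) = a
    generalize w.1 ((SimplexCategory.δ i).toOrderHom 0) = b
    rw [mul_inv_rev, inv_inv, mul_assoc, mul_inv_cancel_left]

theorem fc_ct_zero (L : Slice G F Y T) (n : ℕ) (x) : fc (G := G) k n 0 (ct L k n x) = x := by
  have : fc (G := G) (F := F) (Y := Y) k n 0 ∘ₗ (ct L k n) = LinearMap.id := by
    refine bx_ext fun w y a => ?_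
    refine (congrArg (fc (G := G) (F := F) (Y := Y) k n 0) (bx_single _ _ w y a)).trans ((bx_single _ _ _ _ a).trans ?_)
    have e2 : sinl G ((cone (L.v y) w).1 ((SimplexCategory.δ (0 : Fin (n + 2))).toOrderHom 0))⁻¹ • L.s (L.q y) = y := by
      change sinl G ((L.v y)⁻¹ * w.1 0)⁻¹ • _ = y
      rw [w.2, mul_one, inv_inv, L.dec]
    rw [cone_zero, e2]; rfl
  exact DFunLike.congr_fun this x

theorem fc_ct_succ (L : Slice G F Y T) (n : ℕ) (i : Fin (n + 2)) (x) :
    fc (G := G) k (n + 1) i.succ (ct L k (n + 1) x) = ct L k n (fc (G := G) k n i x) := by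
  have : fc (G := G) (F := F) (Y := Y) k (n + 1) i.succ ∘ₗ (ct L k (n + 1)) = ct L k n ∘ₗ fc (G := G) k n i := by
    refine bx_ext fun w y a => ?_
    refine (congrArg (fc (G := G) (F := F) (Y := Y) k (n + 1) i.succ) (bx_single _ _ w y a)).trans ((bx_single _ _ _ _ a).trans ?_)
    refine Eq.trans ?_ (congrArg (ct L k n) (bx_single _ _ w y a)).symm
    refine Eq.trans ?_ (bx_single _ _ _ _ a).symm
    have h0 : (SimplexCategory.δ i.succ).toOrderHom 0 = (0 : Fin (n + 3)) := Fin.succ_succAbove_zero i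
    have e2 : sinl G ((cone (L.v y) w).1 ((SimplexCategory.δ i.succ).toOrderHom 0))⁻¹ • L.s (L.q y) = L.s (L.q y) := by
      rw [h0, (cone (L.v y) w).2, inv_one, map_one, one_smul]
    rw [e2, cone_succ, L.ql, L.vl]
  exact DFunLike.congr_fun this x

theorem alt_ct {A B C : Type} [AddCommGroup A] [AddCommGroup B] [AddCommGroup C] (m : ℕ) (s1 : A → C) (s0 : B →+ A)
    (d : Fin (m + 1) → A → B) (d' : Fin (m + 2) → C → A) (x : A) (h0 : d' 0 (s1 x) = x)
    (hs : ∀ i, d' (Fin.succ i) (s1 x) = s0 (d i x)) (hx : (∑ i : Fin (m + 1), ((-1) ^ (i : ℕ) : ℤ) • d i x) = 0) :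
    (∑ i : Fin (m + 2), ((-1) ^ (i : ℕ) : ℤ) • d' i (s1 x)) = x := by
  rw [Fin.sum_univ_succ]
  have e1 : ∑ i : Fin (m + 1), ((-1) ^ ((i.succ : Fin (m + 2)) : ℕ) : ℤ) • d' (Fin.succ i) (s1 x)
      = - s0 (∑ i : Fin (m + 1), ((-1) ^ (i : ℕ) : ℤ) • d i x) := by
    rw [map_sum, ← Finset.sum_neg_distrib]
    refine Finset.sum_congr rfl fun i _ => ?_
    rw [hs, map_zsmul, Fin.val_succ, pow_succ, mul_neg_one, neg_smul]
  rw [e1, hx, map_zero, neg_zero, add_zero, h0]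
  simp

theorem fc_ct_sum (L : Slice G F Y T) (n : ℕ) (x : Sx F (n + 1) →₀ Y →₀ k)
    (hx : (∑ i : Fin (n + 2), ((-1) ^ (i : ℕ) : ℤ) • fc (G := G) k n i x) = 0) :
    (∑ i : Fin (n + 3), ((-1) ^ (i : ℕ) : ℤ) • fc (G := G) k (n + 1) i (ct L k (n + 1) x)) = x :=
  alt_ct (n + 1) (ct L k (n + 1)) (ct L k n).toAddMonoidHom (fun i x => fc (G := G) k n i x)
    (fun i x => fc (G := G) k (n + 1) i x) x (fc_ct_zero L (n + 1) x) (fun i => fc_ct_succ L n i x) hx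

theorem Xc_fs_d (n : ℕ) (x : Sx F (n + 1) →₀ Y →₀ k) : (((Xc k G F).obj (fs Y (tr k (Sd G F)))).d (n + 1) n).hom x =
      ∑ i : Fin (n + 2), ((-1) ^ (i : ℕ) : ℤ) • fc (G := G) k n i x :=
    (Xc_d (fs Y (tr k (Sd G F))) n x).trans (Finset.sum_congr rfl fun i _ =>
      congrArg (fun u : Sx F n →₀ Y →₀ k => ((-1) ^ (i : ℕ) : ℤ) • u) (Xs_fc n i x))

theorem Xc_acyc (L : Slice G F Y T) (n : ℕ) : IsZero ((HF (Xc k G F) (n + 1)).obj (fs Y (tr k (Sd G F)))) := by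
  have hz : ∀ c : ((Xc k G F).obj (fs Y (tr k (Sd G F)))).homology (n + 1), c = 0 := fun c => by
    obtain ⟨x, hx, rfl⟩ := cl_surj c
    exact (cl_zero_iff hx).2 ⟨ct L k (n + 1) x, (Xc_fs_d (n + 1) _).trans
      (fc_ct_sum L n x ((Xc_fs_d n x).symm.trans hx))⟩
  have : Subsingleton (((Xc k G F).obj (fs Y (tr k (Sd G F)))).homology (n + 1)).V :=
    ⟨fun a b => (hz a).trans (hz b).symm⟩
  exact (Rep.isZero_iff _ _ _).2 this

/-- augmentation, linear map -/
def augL (L : Slice G F Y T) (k : Type) [CommRing k] : (Sx F 0 →₀ Y →₀ k) →ₗ[k] (T →₀ k) :=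
  Finsupp.lsum k (fun w : Sx F 0 => lx k L.q)

theorem augL_single (L : Slice G F Y T) (w : Sx F 0) (x : Y →₀ k) :
    augL L k (Finsupp.single w x) = lx k L.q x := Finsupp.lsum_single _ _ _ _

theorem augL_single2 (L : Slice G F Y T) (w : Sx F 0) (y : Y) (a : k) :
    augL L k (Finsupp.single w (Finsupp.single y a)) = Finsupp.single (L.q y) a :=
  (augL_single L w _).trans (wmap_single _ _ _ _)

theorem augL_surj (L : Slice G F Y T) : Function.Surjective (augL L k) := fun x => by
  refine ⟨Finsupp.single (nrm 1) (lx k L.s x), (augL_single L _ _).trans ((lx_comp _ _ _).trans ?_)⟩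
  refine Eq.trans ?_ (lx_id x)
  congr 2
  funext t
  exact L.qs t

theorem augL_fc (L : Slice G F Y T) (i : Fin 2) (x : Sx F 1 →₀ Y →₀ k) :
    augL L k (fc (G := G) k 0 i x) = Finsupp.lsum k (fun w : Sx F 1 => lx k L.q) x := by
  have : augL L k ∘ₗ (fc (G := G) k 0 i) = Finsupp.lsum k (fun w : Sx F 1 => lx k L.q) := by
    refine bx_ext fun w y a => ?_
    refine (congrArg (augL L k) (bx_single _ _ _ _ _)).trans ((augL_single2 _ _ _ _).trans ?_)
    refine Eq.trans ?_ (Finsupp.lsum_single k (fun w : Sx F 1 => lx k L.q) w (Finsupp.single y a)).symm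
    refine Eq.trans ?_ (wmap_single L.q (fun _ => LinearMap.id) y a).symm
    exact congrArg (fun u => Finsupp.single u a) (L.ql _ _)
  exact DFunLike.congr_fun this x

theorem augL_d (L : Slice G F Y T) (x : Sx F 1 →₀ Y →₀ k) :
    augL L k (∑ i : Fin 2, ((-1) ^ (i : ℕ) : ℤ) • fc (G := G) k 0 i x) = 0 := by
  have h : ∀ {A B : Type} [AddCommGroup A] [AddCommGroup B] (f : A →+ B) (u : Fin 2 → A) (h : f (u 0) = f (u 1)),
    f (∑ i : Fin 2, ((-1) ^ (i : ℕ) : ℤ) • u i) = 0 := by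
    intro A B _ _ f u h
    simp [Fin.sum_univ_two, h]
  exact h (augL L k).toAddMonoidHom (fun i => fc (G := G) k 0 i x) ((augL_fc L 0 x).trans (augL_fc L 1 x).symm)

theorem Sx0_eq (x y : Sx F 0) : x = y := Sx.ext fun i => by
  obtain rfl : i = 0 := Subsingleton.elim (α := Fin 1) _ _
  exact x.2.trans y.2.symm

theorem augL_ct (L : Slice G F Y T) (x : Sx F 0 →₀ Y →₀ k) (hx : augL L k x = 0) :
    (∑ i : Fin 2, ((-1) ^ (i : ℕ) : ℤ) • fc (G := G) k 0 i (ct L k 0 x)) = x := by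
  have h : ∀ {A : Type} [AddCommGroup A] (u : Fin 2 → A) (x : A) (h0 : u 0 = x) (h1 : u 1 = 0),
    (∑ i : Fin 2, ((-1) ^ (i : ℕ) : ℤ) • u i) = x := by
    intro A _ u x h0 h1
    simp [Fin.sum_univ_two, h0, h1]
  refine h (fun i => fc (G := G) k 0 i (ct L k 0 x)) x (fc_ct_zero L 0 x) ?_
  have : fc (G := G) k 0 1 ∘ₗ ct L k 0 = Finsupp.lsingle (nrm 1) ∘ₗ lx k L.s ∘ₗ augL L k := by
    refine bx_ext fun w y a => ?_
    refine (congrArg (fc (G := G) (F := F) (Y := Y) k 0 1) (bx_single _ _ _ _ _)).trans ((bx_single _ _ _ _ _).trans ?_)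
    refine Eq.trans ?_ (congrArg (fun u => Finsupp.single (nrm 1) (lx k L.s u)) (augL_single2 _ _ _ _)).symm
    refine Eq.trans ?_ (congrArg (Finsupp.single (nrm 1)) (wmap_single _ _ _ _)).symm
    refine congrArg₂ Finsupp.single ?_ (congrArg (fun u => Finsupp.single u a) ?_)
    · exact Sx0_eq _ _
    · change sinl G ((cone (L.v y) w).1 0)⁻¹ • L.s (L.q y) = _
      rw [(cone (L.v y) w).2, inv_one, map_one, one_smul]
  have h2 := DFunLike.congr_fun this x
  change fc (G := G) k 0 1 (ct L k 0 x) = Finsupp.single (nrm 1) (lx k L.s (augL L k x)) at h2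
  refine h2.trans ?_
  rw [hx, map_zero, Finsupp.single_zero]

/-- augmentation -/
def aug (L : Slice G F Y T) (k : Type) [CommRing k] :
    ((Xc k G F).obj (fs Y (tr k (Sd G F)))).X 0 ⟶ fs T (tr k G) :=
  Rep.ofHom ⟨augL L k, fun g => bx_ext fun w y a => by
    have e1 : (fs (Sx F 0) (Rep.res (sinr F) (fs Y (tr k (Sd G F))))).ρ g (Finsupp.single w (Finsupp.single y a)) =
      Finsupp.single (g • w) (Finsupp.single (sinr F g • y) a) :=
      (wmap_single _ _ _ _).trans (congrArg (Finsupp.single (g • w)) (wmap_single _ _ _ _))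
    refine (congrArg (augL L k) e1).trans ((augL_single2 _ _ _ _).trans ?_)
    refine Eq.trans ?_ (congrArg ((fs T (tr k G)).ρ g) (augL_single2 _ _ _ _)).symm
    refine Eq.trans ?_ (wmap_single _ _ _ _).symm
    exact congrArg (fun u => Finsupp.single u a) (L.qr g y)⟩

theorem aug_d (L : Slice G F Y T) : ((Xc k G F).obj (fs Y (tr k (Sd G F)))).d 1 0 ≫ aug L k = 0 := by
  refine Rep.hom_ext ?_
  ext x
  exact (congrArg (augL L k) (Xc_fs_d 0 x)).trans (augL_d L x)

/-- `H_0` -/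
def hzIso (L : Slice G F Y T) (k : Type) [CommRing k] : (HF (Xc k G F) 0).obj (fs Y (tr k (Sd G F))) ≅ fs T (tr k G) :=
  @asIso _ _ _ _ (hdesc _ (aug L k) (aug_d L)) (hdesc_iso _ (aug L k) (aug_d L) (augL_surj L)
    (fun x hx => ⟨ct L k 0 x, (Xc_fs_d 0 _).trans (augL_ct L x hx)⟩))

theorem hzIso_cl (L : Slice G F Y T) (x : Sx F 0 →₀ Y →₀ k) (hx) :
    (hzIso L k).hom.hom (cl ((Xc k G F).obj (fs Y (tr k (Sd G F)))) 0 x hx) = augL L k x := hdesc_cl _ _ _ _ _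

theorem hzIso_nat {Y' T' : Type} [MulAction (Sd G F) Y'] [MulAction G T'] (L : Slice G F Y T) (L' : Slice G F Y' T')
    (f : Y → Y') (hf : ∀ (g : Sd G F) y, f (g • y) = g • f y) (f' : T → T') (hf' : ∀ (g : G) y, f' (g • y) = g • f' y)
    (h : ∀ y, L'.q (f y) = f' (L.q y)) :
    (HF (Xc k G F) 0).map (fsS k f hf) ≫ (hzIso L' k).hom = (hzIso L k).hom ≫ fsS k f' hf' := by
  refine Rep.hom_ext ?_
  ext c
  obtain ⟨x, hx, rfl⟩ := cl_surj (K := (Xc k G F).obj (fs Y (tr k (Sd G F)))) c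
  refine (congrArg (hzIso L' k).hom.hom (cl_map ((Xc k G F).map (fsS k f hf)) hx)).trans ?_
  refine (hzIso_cl L' _ (map_cyc ((Xc k G F).map (fsS k f hf)) hx)).trans ?_
  refine Eq.trans ?_ (congrArg (fsS k f' hf').hom (hzIso_cl L x hx)).symm
  have : augL L' k ∘ₗ wmap (id : Sx F 0 → Sx F 0) (fun _ => lx k f) = lx k f' ∘ₗ augL L k := by
    refine bx_ext fun w y a => ?_
    refine (congrArg (augL L' k) ((wmap_single _ _ _ _).trans (congrArg (Finsupp.single (id w)) (wmap_single _ _ _ _)))).trans ?_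
    refine (augL_single2 _ _ _ _).trans ?_
    refine Eq.trans ?_ (congrArg (lx k f') (augL_single2 _ _ _ _)).symm
    refine Eq.trans ?_ (wmap_single _ _ _ _).symm
    exact congrArg (fun u => Finsupp.single u a) (h y)
  exact DFunLike.congr_fun this x
end acyc

end HNil

namespace HNil
open CategoryTheory.Limits MonoidalCategory Simplicial
set_option linter.unusedVariables false
set_option linter.unusedSectionVars false

section P4e
variable {k : Type} [CommRing k]
variable {G Z E E' : Type} [Group G] [Group Z] [Group E] [Group E'] [MulDistribMulAction G Z]
  [MulDistribMulAction G E] [MulDistribMulAction G E']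
variable {i : Z →* E} {f : E →* E'}

theorem sinl_left (e : E') : (sinl G e).left = e := rfl
theorem sinl_right (e : E') : (sinl G e).right = 1 := rfl
theorem sinr_left (g : G) : (sinr E' g).left = 1 := rfl
theorem sinr_right (g : G) : (sinr E' g).right = g := rfl

/-- the slice -/
def cSlice (C : CExt G i f) (n : ℕ) : Slice G E' ((YG (PAS C)).Y n) ((SG G E).Y n) where
  v := ylift (fun w => f (w 0)) (fun z w => by rw [map_mul, C.comp, one_mul])
  q := ylift nrm (fun z w => nrm_mul (i z) w)
  s t := ymk i t.1
  vl e y := by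
    obtain ⟨w, rfl⟩ := ymk_surj i y
    change f (C.s e * ((1 : G) • w 0)) = e * f (w 0)
    rw [map_mul, C.fs, one_smul]
  ql e y := by
    obtain ⟨w, rfl⟩ := ymk_surj i y
    change nrm (fun a => C.s e * ((1 : G) • w a)) = nrm w
    rw [nrm_mul]
    simp only [one_smul]
  qr g y := by
    obtain ⟨w, rfl⟩ := ymk_surj i y
    change nrm (fun a => C.s 1 * (g • w a)) = g • nrm w
    rw [nrm_mul, nrm_smul]
  qs t := nrm_self t
  vs t := by
    change f (t.1 0) = 1
    rw [t.2, map_one]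
  dec y := by
    obtain ⟨w, rfl⟩ := ymk_surj i y
    change ymk i (fun a => C.s (f (w 0)) * ((1 : G) • ((w 0)⁻¹ * w a))) = ymk i w
    obtain ⟨z, hz⟩ := C.ker2 (x := C.s (f (w 0))) (y := w 0) (C.fs _)
    refine (ymk_eq z fun a => ?_).symm
    rw [hz, one_smul, mul_assoc, mul_inv_cancel_left]

/-- coinvariants of the total simplicial set -/
def coIso (C : CExt G i f) (k : Type) [CommRing k] :
    lin k (YG (PAS C)) ⋙ HF (Xc k G E') 0 ≅ lin k (SG G E) :=
  NatIso.ofComponents (fun Δ => hzIso (cSlice C Δ.unop.len) k) (fun {Δ Δ'} θ => by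
    refine hzIso_nat (cSlice C Δ.unop.len) (cSlice C Δ'.unop.len) ((YG (PAS C)).pl θ.unop.toOrderHom) (fun g y => (YG (PAS C)).pl_smul _ g y)
      ((SG G E).pl θ.unop.toOrderHom) (fun g y => (SG G E).pl_smul _ g y) fun y => ?_
    obtain ⟨w, rfl⟩ := ymk_surj i y
    change nrm (w ∘ θ.unop.toOrderHom) = nrm (fun i => (w 0)⁻¹ * (w ∘ θ.unop.toOrderHom) i)
    rw [nrm_mul])

instance : (HF (Xc k G E') 0).Additive := by unfold HF; infer_instance

/-- the mapped complex -/
def mapIso (C : CExt G i f) (k : Type) [CommRing k] :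
    ((HF (Xc k G E') 0).mapHomologicalComplex _).obj (lch k (YG (PAS C))) ≅ lch k (SG G E) :=
  eqToIso (Functor.congr_obj (map_alternatingFaceMapComplex (HF (Xc k G E') 0)) (lin k (YG (PAS C)))) ≪≫
    (alternatingFaceMapComplex _).mapIso (coIso C k)

/-- normalized chains -/
def SGIso (k G E : Type) [CommRing k] [Group G] [Group E] [MulDistribMulAction G E] :
    lin k (SG G E) ≅ (Xs k G E).obj ((Infl k G E).obj (tr k G)) :=
  NatIso.ofComponents (fun Δ => Iso.refl (fs (Sx E Δ.unop.len) (tr k G))) (fun {Δ Δ'} θ => by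
    refine fs_ext fun s a => ?_
    refine (fsS_sg (H := G) (k := k) (pullS θ.unop.toOrderHom) (fun g s => (SG G E).pl_smul _ g s) s a).trans ?_
    exact (XsObj_map ((Infl k G E).obj (tr k G)) θ s a).symm)

def HnIso (k G E : Type) [CommRing k] [Group G] [Group E] [MulDistribMulAction G E] (n : ℕ) :
    (lch k (SG G E)).homology n ≅ Hn k G E n :=
  (HomologicalComplex.homologyFunctor _ _ n).mapIso ((alternatingFaceMapComplex _).mapIso (SGIso k G E))

/-- isomorphisms of representations from bijections -/
def repIso {A B : Rep.{0} k G} (φ : A.V →ₗ[k] B.V) (hb : Function.Bijective φ)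
    (h : ∀ g a, φ (A.ρ g a) = B.ρ g (φ a)) : A ≅ B :=
  haveI : Mono (Rep.ofHom ⟨φ, fun g => LinearMap.ext (h g)⟩ : A ⟶ B) := (Rep.mono_iff_injective _).2 hb.1
  haveI : Epi (Rep.ofHom ⟨φ, fun g => LinearMap.ext (h g)⟩ : A ⟶ B) := (Rep.epi_iff_surjective _).2 hb.2
  haveI := isIso_of_mono_of_epi (Rep.ofHom ⟨φ, fun g => LinearMap.ext (h g)⟩ : A ⟶ B)
  asIso (Rep.ofHom ⟨φ, fun g => LinearMap.ext (h g)⟩ : A ⟶ B)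

def EHn (k G E : Type) [CommRing k] [Group G] [Group E] [MulDistribMulAction G E] (n : ℕ) :
    (lch k (YG (PAE G E))).homology n ≅ Hn k G E n :=
  repIso _ (ynrm_bij (H₂ := G) (PAE G E) n)
    (fun g a => clsMap_ρ (S := YG (PAE G E)) (T := SG G E) (fun n => ynrm) ynrm_pl n g g (fun y => ynrm_smul g y) a) ≪≫ HnIso k G E n

/-- the fibre -/
def fibIso (C : CExt G i f) (n : ℕ) :
    (Infl k G E').obj ((lch k (YG (PAE G Z))).homology n) ≅ (lch k (YG (PAS C))).homology n :=
  repIso _ (fib_bij (k := k) (PAE G Z) (PAS C) C.retr.choose C.retr.choose_spec n) (fun γ a => by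
    have h : YC (MonoidHom.id Z) i i := fun z => ⟨z, fun x => map_mul i z x⟩
    have e : γ = sinl G γ.left * sinr E' γ.right := (SemidirectProduct.inl_left_mul_inr_right γ).symm
    have e2 : ((lch k (YG (PAS C))).homology n).ρ γ = ((lch k (YG (PAS C))).homology n).ρ (sinl G γ.left) *
      ((lch k (YG (PAS C))).homology n).ρ (sinr E' γ.right) := by rw [← map_mul, ← e]
    refine Eq.trans ?_ (DFunLike.congr_fun e2 _).symm
    refine Eq.trans ?_ (PAS_inl C _ _ _).symm
    refine clsMap_ρ (S := YG (PAE G Z)) (T := YG (PAS C)) (fun n => ymap i h n) (fun θ y => ymap_pl i h θ y) n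
      (sproj G E' γ) (sinr E' γ.right) (fun y => ?_) a
    obtain ⟨w, rfl⟩ := ymk_surj _ y
    obtain ⟨z, hz⟩ := C.ker2 (x := C.s 1) (y := 1) (by rw [C.fs, map_one])
    change ymk i (fun a => i (γ.right • w a)) = ymk i (fun a => C.s 1 * (γ.right • i (w a)))
    refine ymk_eq z fun a => ?_
    rw [hz, mul_one, C.hi])

def fibHn (C : CExt G i f) (n : ℕ) :
    (lch k (YG (PAS C))).homology n ≅ (Infl k G E').obj (Hn k G Z n) :=
  (fibIso C n).symm ≪≫ (Infl k G E').mapIso (EHn k G Z n)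

/-- augmentation -/
def sumL (k S : Type) [CommRing k] : (S →₀ k) →ₗ[k] k := Finsupp.lsum k (fun _ => LinearMap.id)

theorem sumL_single {S : Type} (s : S) (a : k) : sumL k S (Finsupp.single s a) = a := by
  simp [sumL]

theorem sumL_lx {S T : Type} (f : S → T) (x : S →₀ k) : sumL k T (lx k f x) = sumL k S x := by
  have : sumL k T ∘ₗ lx k f = sumL k S := Finsupp.lhom_ext fun s a =>
    (congrArg (sumL k T) (wmap_single _ _ _ _)).trans ((sumL_single _ _).trans (sumL_single _ _).symm)
  exact DFunLike.congr_fun this x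

def augS (k : Type) [CommRing k] (S : GS G) : (lch k S).X 0 ⟶ tr k G :=
  Rep.ofHom ⟨sumL k (S.Y 0), fun g => LinearMap.ext fun x => sumL_lx (k := k) (fun y : S.Y 0 => g • y) x⟩

theorem augS_D (S : GS G) (x : S.Y 1 →₀ k) : sumL k (S.Y 0) (S.D k 0 x) = 0 := by
  have h : ∀ {A B : Type} [AddCommGroup A] [Module k A] [AddCommGroup B] [Module k B] (φ : B →ₗ[k] k)
      (u : Fin 2 → A →ₗ[k] B) (x : A), φ (u 0 x) = φ (u 1 x) → φ ((∑ i : Fin 2, ((-1) ^ (i : ℕ) : ℤ) • u i) x) = 0 := by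
    intro A B _ _ _ _ φ u x h
    simp [Fin.sum_univ_two, h]
  exact h (sumL k (S.Y 0)) (fun i => lx k (S.pl (SimplexCategory.δ i).toOrderHom)) x
    ((sumL_lx _ x).trans (sumL_lx _ x).symm)

theorem augS_d (S : GS G) : (lch k S).d 1 0 ≫ augS k S = 0 := by
  refine Rep.hom_ext ?_
  ext x
  exact (congrArg (sumL k (S.Y 0)) (lch_d S 0 x)).trans (augS_D S x)

/-- `H_0` of a group -/
def H0Iso (k G E : Type) [CommRing k] [Group G] [Group E] [MulDistribMulAction G E] : Hn k G E 0 ≅ tr k G :=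
  (HnIso k G E 0).symm ≪≫ @asIso _ _ _ _ (hdesc (lch k (SG G E)) (augS k (SG G E)) (augS_d _))
    (hdesc_iso _ _ _ (fun a => ⟨Finsupp.single (nrm 1 : Sx E 0) a, sumL_single (S := Sx E 0) _ a⟩)
    (fun x hx => ⟨0, by
      have : ∀ x : Sx E 0 →₀ k, sumL k (Sx E 0) x = 0 → 0 = x := by
        intro x hx
        have e : x = Finsupp.single (nrm 1) (sumL k _ x) := by
          have : LinearMap.id = Finsupp.lsingle (nrm 1) ∘ₗ sumL k (Sx E 0) := Finsupp.lhom_ext fun s a => by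
            obtain rfl : s = nrm 1 := Sx0_eq _ _
            exact (congrArg (Finsupp.single (nrm 1)) (sumL_single (nrm 1) a)).symm
          exact DFunLike.congr_fun this x
        rw [hx, Finsupp.single_zero] at e
        exact e.symm
      exact (map_zero _).trans (this x hx)⟩))

variable {N : Subgroup G} {π : Set ℕ}

theorem ntriv_tr : NTriv N (tr ℤ G) := fun _ _ _ => rfl

theorem Xc_YG (C : CExt G i f) (p q : ℕ) : IsZero ((HF (Xc k G E') (p + 1)).obj ((lch k (YG (PAS C))).X q)) :=
  Xc_acyc (cSlice C q) p

theorem hnext_total (C : CExt G i f) (hE' : ∀ n, PC N π (Hn ℤ G E' n)) (hZ : ∀ n, PC N π (Hn ℤ G Z n)) (n : ℕ) :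
    PC N π (Hn ℤ G E n) := by
  refine (PP N π).prop_of_iso (HnIso ℤ G E n) ?_
  refine (PP N π).prop_of_iso ((HomologicalComplex.homologyFunctor _ _ n).mapIso (mapIso C ℤ)) ?_
  refine collapse_one (X := Xc ℤ G E') Xc_exact (PP N π) (lch ℤ (YG (PAS C))) (Xc_YG C) (fun p q => ?_) n
  refine (PP N π).prop_of_iso ((HF (Xc ℤ G E') p).mapIso (fibHn C q)).symm ?_
  exact uct p (fun i _ => hE' i) _ (hZ q)

theorem hnext_base (C : CExt G i f) (h0 : PC N π (tr ℤ G)) (hE : ∀ n, PC N π (Hn ℤ G E n)) (hZ : ∀ n, PC N π (Hn ℤ G Z n)) (n : ℕ) :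
    PC N π (Hn ℤ G E' n) := by
  induction n using Nat.strong_induction_on with
  | _ n ih =>
    cases n with
    | zero => exact (PP N π).prop_of_iso (H0Iso ℤ G E').symm h0
    | succ n =>
      refine (PP N π).prop_of_iso ((HF (Xc ℤ G E') (n + 1)).mapIso (fibHn C 0 ≪≫ (Infl ℤ G E').mapIso (H0Iso ℤ G Z))) ?_
      refine collapse_two (X := Xc ℤ G E') Xc_exact (PP N π) (lch ℤ (YG (PAS C))) (Xc_YG C) n (fun p q hp => ?_) (fun m => ?_)
      · refine (PP N π).prop_of_iso ((HF (Xc ℤ G E') p).mapIso (fibHn C q)).symm ?_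
        exact uct p (fun i hi => ih i (by omega)) _ (hZ q)
      · refine (PP N π).prop_of_iso ((HomologicalComplex.homologyFunctor _ _ m).mapIso (mapIso C ℤ)).symm ?_
        exact (PP N π).prop_of_iso (HnIso ℤ G E m).symm (hE m)

end P4e
end HNil

namespace HNil
open CategoryTheory.Limits MonoidalCategory Simplicial
set_option linter.unusedVariables false
set_option linter.unusedSectionVars false

section shiftlem
variable {k : Type} [CommRing k] {S T : Type}

theorem lx_eq (f : S → T) (x : S →₀ k) : lx k f x = Finsupp.mapDomain f x := by
  have : lx k f = Finsupp.lmapDomain k k f := Finsupp.lhom_ext fun s a => by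
    simp
  exact DFunLike.congr_fun this x

theorem lx_apply {f : S → T} (hf : Function.Injective f) (x : S →₀ k) (s : S) : lx k f x (f s) = x s := by
  rw [lx_eq, Finsupp.mapDomain_apply hf]

theorem lx_inj {f : S → T} (hf : Function.Injective f) : Function.Injective (lx k f) := fun x y h => by
  rw [lx_eq, lx_eq] at h
  exact Finsupp.mapDomain_injective hf h

theorem lx_surj {f : S → T} (hf : Function.Surjective f) : Function.Surjective (lx k f) := fun x => by
  obtain ⟨x', h⟩ := Finsupp.mapDomain_surjective hf x
  exact ⟨x', (lx_eq _ _).trans h⟩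

theorem shift_inj (τ : S → S) (v : S → ℤ) (hv : ∀ s, v (τ s) = v s + 1) (hτ : Function.Injective τ)
    (x : S →₀ k) (h : lx k τ x = x) : x = 0 := by
  ext s
  by_contra hs
  have h1 : ∀ s, x (τ s) = x s := fun s => by
    conv_lhs => rw [← h]
    exact lx_apply hτ x s
  have h2 : ∀ n : ℕ, x (τ^[n] s) = x s := fun n => by
    induction n with
    | zero => rfl
    | succ n ih => rw [Function.iterate_succ_apply', h1, ih]
  have h3 : ∀ n : ℕ, v (τ^[n] s) = v s + n := fun n => by
    induction n with
    | zero => simp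
    | succ n ih => rw [Function.iterate_succ_apply', hv, ih]; push_cast; ring
  refine Set.infinite_of_injective_forall_mem (s := (x.support : Set S)) (f := fun n : ℕ => τ^[n] s) ?_ ?_ x.support.finite_toSet
  · intro a b hab
    have := congrArg v hab
    beta_reduce at this
    rw [h3, h3] at this
    omega
  · intro n
    simp only [Finset.mem_coe, Finsupp.mem_support_iff]
    rw [h2]
    exact hs

theorem shift_exact (τ : S → S) (q : S → T) (σ : T → S) 
    (h : ∀ s, ∃ n : ℕ, τ^[n] s = σ (q s) ∨ τ^[n] (σ (q s)) = s)
    (x : S →₀ k) (hx : lx k q x = 0) : ∃ y, lx k τ y - y = x := by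
  let W := LinearMap.range (lx k τ - LinearMap.id)
  have h1 : ∀ (n : ℕ) s (a : k), Finsupp.single (τ^[n] s) a - Finsupp.single s a ∈ W := fun n s a => by
    induction n with
    | zero => simp
    | succ n ih =>
      have : Finsupp.single (τ (τ^[n] s)) a - Finsupp.single (τ^[n] s) a ∈ W := ⟨Finsupp.single (τ^[n] s) a, by simp⟩
      have := W.add_mem this ih
      rw [Function.iterate_succ_apply']
      simpa using this
  have h2 : ∀ x : S →₀ k, x - lx k σ (lx k q x) ∈ W := fun x => by
    induction x using Finsupp.induction_linear with
    | zero => simp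
    | add x y hx hy =>
      have := W.add_mem hx hy
      rw [map_add, map_add]
      convert this using 1
      abel
    | single s a =>
      rw [wmap_single, wmap_single]
      obtain ⟨n, hn | hn⟩ := h s
      · have := W.neg_mem (h1 n s a)
        rw [hn] at this
        simpa using this
      · have := h1 n (σ (q s)) a
        rw [hn] at this
        simpa using this
  have := h2 x
  rw [hx, map_zero, sub_zero] at this
  obtain ⟨y, hy⟩ := this
  exact ⟨y, hy⟩
end shiftlem

/-- finitely generated torsion-free -/
def FT (X : Type) [AddCommGroup X] : Prop :=
  AddGroup.FG X ∧ ∀ (n : ℕ) (x : X), n ≠ 0 → n • x = 0 → x = 0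

theorem FT.mid {A B C : Type} [AddCommGroup A] [AddCommGroup B] [AddCommGroup C] (f : A →+ B) (g : B →+ C)
    (hf : Function.Injective f) (h : ∀ b, g b = 0 → ∃ a, f a = b) (hA : FT A) (hC : FT C) : FT B := by
  refine ⟨?_, fun n b hn hb => ?_⟩
  · have := AddGroup.fg_iff_addMonoid_fg.1 hA.1
    have h1 : Module.Finite ℤ A := Module.Finite.iff_addGroup_fg.2 hA.1
    have h2 : Module.Finite ℤ C := Module.Finite.iff_addGroup_fg.2 hC.1
    refine Module.Finite.iff_addGroup_fg.1 ⟨?_⟩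
    refine Submodule.fg_of_fg_map_of_fg_inf_ker g.toIntLinearMap (IsNoetherian.noetherian _) ?_
    rw [top_inf_eq]
    have : LinearMap.ker g.toIntLinearMap ≤ LinearMap.range f.toIntLinearMap := fun b hb => h b hb
    have h3 : (LinearMap.range f.toIntLinearMap).FG := by
      rw [LinearMap.range_eq_map]; exact Submodule.FG.map _ h1.1
    have h4 := isNoetherian_of_fg_of_noetherian _ h3
    have h5 := (isNoetherian_submodule.1 h4) _ this
    exact h5
  · obtain ⟨a, rfl⟩ := h b (hC.2 n _ hn (by rw [← map_nsmul, hb, map_zero]))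
    rw [hA.2 n a hn (hf (by rw [map_nsmul, hb, map_zero])), map_zero]

theorem FT.of_bij {A B : Type} [AddCommGroup A] [AddCommGroup B] (f : A →+ B)
    (hf : Function.Bijective f) (hA : FT A) : FT B :=
  FT.mid f (0 : B →+ A) hf.1 (fun b _ => hf.2 b) hA hA

theorem ym_q_YC {Z E : Type} [Group Z] [Group E] (i : Z →* E) : YC i (MonoidHom.id E) id := fun z => ⟨i z, fun x => rfl⟩

section cyc
variable {Z E : Type} [CommGroup Z] [CommGroup E]

/-- split extension by an infinite cyclic group -/
structure CycE (i : Z →* E) (v : E → ℤ) (t : E) : Prop where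
  mul : ∀ x y, v (x * y) = v x + v y
  inj : Function.Injective i
  vi : ∀ z, v (i z) = 0
  ker : ∀ x, v x = 0 → ∃ z, i z = x
  vt : v t = 1

variable {i : Z →* E} {v : E → ℤ} {t : E} (C : CycE i v t)

theorem tr_YC (i : Z →* E) (t : E) : YC i i (fun x => t * x) := fun z => ⟨z, fun x => mul_left_comm _ _ _⟩

theorem CycE.v_pow (C : CycE i v t) (n : ℕ) (x : E) : v (t ^ n * x) = v x + n := by
  induction n with
  | zero => simp
  | succ n ih => rw [pow_succ', mul_assoc, C.mul, ih, C.vt]; push_cast; ring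

theorem CycE.v_one (C : CycE i v t) : v 1 = 0 := by
  have := C.mul 1 1
  rw [mul_one] at this
  omega

theorem CycE.v_inv (C : CycE i v t) (x : E) : v x⁻¹ = - v x := by
  have := C.mul x⁻¹ x
  rw [inv_mul_cancel, C.v_one] at this
  omega

theorem tau_iter (n m : ℕ) (w : Fin (n + 1) → E) :
    (ymap (fun x => t * x) (tr_YC i t) n)^[m] (ymk i w) = ymk i (fun a => t ^ m * w a) := by
  induction m with
  | zero => simp
  | succ m ih =>
    rw [Function.iterate_succ_apply', ih]
    change ymk i (fun a => t * (t ^ m * w a)) = _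
    congr 1
    funext a
    rw [pow_succ', mul_assoc]

/-- section -/
def ysec (i : Z →* E) (n : ℕ) : Yq (MonoidHom.id E) n → Yq i n := fun y => ymk i (ynrm y).1

theorem CycE.eq_of (C : CycE i v t) {n : ℕ} (e : E) (w : Fin (n + 1) → E) (h : v e = 0) :
    ymk i (fun a => e * w a) = ymk i w := by
  obtain ⟨z, rfl⟩ := C.ker e h
  exact (ymk_eq z fun a => rfl).symm

theorem cyc_dec (C : CycE i v t) (n : ℕ) (s : Yq i n) : ∃ m : ℕ,
    (ymap (fun x => t * x) (tr_YC i t) n)^[m] s = ysec i n (ymap id (ym_q_YC i) n s) ∨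
    (ymap (fun x => t * x) (tr_YC i t) n)^[m] (ysec i n (ymap id (ym_q_YC i) n s)) = s := by
  obtain ⟨w, rfl⟩ := ymk_surj i s
  have e : ysec i n (ymap id (ym_q_YC i) n (ymk i w)) = ymk i (fun a => (w 0)⁻¹ * w a) := rfl
  rw [e]
  refine ⟨(v (w 0)).natAbs, ?_⟩
  rw [tau_iter, tau_iter]
  rcases le_total 0 (v (w 0)) with h | h
  · right
    refine Eq.trans ?_ (C.eq_of (t ^ (v (w 0)).natAbs * (w 0)⁻¹) w ?_)
    · congr 1
      funext a
      rw [mul_assoc]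
    · rw [C.v_pow, C.v_inv]; omega
  · left
    refine Eq.trans ?_ (C.eq_of (t ^ (v (w 0)).natAbs * w 0) _ ?_)
    · congr 1
      funext a
      rw [mul_assoc, mul_inv_cancel_left]
    · rw [C.v_pow]; omega

theorem tau_inj (n : ℕ) : Function.Injective (ymap (fun x => t * x) (tr_YC i t) n) := by
  intro y y' h
  obtain ⟨w, rfl⟩ := ymk_surj i y
  obtain ⟨w', rfl⟩ := ymk_surj i y'
  obtain ⟨z, hz⟩ := ymk_exact (show ymk i (fun a => t * w a) = ymk i (fun a => t * w' a) from h)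
  refine ymk_eq z fun a => ?_
  have := hz a
  beta_reduce at this
  rw [mul_left_comm] at this
  exact mul_left_cancel this

def CycE.vv (C : CycE i v t) (n : ℕ) : Yq i n → ℤ := ylift (fun w => v (w 0)) (fun z w => by
  rw [C.mul, C.vi, zero_add])

theorem CycE.vv_tau (C : CycE i v t) (n : ℕ) (y : Yq i n) :
    C.vv n (ymap (fun x => t * x) (tr_YC i t) n y) = C.vv n y + 1 := by
  obtain ⟨w, rfl⟩ := ymk_surj i y
  change v (t * w 0) = v (w 0) + 1
  rw [C.mul, C.vt, add_comm]

theorem q_surj (i : Z →* E) (n : ℕ) : Function.Surjective (ymap id (ym_q_YC i) n : Yq i n → Yq (MonoidHom.id E) n) := by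
  intro y
  obtain ⟨w, rfl⟩ := ymk_surj _ y
  exact ⟨ymk i w, rfl⟩
end cyc
end HNil

namespace HNil
open CategoryTheory.Limits MonoidalCategory Simplicial
set_option linter.unusedVariables false
set_option linter.unusedSectionVars false

theorem FT.of_lin {A B : Type} [AddCommGroup A] [AddCommGroup B] {mA : Module ℤ A} {mB : Module ℤ B} {f : A →ₗ[ℤ] B}
    (hf : Function.Bijective f) (hA : FT A) : FT B := FT.of_bij f.toAddMonoidHom hf hA

section wang
variable {k : Type} [CommRing k] {S T : GS U1}

/-- Wang sequence -/
def wangS (τ : ∀ n, S.Y n → S.Y n)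
    (hτ : ∀ {m n : ℕ} (θ : Fin (m + 1) →o Fin (n + 1)) (y : S.Y n), τ m (S.pl θ y) = S.pl θ (τ n y))
    (q : ∀ n, S.Y n → T.Y n)
    (hq : ∀ {m n : ℕ} (θ : Fin (m + 1) →o Fin (n + 1)) (y : S.Y n), q m (S.pl θ y) = T.pl θ (q n y))
    (hc : lchMap k τ (fun n => unit_eqv _) hτ ≫ lchMap k q (fun n => unit_eqv _) hq = lchMap k q (fun n => unit_eqv _) hq) :
    ShortComplex (ChainComplex (Rep.{0} k U1) ℕ) :=
  ShortComplex.mk (lchMap k τ (fun n => unit_eqv _) hτ - 𝟙 _) (lchMap k q (fun n => unit_eqv _) hq)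
    (by rw [Preadditive.sub_comp, hc, Category.id_comp, sub_self])

theorem lchMap_tq (τ : ∀ n, S.Y n → S.Y n)
    (hτ : ∀ {m n : ℕ} (θ : Fin (m + 1) →o Fin (n + 1)) (y : S.Y n), τ m (S.pl θ y) = S.pl θ (τ n y))
    (q : ∀ n, S.Y n → T.Y n)
    (hq : ∀ {m n : ℕ} (θ : Fin (m + 1) →o Fin (n + 1)) (y : S.Y n), q m (S.pl θ y) = T.pl θ (q n y))
    (h : ∀ n y, q n (τ n y) = q n y) :
    lchMap k τ (fun n => unit_eqv _) hτ ≫ lchMap k q (fun n => unit_eqv _) hq = lchMap k q (fun n => unit_eqv _) hq := by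
  refine HomologicalComplex.Hom.ext (funext fun n => ?_)
  exact fsS_tr (τ n) (unit_eqv _) (q n) (unit_eqv _) (q n) (unit_eqv _) (h n)

theorem shift_aux {S : Type} (τ : S → S) (x y : S →₀ k) (h : lx k τ x - x = lx k τ y - y) : lx k τ (x - y) = x - y := by
  rw [map_sub]
  exact sub_eq_sub_iff_sub_eq_sub.1 h

theorem wang_se (τ : ∀ n, S.Y n → S.Y n)
    (hτ : ∀ {m n : ℕ} (θ : Fin (m + 1) →o Fin (n + 1)) (y : S.Y n), τ m (S.pl θ y) = S.pl θ (τ n y))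
    (q : ∀ n, S.Y n → T.Y n)
    (hq : ∀ {m n : ℕ} (θ : Fin (m + 1) →o Fin (n + 1)) (y : S.Y n), q m (S.pl θ y) = T.pl θ (q n y))
    (hc)
    (h1 : ∀ n (x : S.Y n →₀ k), lx k (τ n) x = x → x = 0)
    (h2 : ∀ n (x : S.Y n →₀ k), lx k (q n) x = 0 → ∃ y, lx k (τ n) y - y = x)
    (h3 : ∀ n, Function.Surjective (q n)) : (wangS (k := k) τ hτ q hq hc).ShortExact := by
  refine HomologicalComplex.shortExact_of_degreewise_shortExact _ fun n => ?_
  refine (rep_shortExact_iff' _).2 ⟨fun x hx => ?_, fun x y hxy => ?_, fun x => lx_surj (h3 n) x⟩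
  · exact h2 n x hx
  · refine sub_eq_zero.1 (h1 n (x - y : S.Y n →₀ k) ?_)
    exact shift_aux (τ n) x y hxy

theorem wang_les (τ : ∀ n, S.Y n → S.Y n)
    (hτ : ∀ {m n : ℕ} (θ : Fin (m + 1) →o Fin (n + 1)) (y : S.Y n), τ m (S.pl θ y) = S.pl θ (τ n y))
    (q : ∀ n, S.Y n → T.Y n)
    (hq : ∀ {m n : ℕ} (θ : Fin (m + 1) →o Fin (n + 1)) (y : S.Y n), q m (S.pl θ y) = T.pl θ (q n y))
    (h : ∀ n y, q n (τ n y) = q n y)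
    (h1 : ∀ n (x : S.Y n →₀ k), lx k (τ n) x = x → x = 0)
    (h2 : ∀ n (x : S.Y n →₀ k), lx k (q n) x = 0 → ∃ y, lx k (τ n) y - y = x)
    (h3 : ∀ n, Function.Surjective (q n))
    (ho : ∀ n (x : S.Y n →₀ k), S.Dm k n x = 0 → ∃ b, S.D k n b = lx k (τ n) x - x) (n : ℕ) :
    ∃ (f : (lch k S).homology n →+ (lch k T).homology n) (g : (lch k T).homology n →+ (lch k S).homology (n - 1)),
      Function.Injective f ∧ ∀ b, g b = 0 → ∃ a, f a = b := by
  have hS := wang_se τ hτ q hq (lchMap_tq τ hτ q hq h) h1 h2 h3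
  have hz : ∀ n c, (HomologicalComplex.homologyMap (wangS (k := k) τ hτ q hq (lchMap_tq τ hτ q hq h)).f n).hom c = 0 := fun n c => by
    obtain ⟨x, hx, rfl⟩ := S.cls_surj c
    refine (cl_map _ _).trans ?_
    refine (cl_zero_iff _).2 ?_
    obtain ⟨b, hb⟩ := ho n x hx
    exact ⟨b, (lch_d S n b).trans hb⟩
  have hinj : ∀ n, Function.Injective (HomologicalComplex.homologyMap (wangS (k := k) τ hτ q hq (lchMap_tq τ hτ q hq h)).g n).hom := fun n => by
    refine (injective_iff_map_eq_zero _).2 fun x hx => ?_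
    obtain ⟨y, rfl⟩ := (rep_exact_iff' _).1 (hS.homology_exact₂ n) x hx
    exact hz n y
  cases n with
  | zero =>
    refine ⟨(HomologicalComplex.homologyMap (wangS (k := k) τ hτ q hq (lchMap_tq τ hτ q hq h)).g 0).hom.toLinearMap.toAddMonoidHom, 0, hinj 0, fun b _ => ?_⟩
    obtain ⟨x, hx, rfl⟩ := T.cls_surj b
    obtain ⟨y, rfl⟩ := lx_surj (h3 0) x
    exact ⟨S.cls 0 y rfl, (cl_map _ _)⟩
  | succ n =>
    exact ⟨(HomologicalComplex.homologyMap (wangS (k := k) τ hτ q hq (lchMap_tq τ hτ q hq h)).g (n + 1)).hom.toLinearMap.toAddMonoidHom,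
      (hS.δ (n + 1) n (by simp)).hom.toLinearMap.toAddMonoidHom, hinj _, fun b hb =>
        (rep_exact_iff' _).1 (hS.homology_exact₃ (n + 1) n (by simp)) b hb⟩
end wang

theorem cyc_ft {Z E : Type} [CommGroup Z] [CommGroup E] {i : Z →* E} {v : E → ℤ} {t : E} (C : CycE i v t)
    (hF : ∀ n, FT ((lch ℤ (YG (PA0 i))).homology n)) (n : ℕ) :
    FT ((lch ℤ (YG (PA0 (MonoidHom.id E)))).homology n) := by
  obtain ⟨f, g, hf, hg⟩ := wang_les (k := ℤ) (S := YG (PA0 i)) (T := YG (PA0 (MonoidHom.id E)))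
    (fun n => ymap (fun x => t * x) (tr_YC i t) n) (fun θ y => ymap_pl _ (tr_YC i t) θ y)
    (fun n => ymap id (ym_q_YC i) n) (fun θ y => ymap_pl _ (ym_q_YC i) θ y)
    (fun n y => by
      obtain ⟨w, rfl⟩ := ymk_surj _ y
      exact (ymk_eq t fun a => rfl).symm)
    (fun n x hx => shift_inj _ (C.vv n) (C.vv_tau n) (tau_inj n) x hx)
    (fun n x hx => shift_exact _ _ _ (cyc_dec C n) x hx) (q_surj i)
    (fun n x hx => by
      obtain ⟨b, hb⟩ := yHo_cls (k := ℤ) (fun x => t * x) id (i := i) (i' := i) (fun z => ⟨z, fun x => ⟨mul_left_comm _ _ _, rfl⟩⟩) n x hx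
      refine ⟨b, hb.trans ?_⟩
      refine congrArg₂ _ rfl ?_
      have : ymap id (fun z => ⟨z, fun x => rfl⟩ : YC i i id) n = id := funext fun y => by
        obtain ⟨w, rfl⟩ := ymk_surj _ y; rfl
      exact (congrArg (fun u => lx ℤ u x) this).trans (lx_id x)) n
  exact FT.mid f g hf hg (hF n) (hF (n - 1))

theorem sumL_D {k : Type} [CommRing k] {H : Type} [Group H] (S : GS H) (n : ℕ) (x : S.Y (n + 1) →₀ k) :
    sumL k (S.Y n) (S.D k n x) = (∑ i : Fin (n + 2), ((-1) ^ (i : ℕ) : ℤ)) • sumL k _ x := by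
  have h : ∀ {A B : Type} [AddCommGroup A] [Module k A] [AddCommGroup B] [Module k B] (φ : B →ₗ[k] k)
      (u : Fin (n + 2) → A →ₗ[k] B) (x : A) (s : k), (∀ i, φ (u i x) = s) →
      φ ((∑ i : Fin (n + 2), ((-1) ^ (i : ℕ) : ℤ) • u i) x) = (∑ i : Fin (n + 2), ((-1) ^ (i : ℕ) : ℤ)) • s := by
    intro A B _ _ _ _ φ u x s h
    rw [LinearMap.sum_apply, map_sum, Finset.sum_smul]
    refine Finset.sum_congr rfl fun i _ => ?_
    rw [LinearMap.smul_apply, map_zsmul, h]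
  exact h (sumL k (S.Y n)) (fun i => lx k (S.pl (SimplexCategory.δ i).toOrderHom)) x _ fun i => sumL_lx _ x

theorem sumL_inj {k : Type} [CommRing k] {S : Type} (hs : ∀ s t : S, s = t) : Function.Injective (sumL k S) := by
  refine (injective_iff_map_eq_zero _).2 fun x hx => ?_
  ext s
  have : x = Finsupp.single s (x s) := by
    ext t
    obtain rfl := hs s t
    simp
  rw [this, sumL_single] at hx
  exact hx

theorem altsum (n : ℕ) : (∑ i : Fin (n + 2), ((-1) ^ (i : ℕ) : ℤ)) = if Even n then 0 else 1 := by
  rw [Fin.sum_univ_eq_sum_range (fun i => ((-1) ^ i : ℤ)) (n + 2), neg_one_geom_sum]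
  simp [Nat.even_add]

theorem sub_ft {H : Type} [Group H] (S : GS H) (u : ∀ n, S.Y n) (hs : ∀ n (s t : S.Y n), s = t) (n : ℕ) :
    FT ((lch ℤ S).homology n) := by
  have hz : ∀ n, (∀ c : (lch ℤ S).homology n, c = 0) → FT ((lch ℤ S).homology n) := fun n h =>
    ⟨AddGroup.fg_def.2 ⟨∅, by
      rw [Finset.coe_empty, AddSubgroup.closure_empty]
      exact (AddSubgroup.ext fun c => ⟨fun _ => trivial, fun _ => (h c)⟩)⟩, fun _ x _ _ => h x⟩
  rcases n with _ | n
  · refine FT.of_bij (A := ℤ) (AddMonoidHom.mk' (fun a => S.cls 0 (Finsupp.single (u 0) a) rfl) ?_) ⟨?_, ?_⟩ ?_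
    · intro a b
      refine Eq.trans ?_ (S.cls_add _ _ rfl)
      congr 1
      exact Finsupp.single_add _ _ _
    · refine (injective_iff_map_eq_zero _).2 fun a ha => ?_
      obtain ⟨y, hy⟩ := (S.cls_zero_iff (n := 0) (x := Finsupp.single (u 0) a) rfl).1 ha
      have := (sumL_D S 0 y).symm.trans (congrArg (sumL ℤ (S.Y 0)) hy)
      rw [altsum, sumL_single] at this
      simpa using this.symm
    · intro c
      obtain ⟨x, hx, rfl⟩ := S.cls_surj c
      refine ⟨sumL ℤ _ x, ?_⟩
      change S.cls 0 _ rfl = _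
      congr 1
      exact sumL_inj (hs 0) (sumL_single _ _)
    · exact ⟨inferInstance, fun n x hn hx => by simpa [hn] using hx⟩
  · refine hz _ fun c => ?_
    obtain ⟨x, hx, rfl⟩ := S.cls_surj c
    by_cases hn : Even n
    · refine (S.cls_zero_iff hx).2 ⟨Finsupp.single (u (n + 2)) (sumL ℤ _ x), sumL_inj (hs _) ?_⟩
      rw [sumL_D, altsum, sumL_single, if_neg (by simpa [Nat.even_add_one] using hn), one_smul]
    · have h0 : x = 0 := sumL_inj (hs _) (by
        have := (sumL_D S n x).symm.trans (congrArg (sumL ℤ (S.Y n)) hx)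
        rw [altsum, if_neg hn, one_smul] at this
        rw [this, map_zero, map_zero])
      exact (S.cls_zero_iff hx).2 ⟨0, by rw [h0, map_zero]⟩

/-- FT homology of `ℤ^r` -/
theorem zr_ft (r n : ℕ) : FT ((lch ℤ (YG (PA0 (MonoidHom.id (Multiplicative (Fin r → ℤ)))))).homology n) := by
  induction r generalizing n with
  | zero =>
    refine sub_ft (YG (PA0 (MonoidHom.id (Multiplicative (Fin 0 → ℤ))))) (fun n => ymk _ (fun _ => 1)) (fun n s t => ?_) n
    obtain ⟨w, rfl⟩ := ymk_surj _ s
    obtain ⟨w', rfl⟩ := ymk_surj _ t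
    congr 1
    funext a
    exact Subsingleton.elim (α := Fin 0 → ℤ) _ _
  | succ r ih =>
    let i : Multiplicative (Fin r → ℤ) →* Multiplicative (Fin (r + 1) → ℤ) :=
      AddMonoidHom.toMultiplicative (AddMonoidHom.mk' (fun w => (Fin.cons 0 w : Fin (r + 1) → ℤ)) (fun a b => by
        funext j; refine Fin.cases ?_ (fun j => ?_) j <;> simp))
    have C : CycE i (fun x => Multiplicative.toAdd x 0) (Multiplicative.ofAdd (Pi.single 0 1)) :=
      { mul := fun x y => rfl
        inj := fun x y h => by
          have : (Fin.cons 0 x.toAdd : Fin (r + 1) → ℤ) = Fin.cons 0 y.toAdd := h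
          exact Fin.cons_right_injective (α := fun _ => ℤ) 0 this
        vi := fun z => rfl
        ker := fun x hx => ⟨Multiplicative.ofAdd (Fin.tail x.toAdd), by
          change (Fin.cons 0 (Fin.tail x.toAdd) : Fin (r + 1) → ℤ) = x.toAdd
          rw [← hx]
          exact Fin.cons_self_tail _⟩
        vt := by simp }
    refine cyc_ft C (fun n => ?_) n
    exact FT.of_lin (fib_bij (PA0 (MonoidHom.id (Multiplicative (Fin r → ℤ)))) (PA0 i)
      (fun x => Multiplicative.ofAdd (Fin.tail x.toAdd)) (fun z x => rfl) n) (ih n)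

theorem ymap_iso_bij {k : Type} [CommRing k] {E E' : Type} [Group E] [Group E'] (e : E ≃* E') {H H' : Type} [Group H] [Group H']
    (P : PA H (MonoidHom.id E)) (P' : PA H' (MonoidHom.id E')) (n : ℕ)
    (h : YC (MonoidHom.id E) (MonoidHom.id E') e := fun z => ⟨e z, fun x => map_mul e z x⟩) :
    Function.Bijective (clsMap (YG P) (YG P') k (fun n => ymap e h n) (fun θ y => ymap_pl e h θ y) n) := by
  refine clsMap_bij_of_bij (S := YG P) (T := YG P') _ _ (fun n => ymap e.symm (fun z => ⟨e.symm z, fun x => map_mul e.symm z x⟩) n) ?_ ?_ n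
  · intro n y
    obtain ⟨w, rfl⟩ := ymk_surj _ y
    exact congrArg (ymk _) (funext fun a => e.symm_apply_apply _)
  · intro n y
    obtain ⟨w, rfl⟩ := ymk_surj _ y
    exact congrArg (ymk _) (funext fun a => e.apply_symm_apply _)

theorem fg_ft {L : Type} [AddCommGroup L] (hL : FT L) (n : ℕ) :
    FT ((lch ℤ (YG (PA0 (MonoidHom.id (Multiplicative L))))).homology n) := by
  have h1 : Module.Finite ℤ L := Module.Finite.iff_addGroup_fg.2 hL.1
  have h2 : Module.IsTorsionFree ℤ L := by
    exact torsionFree_of_tf hL.2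
  have b := Module.finBasis ℤ L
  exact FT.of_lin
    (ymap_iso_bij (AddEquiv.toMultiplicative b.equivFun.toAddEquiv.symm) (PA0 _) (PA0 _) n) (zr_ft _ n)
end HNil

namespace HNil
open CategoryTheory.Limits MonoidalCategory Simplicial
set_option linter.unusedVariables false
set_option linter.unusedSectionVars false

theorem fg_ft' {E : Type} [CommGroup E] (h1 : Group.FG E) (h2 : ∀ (n : ℕ) (x : E), n ≠ 0 → x ^ n = 1 → x = 1) (n : ℕ) :
    FT ((lch ℤ (YG (PA0 (MonoidHom.id E)))).homology n) := by
  have h : FT (Additive E) := ⟨inferInstance, fun n x hn hx => h2 n x.toMul hn hx⟩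
  exact FT.of_lin (ymap_iso_bij (MulEquiv.refl E : Multiplicative (Additive E) ≃* E) (PA0 _) (PA0 _) n) (fg_ft h n)

section transfer
variable {k : Type} [CommRing k] {Z E : Type} [CommGroup Z] [CommGroup E] (i : Z →* E)

/-- coset representative -/
def crep (c : E ⧸ i.range) : E := Quotient.out c

theorem crep_mk (c : E ⧸ i.range) : (QuotientGroup.mk (crep i c) : E ⧸ i.range) = c := Quotient.out_eq _

variable [Fintype (E ⧸ i.range)]

def trw (k : Type) [CommRing k] (n : ℕ) (w : Fin (n + 1) → E) : k →ₗ[k] (Yq i n →₀ k) :=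
  ∑ c : E ⧸ i.range, Finsupp.lsingle (ymk i (fun a => crep i c * w a))

theorem trw_inv (n : ℕ) (z : E) (w : Fin (n + 1) → E) : trw i k n (fun a => z * w a) = trw i k n w := by
  unfold trw
  refine Fintype.sum_equiv (Equiv.mulRight (QuotientGroup.mk z : E ⧸ i.range)) _ _ fun c => ?_
  congr 1
  have : (QuotientGroup.mk (crep i (c * QuotientGroup.mk z)) : E ⧸ i.range) = QuotientGroup.mk (crep i c * z) := by
    rw [crep_mk, QuotientGroup.mk_mul, crep_mk]
  obtain ⟨l, hl⟩ := QuotientGroup.eq.1 this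
  refine (ymk_eq l fun a => ?_).symm
  change _ = i l * (crep i (c * QuotientGroup.mk z) * w a)
  rw [hl]
  rw [← mul_assoc, ← mul_assoc]
  congr 1
  rw [mul_comm _ (crep i (c * QuotientGroup.mk z)), mul_inv_cancel_left]

/-- transfer -/
def trf (k : Type) [CommRing k] (n : ℕ) : (Yq (MonoidHom.id E) n →₀ k) →ₗ[k] (Yq i n →₀ k) :=
  Finsupp.lsum k (fun y => ylift (i := MonoidHom.id E) (trw i k n) (fun z w => trw_inv i n z w) y)

theorem trf_single (n : ℕ) (w : Fin (n + 1) → E) (a : k) :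
    trf i k n (Finsupp.single (ymk (MonoidHom.id E) w) a) = trw i k n w a := by
  unfold trf
  rw [Finsupp.lsum_single]
  rfl

theorem trf_pl {m n : ℕ} (θ : Fin (m + 1) → Fin (n + 1)) (x : Yq (MonoidHom.id E) n →₀ k) :
    lx k (ypl θ) (trf i k n x) = trf i k m (lx k (ypl θ) x) := by
  have : (lx k (ypl θ)) ∘ₗ (trf i k n) = trf i k m ∘ₗ (lx k (ypl θ)) := Finsupp.lhom_ext fun s a => by
    obtain ⟨w, rfl⟩ := ymk_surj _ s
    rw [LinearMap.comp_apply, LinearMap.comp_apply, trf_single, wmap_single, ypl_mk]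
    refine Eq.trans ?_ (trf_single i m (w ∘ θ) a).symm
    unfold trw
    rw [LinearMap.sum_apply, LinearMap.sum_apply, map_sum]
    refine Finset.sum_congr rfl fun c _ => ?_
    rw [Finsupp.lsingle_apply, wmap_single]
    rfl
  exact DFunLike.congr_fun this x

theorem trf_q (n : ℕ) (x : Yq (MonoidHom.id E) n →₀ k) :
    lx k (ymap id (ym_q_YC i) n) (trf i k n x) = Fintype.card (E ⧸ i.range) • x := by
  have : (lx k (ymap id (ym_q_YC i) n)) ∘ₗ (trf i k n) = Fintype.card (E ⧸ i.range) • LinearMap.id := Finsupp.lhom_ext fun s a => by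
    obtain ⟨w, rfl⟩ := ymk_surj _ s
    rw [LinearMap.comp_apply, trf_single]
    unfold trw
    rw [LinearMap.sum_apply, map_sum, LinearMap.smul_apply]
    refine (Finset.sum_congr rfl (g := fun _ => Finsupp.single (ymk (MonoidHom.id E) w) a) fun c _ => ?_).trans ?_
    · rw [Finsupp.lsingle_apply, wmap_single]
      refine congrArg (fun y => Finsupp.single y a) ?_
      exact (ymk_eq (crep i c) fun a => rfl).symm
    · rw [Finset.sum_const, Finset.card_univ]; rfl
  exact DFunLike.congr_fun this x

theorem trf_Dm (n : ℕ) (x : Yq (MonoidHom.id E) n →₀ k) :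
    (YG (PA0 i)).Dm k n (trf i k n x) = trf i k (n - 1) ((YG (PA0 (MonoidHom.id E))).Dm k n x) := by
  cases n with
  | zero => exact (map_zero (trf i k 0)).symm
  | succ n =>
    have h : ∀ {A B A' B' : Type} [AddCommGroup A] [Module k A] [AddCommGroup B] [Module k B] 
      [AddCommGroup A'] [Module k A'] [AddCommGroup B'] [Module k B'] (φ : A →ₗ[k] A') (ψ : B →ₗ[k] B')
      (u : Fin (n + 2) → A →ₗ[k] B) (u' : Fin (n + 2) → A' →ₗ[k] B') (x : A), (∀ i, u' i (φ x) = ψ (u i x)) →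
      (∑ i : Fin (n + 2), ((-1) ^ (i : ℕ) : ℤ) • u' i) (φ x) = ψ ((∑ i : Fin (n + 2), ((-1) ^ (i : ℕ) : ℤ) • u i) x) := by
      intro A B A' B' _ _ _ _ _ _ _ _ φ ψ u u' x h
      rw [LinearMap.sum_apply, LinearMap.sum_apply, map_sum]
      refine Finset.sum_congr rfl fun i _ => ?_
      rw [LinearMap.smul_apply, LinearMap.smul_apply, map_zsmul, h]
    exact h (trf i k (n + 1)) (trf i k n) (fun j => lx k ((YG (PA0 (MonoidHom.id E))).pl (SimplexCategory.δ j).toOrderHom))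
      (fun j => lx k ((YG (PA0 i)).pl (SimplexCategory.δ j).toOrderHom)) x fun j => trf_pl i _ x

theorem id_YC (i : Z →* E) : YC (MonoidHom.id Z) (MonoidHom.id E) i := fun z => ⟨i z, fun x => map_mul i z x⟩

/-- pushforward in homology -/
def hpush (k : Type) [CommRing k] (i : Z →* E) (n : ℕ) :=
  clsMap (YG (PA0 (MonoidHom.id Z))) (YG (PA0 (MonoidHom.id E))) k (fun n => ymap i (id_YC i) n) (fun θ y => ymap_pl i (id_YC i) θ y) n

theorem hpush_cls (i : Z →* E) (n : ℕ) (x) (hx) : hpush k i n ((YG (PA0 (MonoidHom.id Z))).cls n x hx) =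
    (YG (PA0 (MonoidHom.id E))).cls n (lx k (ymap i (id_YC i) n) x) 
      (Dm_nat0 (S := YG (PA0 (MonoidHom.id Z))) (T := YG (PA0 (MonoidHom.id E))) (fun n => ymap i (id_YC i) n) (fun θ y => ymap_pl i (id_YC i) θ y) n hx) :=
  clsMap_cls (S := YG (PA0 (MonoidHom.id Z))) (T := YG (PA0 (MonoidHom.id E))) (fun n => ymap i (id_YC i) n) (fun θ y => ymap_pl i (id_YC i) θ y) n x hx

theorem transfer (hi : Function.Injective i) (n : ℕ) (c : (lch k (YG (PA0 (MonoidHom.id E)))).homology n) :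
    ∃ d, hpush k i n d = Fintype.card (E ⧸ i.range) • c := by
  obtain ⟨x, hx, rfl⟩ := GS.cls_surj _ c
  have h0 : (YG (PA0 i)).Dm k n (trf i k n x) = 0 :=
    (trf_Dm i n x).trans ((congrArg (trf i k (n - 1)) hx).trans (map_zero _))
  have hr : ∀ x : E, ∃ z, i z * crep i (QuotientGroup.mk x) = x := fun x => by
    obtain ⟨l, hl⟩ := QuotientGroup.eq.1 (crep_mk i (QuotientGroup.mk x))
    exact ⟨l, by rw [hl, inv_mul_cancel_comm]⟩
  choose r hr using hr
  obtain ⟨d, hd⟩ := (fib_bij (k := k) (PA0 (MonoidHom.id Z)) (PA0 i) r (fun z x => hi (by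
    have h1 := hr (i z * x)
    have h2 := hr x
    have : (QuotientGroup.mk (i z * x) : E ⧸ i.range) = QuotientGroup.mk x := by
      rw [QuotientGroup.mk_mul, (QuotientGroup.eq_one_iff (N := i.range) (i z)).2 (MonoidHom.mem_range.2 ⟨z, rfl⟩), one_mul]
    rw [this] at h1
    rw [map_mul]
    refine mul_right_cancel (h1.trans ?_)
    rw [mul_assoc, h2])) n).2 ((YG (PA0 i)).cls n _ h0)
  refine ⟨d, ?_⟩
  obtain ⟨y, hy, rfl⟩ := GS.cls_surj _ d
  obtain ⟨b, hb⟩ := (GS.cls_eq_iff _ _ _).1 ((clsMap_cls (S := YG (PA0 (MonoidHom.id Z))) (T := YG (PA0 i))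
    (fun n => ymap i (fun z => ⟨z, fun x => map_mul i z x⟩ : YC (MonoidHom.id Z) i i) n) (fun θ y => ymap_pl i _ θ y) n y hy).symm.trans hd)
  refine (hpush_cls i n y hy).trans ?_
  have hm : (YG (PA0 (MonoidHom.id E))).Dm k n ((Fintype.card (E ⧸ i.range) : k) • x) = 0 := by
    rw [map_smul, hx, smul_zero]
  rw [← Nat.cast_smul_eq_nsmul k, ← GS.cls_smul _ _ hx hm]
  refine (GS.cls_eq_iff _ _ _).2 ⟨lx k (ymap id (ym_q_YC i) (n + 1)) b, ?_⟩
  refine (D_nat (S := YG (PA0 i)) (T := YG (PA0 (MonoidHom.id E))) (fun n => ymap id (ym_q_YC i) n) (fun θ y => ymap_pl _ (ym_q_YC i) θ y) n b).trans ?_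
  refine (congrArg (lx k (ymap id (ym_q_YC i) n)) hb).trans ?_
  refine (map_sub (lx k (ymap id (ym_q_YC i) n)) _ _).trans ?_
  refine congrArg₂ _ ?_ ((trf_q i n x).trans (Nat.cast_smul_eq_nsmul k _ _).symm)
  refine (lx_comp _ _ _).trans ?_
  exact congrArg (fun u => lx k u y) (funext fun v => by obtain ⟨w, rfl⟩ := ymk_surj _ v; rfl)
end transfer


section lim
variable {k : Type} [CommRing k] {M : Type} [CommGroup M]

theorem hpush_comp {A B C : Type} [CommGroup A] [CommGroup B] [CommGroup C] (f : A →* B) (g : B →* C) (n : ℕ) (c) :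
    hpush k g n (hpush k f n c) = hpush k (g.comp f) n c := by
  obtain ⟨x, hx, rfl⟩ := GS.cls_surj _ c
  refine (congrArg (hpush k g n) (hpush_cls f n x hx)).trans ((hpush_cls g n _ _).trans (Eq.trans ?_ (hpush_cls _ n x hx).symm))
  congr 1
  refine (lx_comp _ _ _).trans ?_
  exact congrArg (fun u => lx k u x) (funext fun v => by obtain ⟨w, rfl⟩ := ymk_surj _ v; rfl)

theorem ysub_inj {A B : Type} [CommGroup A] [CommGroup B] (f : A →* B) (hf : Function.Injective f) (n : ℕ) :
    Function.Injective (ymap f (id_YC f) n) := by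
  intro y y' h
  obtain ⟨w, rfl⟩ := ymk_surj _ y
  obtain ⟨w', rfl⟩ := ymk_surj _ y'
  obtain ⟨z, hz⟩ := ymk_exact (show ymk (MonoidHom.id B) (fun a => f (w a)) = ymk (MonoidHom.id B) (fun a => f (w' a)) from h)
  refine ymk_eq (w' 0 * (w 0)⁻¹) fun a => hf ?_
  have h0 := hz 0
  have ha := hz a
  beta_reduce at h0 ha
  have : z = f (w' 0 * (w 0)⁻¹) := by
    rw [map_mul, map_inv, h0]
    exact (mul_inv_cancel_right _ _).symm
  rw [ha, this]
  exact (map_mul f _ _).symm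

theorem ylift_ex (n : ℕ) (x : Yq (MonoidHom.id M) n →₀ k) : ∃ F : Finset M, ∀ L : Subgroup M, (F : Set M) ⊆ L →
    ∃ x' : Yq (MonoidHom.id L) n →₀ k, lx k (ymap L.subtype (id_YC L.subtype) n) x' = x := by
  classical
  induction x using Finsupp.induction_linear with
  | zero => exact ⟨∅, fun L _ => ⟨0, map_zero _⟩⟩
  | add x y hx hy =>
    obtain ⟨F, hF⟩ := hx
    obtain ⟨F', hF'⟩ := hy
    refine ⟨F ∪ F', fun L hL => ?_⟩
    rw [Finset.coe_union] at hL
    obtain ⟨x', rfl⟩ := hF L (Set.subset_union_left.trans hL)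
    obtain ⟨y', rfl⟩ := hF' L (Set.subset_union_right.trans hL)
    exact ⟨x' + y', map_add _ _ _⟩
  | single y a =>
    obtain ⟨w, rfl⟩ := ymk_surj _ y
    refine ⟨Finset.univ.image w, fun L hL => ?_⟩
    refine ⟨Finsupp.single (ymk _ (fun a => ⟨w a, hL (by simp)⟩)) a, ?_⟩
    rw [wmap_single]
    rfl

theorem hM_lift (n : ℕ) (c : (lch k (YG (PA0 (MonoidHom.id M)))).homology n) : ∃ F : Finset M, ∀ L : Subgroup M, (F : Set M) ⊆ L →
    ∃ c', hpush k L.subtype n c' = c := by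
  obtain ⟨x, hx, rfl⟩ := GS.cls_surj _ c
  obtain ⟨F, hF⟩ := ylift_ex n x
  refine ⟨F, fun L hL => ?_⟩
  obtain ⟨x', rfl⟩ := hF L hL
  have h0 : (YG (PA0 (MonoidHom.id L))).Dm k n x' = 0 := by
    refine lx_inj (ysub_inj L.subtype Subtype.coe_injective (n - 1)) (Eq.trans ?_ (map_zero _).symm)
    exact (Dm_nat (S := YG (PA0 (MonoidHom.id L))) (T := YG (PA0 (MonoidHom.id M))) (fun n => ymap L.subtype (id_YC L.subtype) n) (fun θ y => ymap_pl _ (id_YC L.subtype) θ y) n x').symm.trans hx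
  exact ⟨(YG (PA0 (MonoidHom.id L))).cls n x' h0, hpush_cls _ n x' h0⟩

theorem hM_zero (n : ℕ) (L : Subgroup M) (c : (lch k (YG (PA0 (MonoidHom.id L)))).homology n) (hc : hpush k L.subtype n c = 0) :
    ∃ F : Finset M, ∀ (L' : Subgroup M) (h : L ≤ L'), (F : Set M) ⊆ L' → hpush k (Subgroup.inclusion h) n c = 0 := by
  obtain ⟨x, hx, rfl⟩ := GS.cls_surj _ c
  obtain ⟨b, hb⟩ := (GS.cls_zero_iff _ _).1 ((hpush_cls _ n x hx).symm.trans hc)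
  obtain ⟨F, hF⟩ := ylift_ex (n + 1) b
  refine ⟨F, fun L' h hL' => (hpush_cls _ n x hx).trans ((GS.cls_zero_iff _ _).2 ?_)⟩
  obtain ⟨b', rfl⟩ := hF L' hL'
  refine ⟨b', lx_inj (ysub_inj L'.subtype Subtype.coe_injective n) ?_⟩
  refine ((D_nat (S := YG (PA0 (MonoidHom.id L'))) (T := YG (PA0 (MonoidHom.id M))) (fun n => ymap L'.subtype (id_YC L'.subtype) n) (fun θ y => ymap_pl _ (id_YC L'.subtype) θ y) n b').symm.trans hb).trans ?_
  refine Eq.symm ((lx_comp _ _ _).trans ?_)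
  exact congrArg (fun u => lx k u x) (funext fun v => by obtain ⟨w, rfl⟩ := ymk_surj _ v; rfl)

theorem hM_tf (htf : ∀ (n : ℕ) (x : M), n ≠ 0 → x ^ n = 1 → x = 1) (n : ℕ) (m : ℕ)
    (c : (lch ℤ (YG (PA0 (MonoidHom.id M)))).homology n) (hm : m ≠ 0) (hc : m • c = 0) : c = 0 := by
  classical
  obtain ⟨F, hF⟩ := hM_lift n c
  obtain ⟨c', rfl⟩ := hF (Subgroup.closure F) Subgroup.subset_closure
  obtain ⟨F', hF'⟩ := hM_zero n _ (m • c') ((map_nsmul (hpush ℤ (Subgroup.closure (F : Set M)).subtype n) m c').trans hc)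
  have hle : Subgroup.closure (F : Set M) ≤ Subgroup.closure ((F ∪ F' : Finset M) : Set M) :=
    Subgroup.closure_mono (by simp)
  have h0 := hF' (Subgroup.closure ((F ∪ F' : Finset M) : Set M)) hle
    (Set.Subset.trans (by simp) Subgroup.subset_closure)
  have hft := fg_ft' (E := Subgroup.closure ((F ∪ F' : Finset M) : Set M)) ((Group.fg_iff_subgroup_fg _).2 ⟨_, rfl⟩)
    (fun n x hn hx => Subtype.ext (htf n x hn (by simpa using congrArg Subtype.val hx))) n
  have h1 := hft.2 m _ hm ((map_nsmul (hpush ℤ (Subgroup.inclusion hle) n) m c').symm.trans h0)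
  refine Eq.trans ?_ ((congrArg (hpush ℤ (Subgroup.closure ((F ∪ F' : Finset M) : Set M)).subtype n) h1).trans (map_zero _))
  exact (hpush_comp (Subgroup.inclusion hle) (Subgroup.closure ((F ∪ F' : Finset M) : Set M)).subtype n c').symm

theorem wfg_push {A B : Type} [AddCommGroup A] [AddCommGroup B] {mA : Module ℤ A} {mB : Module ℤ B} (f : A →ₗ[ℤ] B) (hA : FT A)
    (U : Set ℕ) (h : ∀ b, ∃ u ∈ U, ∃ a, f a = u • b) : WFG U B := by
  refine ⟨f.toAddMonoidHom.range, ?_, fun b => ?_⟩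
  · have := hA.1
    exact (AddGroup.fg_iff_addSubgroup_fg _).1 (AddGroup.fg_range f.toAddMonoidHom)
  · obtain ⟨u, hu, a, ha⟩ := h b
    exact ⟨u, hu, a, ha⟩

theorem hM_wfg (htf : ∀ (n : ℕ) (x : M), n ≠ 0 → x ^ n = 1 → x = 1) (n : ℕ) (U : Set ℕ) (h0 : 0 ∉ U)
    (hU : ∀ (Q : Type) [CommGroup Q] [Finite Q], (∀ x : Q, ∃ u ∈ U, x ^ u = 1) → Nat.card Q ∈ U)
    (h : WFG U (Additive M)) : WFG U ((lch ℤ (YG (PA0 (MonoidHom.id M)))).homology n) := by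
  classical
  obtain ⟨L, hL, hLu⟩ := h
  let L0 : Subgroup M := AddSubgroup.toSubgroup' L
  have hL0 : L0.FG := (Subgroup.fg_iff_add_fg L0).2 hL
  have hu : ∀ x : M, ∃ u ∈ U, x ^ u ∈ L0 := fun x => hLu (Additive.ofMul x)
  refine wfg_push (hpush ℤ L0.subtype n) (fg_ft' ((Group.fg_iff_subgroup_fg _).2 hL0) 
    (fun n x hn hx => Subtype.ext (htf n x hn (by simpa using congrArg Subtype.val hx))) n) U fun c => ?_
  obtain ⟨F, hF⟩ := hM_lift n c
  obtain ⟨c', rfl⟩ := hF (L0 ⊔ Subgroup.closure F) (Set.Subset.trans Subgroup.subset_closure (show Subgroup.closure (F : Set M) ≤ _ from le_sup_right))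
  let i : L0 →* (L0 ⊔ Subgroup.closure (F : Set M) : Subgroup M) := Subgroup.inclusion le_sup_left
  have hk : ∀ x : (L0 ⊔ Subgroup.closure (F : Set M) : Subgroup M) ⧸ i.range, ∃ u ∈ U, x ^ u = 1 := fun x => by
    obtain ⟨x, rfl⟩ := QuotientGroup.mk_surjective x
    obtain ⟨u, hu, hx⟩ := hu x
    refine ⟨u, hu, ?_⟩
    rw [← QuotientGroup.mk_pow]
    exact (QuotientGroup.eq_one_iff (N := i.range) _).2 (MonoidHom.mem_range.2 ⟨⟨_, hx⟩, rfl⟩)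
  have hfg : Group.FG (L0 ⊔ Subgroup.closure (F : Set M) : Subgroup M) :=
    (Group.fg_iff_subgroup_fg _).2 (Subgroup.FG.sup hL0 ⟨F, rfl⟩)
  have hfin : Finite ((L0 ⊔ Subgroup.closure (F : Set M) : Subgroup M) ⧸ i.range) := by
    refine CommGroup.finite_of_fg_torsion _ fun x => ?_
    obtain ⟨u, hu, hx⟩ := hk x
    exact isOfFinOrder_iff_pow_eq_one.2 ⟨u, Nat.pos_of_ne_zero fun h => h0 (h ▸ hu), hx⟩
  have := Fintype.ofFinite ((L0 ⊔ Subgroup.closure (F : Set M) : Subgroup M) ⧸ i.range)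
  have hcard := hU _ hk
  obtain ⟨d, hd⟩ := transfer (k := ℤ) i (Subgroup.inclusion_injective _) n c'
  refine ⟨_, hcard, d, ?_⟩
  rw [Nat.card_eq_fintype_card]
  refine ((hpush_comp i (L0 ⊔ Subgroup.closure (F : Set M) : Subgroup M).subtype n d).symm.trans (congrArg _ hd)).trans ?_
  exact map_nsmul (hpush ℤ (L0 ⊔ Subgroup.closure (F : Set M) : Subgroup M).subtype n) _ c'

theorem hM_nice {π : Set ℕ} (h : NiceAb π (Additive M)) (n : ℕ) :
    NiceAb π ((lch ℤ (YG (PA0 (MonoidHom.id M)))).homology n) where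
  tf m c hm hc := hM_tf (fun n x => h.tf n (Additive.ofMul x)) n m c hm hc
  w0 := hM_wfg (fun n x => h.tf n (Additive.ofMul x)) n Upos (lt_irrefl 0) (fun Q _ _ _ => Nat.card_pos) h.w0
  wp p hp hpi := hM_wfg (fun n x => h.tf n (Additive.ofMul x)) n (Ucop p) (fun h => by
      have : Nat.Coprime 0 p := h
      rw [Nat.coprime_zero_left] at this
      exact hp.one_lt.ne' this) (fun Q _ _ hQ => by
    by_contra hc
    have hdvd : p ∣ Nat.card Q := by
      by_contra hd
      exact hc ((Nat.Prime.coprime_iff_not_dvd hp).2 hd).symm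
    have := Fact.mk hp
    obtain ⟨x, hx⟩ := exists_prime_orderOf_dvd_card' p hdvd
    obtain ⟨u, hu, hxu⟩ := hQ x
    have h1 := orderOf_dvd_of_pow_eq_one hxu
    rw [hx] at h1
    have : Nat.Coprime u p := hu
    exact (Nat.Prime.coprime_iff_not_dvd hp).1 this.symm h1) (h.wp p hp hpi)
end lim
end HNil

namespace HNil
open CategoryTheory.Limits MonoidalCategory Simplicial
set_option linter.unusedVariables false
set_option linter.unusedSectionVars false

section
variable {G : Type} [Group G] {N : Subgroup G} {π : Set ℕ}

theorem hn_ntriv {E : Type} [Group E] [MulDistribMulAction G E] (h : ∀ g ∈ N, ∃ e : E, ∀ x : E, g • x = e * x * e⁻¹) (n : ℕ) :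
    NTriv N ((lch ℤ (YG (PAE G E))).homology n) := fun g hg a => by
  obtain ⟨e, he⟩ := h g hg
  exact PAE_inner g e he n a

theorem NiceAb.of_lin {A B : Type} [AddCommGroup A] [AddCommGroup B] {mA : Module ℤ A} {mB : Module ℤ B} (h : NiceAb π B)
    (f : A →ₗ[ℤ] B) (hf : Function.Injective f) : NiceAb π A :=
  h.of_injective f.toAddMonoidHom hf

theorem hn_nice {M : Type} [CommGroup M] [MulDistribMulAction G M] (h : NiceAb π (Additive M))
    (ht : ∀ g ∈ N, ∀ x : M, g • x = x) (n : ℕ) : PC N π (Hn ℤ G M n) := by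
  refine (PP N π).prop_of_iso (EHn ℤ G M n) ?_
  refine PC.nice _ ?_ (hn_ntriv (fun g hg => ⟨1, fun x => by rw [ht g hg]; simp⟩) n)
  have hb := ymap_iso_bij (k := ℤ) (MulEquiv.refl M) (PAE G M) (PA0 _) n
  exact NiceAb.of_lin (hM_nice h n) _ hb.1

theorem tr_PC : PC N π (tr ℤ G) := by
  refine PC.nice _ ?_ ntriv_tr
  have : NiceAb π ℤ := NiceAb.of_fg inferInstance (fun n x hn hx => by
    rw [nsmul_eq_mul] at hx
    exact (mul_eq_zero.1 hx).resolve_left (by exact_mod_cast hn))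
  exact this

/-- restricted action on an invariant subgroup -/
@[reducible] def subAct {M : Type} [Group M] [MulDistribMulAction G M] (K : Subgroup M) (hK : ∀ (g : G) (x : M), x ∈ K → g • x ∈ K) :
    MulDistribMulAction G K where
  smul g x := ⟨g • (x : M), hK g x x.2⟩
  one_smul x := Subtype.ext (one_smul G (x : M))
  mul_smul g h x := Subtype.ext (mul_smul g h (x : M))
  smul_one g := Subtype.ext (smul_one g)
  smul_mul g x y := Subtype.ext (smul_mul' g (x : M) (y : M))

theorem hn_quot {M Z : Type} [CommGroup M] [MulDistribMulAction G M] [Group Z] [MulDistribMulAction G Z]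
    (h : NiceAb π (Additive M)) (ht : ∀ g ∈ N, ∀ x : M, g • x = x) (f : M →* Z) (hf : ∀ (g : G) x, f (g • x) = g • f x)
    (hs : Function.Surjective f) (n : ℕ) : PC N π (Hn ℤ G Z n) := by
  letI := subAct (G := G) f.ker (fun g x hx => by
    have : f x = 1 := hx
    change f (g • x) = 1
    rw [hf, this, smul_one])
  have C : CExt G f.ker.subtype f :=
    { hi := fun g z => rfl
      hf := hf
      inj := Subtype.val_injective
      surj := hs
      comp := fun z => z.2
      ker := fun x hx => ⟨⟨x, hx⟩, rfl⟩
      cen := fun z x => mul_comm _ _ }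
  refine hnext_base C tr_PC (hn_nice h ht) (hn_nice ?_ ?_) n
  · exact h.of_injective (MonoidHom.toAdditive f.ker.subtype) Subtype.val_injective
  · intro g hg x
    exact Subtype.ext (ht g hg x)

def FM (Z : Type) := Multiplicative (Z →₀ ℤ)
instance (Z : Type) : CommGroup (FM Z) := inferInstanceAs (CommGroup (Multiplicative (Z →₀ ℤ)))

instance (Z : Type) [MulAction G Z] : MulDistribMulAction G (FM Z) where
  smul g x := Multiplicative.ofAdd (Finsupp.mapDomain.addMonoidHom (g • ·) x.toAdd)
  one_smul x := by
    change Multiplicative.ofAdd (Finsupp.mapDomain ((1 : G) • ·) x.toAdd) = x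
    have : ((1 : G) • · : Z → Z) = id := funext fun z => one_smul G z
    rw [this, Finsupp.mapDomain_id]; rfl
  mul_smul g h x := by
    change Multiplicative.ofAdd (Finsupp.mapDomain ((g * h) • ·) x.toAdd) = Multiplicative.ofAdd (Finsupp.mapDomain (g • ·) (Finsupp.mapDomain (h • ·) x.toAdd))
    rw [← Finsupp.mapDomain_comp]
    congr 2
    exact funext fun z => mul_smul g h z
  smul_one g := congrArg Multiplicative.ofAdd (map_zero (Finsupp.mapDomain.addMonoidHom (g • ·)))
  smul_mul g x y := congrArg Multiplicative.ofAdd (map_add (Finsupp.mapDomain.addMonoidHom (g • ·)) x.toAdd y.toAdd)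

theorem hn_fin' {Z : Type} [CommGroup Z] [MulDistribMulAction G Z] [Finite Z] (ht : ∀ g ∈ N, ∀ x : Z, g • x = x) (n : ℕ) :
    PC N π (Hn ℤ G Z n) := by
  let f0 : (Z →₀ ℤ) →+ Additive Z := Finsupp.liftAddHom fun z => zmultiplesHom (Additive Z) (Additive.ofMul z)
  let f : FM Z →* Z := AddMonoidHom.toMultiplicativeLeft f0
  have hf0 : ∀ z, f (Multiplicative.ofAdd (Finsupp.single z 1)) = z := fun z => by
    change (f0 (Finsupp.single z 1)).toMul = z
    simp [f0]
  refine hn_quot (M := FM Z) ?_ ?_ f ?_ (fun z => ⟨_, hf0 z⟩) n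
  · have : NiceAb π (Z →₀ ℤ) := NiceAb.of_fg (Module.Finite.iff_addGroup_fg.1 inferInstance) (fun n x hn hx => by
      ext z
      have := DFunLike.congr_fun hx z
      rw [Finsupp.smul_apply, nsmul_eq_mul] at this
      exact (mul_eq_zero.1 this).resolve_left (by exact_mod_cast hn))
    exact this
  · intro g hg x
    change Multiplicative.ofAdd (Finsupp.mapDomain (g • ·) x.toAdd) = x
    have : (g • · : Z → Z) = id := funext fun z => ht g hg z
    rw [this, Finsupp.mapDomain_id]; rfl
  · intro g x
    have : f0.comp (Finsupp.mapDomain.addMonoidHom (g • ·)) = (MonoidHom.toAdditive (MulDistribMulAction.toMonoidHom Z g)).comp f0 := by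
      ext z
      simp [f0]
    exact DFunLike.congr_fun this x.toAdd

theorem hn_fin {Z : Type} [Group Z] [MulDistribMulAction G Z] [Finite Z] (hc : ∀ x y : Z, x * y = y * x)
    (ht : ∀ g ∈ N, ∀ x : Z, g • x = x) (n : ℕ) :
    PC N π (Hn ℤ G Z n) := by
  letI : CommGroup Z := { ‹Group Z› with mul_comm := hc }
  exact hn_fin' ht n

end
end HNil

namespace HNil
open CategoryTheory.Limits MonoidalCategory Simplicial
set_option linter.unusedVariables false
set_option linter.unusedSectionVars false
set_option linter.style.haveILetI false

section
variable {G : Type} [Group G]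

/-- conjugation action on a normal subgroup -/
def conjN (N : Subgroup G) [N.Normal] : MulDistribMulAction G N where
  smul g x := MulAut.conjNormal g x
  one_smul x := by
    change MulAut.conjNormal (1 : G) x = x
    rw [map_one]; rfl
  mul_smul g h x := by
    change MulAut.conjNormal (g * h) x = MulAut.conjNormal g (MulAut.conjNormal h x)
    rw [map_mul]; rfl
  smul_one g := map_one _
  smul_mul g x y := map_mul _ _ _

attribute [local instance] conjN

theorem conjN_val (N : Subgroup G) [N.Normal] (g : G) (x : N) : ((g • x : N) : G) = g * x * g⁻¹ := MulAut.conjNormal_apply g x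

/-- sections of `G` -/
def Sec (A B : Subgroup G) := A ⧸ B.subgroupOf A
instance (A B : Subgroup G) [B.Normal] : Group (Sec A B) := inferInstanceAs (Group (A ⧸ B.subgroupOf A))

variable (A B : Subgroup G) [A.Normal] [B.Normal]

def smk : A →* Sec A B := QuotientGroup.mk' (B.subgroupOf A)

theorem smk_surj : Function.Surjective (smk A B) := QuotientGroup.mk'_surjective _

theorem smk_eq (a b : A) : smk A B a = smk A B b ↔ (a : G)⁻¹ * b ∈ B := by
  refine (QuotientGroup.eq (s := B.subgroupOf A)).trans ?_
  exact Subgroup.mem_subgroupOf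

theorem smk_one (a : A) : smk A B a = 1 ↔ (a : G) ∈ B := by
  refine (QuotientGroup.eq_one_iff (N := B.subgroupOf A) a).trans ?_
  exact Subgroup.mem_subgroupOf

/-- maps out of sections -/
def slift {E : Type} [Group E] (f : A →* E) (h : ∀ a : A, (a : G) ∈ B → f a = 1) : Sec A B →* E :=
  QuotientGroup.lift (B.subgroupOf A) f (fun a ha => h a (Subgroup.mem_subgroupOf.1 ha))

theorem slift_mk {E : Type} [Group E] (f : A →* E) (h : ∀ a : A, (a : G) ∈ B → f a = 1) (a : A) : slift A B f h (smk A B a) = f a := rfl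

instance secAct : MulDistribMulAction G (Sec A B) where
  smul g := slift A B ((smk A B).comp (MulDistribMulAction.toMonoidHom A g)) (fun a ha => (smk_one A B _).2 (by
    change ((g • a : A) : G) ∈ B
    rw [conjN_val]
    exact Subgroup.Normal.conj_mem ‹_› _ ha g))
  one_smul x := by
    obtain ⟨a, rfl⟩ := smk_surj A B x
    exact congrArg (smk A B) (one_smul G a)
  mul_smul g h x := by
    obtain ⟨a, rfl⟩ := smk_surj A B x
    exact congrArg (smk A B) (mul_smul g h a)
  smul_one g := map_one (slift A B _ _)
  smul_mul g x y := map_mul (slift A B _ _) x y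

theorem smk_smul (g : G) (a : A) : g • smk A B a = smk A B (g • a) := rfl

theorem sec_triv {N : Subgroup G} (h : ∀ m t : G, m ∈ N → t ∈ A → m * t * m⁻¹ * t⁻¹ ∈ B) (g : G) (hg : g ∈ N) (x : Sec A B) : g • x = x := by
  obtain ⟨a, rfl⟩ := smk_surj A B x
  rw [smk_smul, eq_comm, smk_eq, conjN_val]
  have := Subgroup.Normal.conj_mem ‹B.Normal› _ (h g a hg a.2) (a : G)⁻¹
  simpa [mul_assoc] using this

theorem sec_comm {N : Subgroup G} (hA : A ≤ N) (h : ∀ m t : G, m ∈ N → t ∈ A → m * t * m⁻¹ * t⁻¹ ∈ B) (x y : Sec A B) : x * y = y * x := by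
  obtain ⟨a, rfl⟩ := smk_surj A B x
  obtain ⟨b, rfl⟩ := smk_surj A B y
  rw [← map_mul, ← map_mul, smk_eq]
  have := h (a : G)⁻¹ (b : G)⁻¹ (N.inv_mem (hA a.2)) (A.inv_mem b.2)
  have := Subgroup.Normal.conj_mem ‹B.Normal› _ this (1 : G)
  have h2 := h (b : G)⁻¹ (a : G)⁻¹ (N.inv_mem (hA b.2)) (A.inv_mem a.2)
  simpa [mul_assoc] using h2

variable {A B}
/-- the basic central extension -/
theorem sec_ext {N : Subgroup G} [N.Normal] (hA : A ≤ N) (hB : B ≤ A) (h : ∀ m t : G, m ∈ N → t ∈ A → m * t * m⁻¹ * t⁻¹ ∈ B) :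
    CExt G (slift A B ((smk N B).comp (Subgroup.inclusion hA)) (fun a ha => (smk_one _ _ _).2 ha))
      (slift N B (smk N A) (fun a ha => (smk_one _ _ _).2 (hB ha))) where
  hi g z := by
    obtain ⟨a, rfl⟩ := smk_surj _ _ z
    exact congrArg (smk N B) (Subtype.ext rfl)
  hf g z := by
    obtain ⟨a, rfl⟩ := smk_surj _ _ z
    rfl
  inj x y hxy := by
    obtain ⟨a, rfl⟩ := smk_surj _ _ x
    obtain ⟨b, rfl⟩ := smk_surj _ _ y
    exact (smk_eq _ _ _ _).2 ((smk_eq N B _ _).1 hxy)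
  surj x := by
    obtain ⟨a, rfl⟩ := smk_surj _ _ x
    exact ⟨smk N B a, rfl⟩
  comp z := by
    obtain ⟨a, rfl⟩ := smk_surj _ _ z
    exact (smk_one N A _).2 a.2
  ker x hx := by
    obtain ⟨a, rfl⟩ := smk_surj _ _ x
    have : (a : G) ∈ A := (smk_one N A _).1 hx
    exact ⟨smk A B ⟨a, this⟩, rfl⟩
  cen z x := by
    obtain ⟨a, rfl⟩ := smk_surj _ _ z
    obtain ⟨b, rfl⟩ := smk_surj _ _ x
    refine ((map_mul (smk N B) _ _).symm.trans ?_).trans (map_mul (smk N B) _ _)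
    rw [smk_eq]
    have h2 := h (b : G)⁻¹ (a : G)⁻¹ (N.inv_mem b.2) (A.inv_mem a.2)
    simpa [mul_assoc] using h2

theorem bot_ext {N : Subgroup G} [N.Normal] (hB : B = ⊥) :
    letI := subAct (G := G) (⊥ : Subgroup N) (fun g x hx => by
      rw [Subgroup.mem_bot] at *; rw [hx, smul_one])
    CExt G (⊥ : Subgroup N).subtype (smk N B) := by
  letI := subAct (G := G) (⊥ : Subgroup N) (fun g x hx => by
      rw [Subgroup.mem_bot] at *; rw [hx, smul_one])
  exact
  { hi := fun g z => rfl
    hf := fun g z => rfl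
    inj := Subtype.val_injective
    surj := smk_surj _ _
    comp := fun z => by
      have : (z : N) = 1 := z.2
      exact (congrArg (smk N B) this).trans (map_one _)
    ker := fun x hx => ⟨⟨x, by
      have := (smk_one N B _).1 hx
      subst hB
      rw [Subgroup.mem_bot] at *
      exact Subtype.ext this⟩, rfl⟩
    cen := fun z x => by
      have : (z : N) = 1 := z.2
      change (z : N) * x = x * (z : N)
      rw [this, one_mul, mul_one] }

/-- the multiplicative group of a representation of the quotient -/
def MM {N : Subgroup G} [N.Normal] (M : Rep.{0} ℤ (G ⧸ N)) := Multiplicative M.V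
instance {N : Subgroup G} [N.Normal] (M : Rep.{0} ℤ (G ⧸ N)) : CommGroup (MM M) := inferInstanceAs (CommGroup (Multiplicative M.V))
instance {N : Subgroup G} [N.Normal] (M : Rep.{0} ℤ (G ⧸ N)) : MulDistribMulAction G (MM M) where
  smul g x := Multiplicative.ofAdd (M.ρ (QuotientGroup.mk g) x.toAdd)
  one_smul x := by
    change Multiplicative.ofAdd (M.ρ 1 x.toAdd) = x
    rw [map_one]; rfl
  mul_smul g h x := by
    change Multiplicative.ofAdd (M.ρ (QuotientGroup.mk g * QuotientGroup.mk h) x.toAdd) = _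
    rw [map_mul]; rfl
  smul_one g := congrArg Multiplicative.ofAdd (map_zero (M.ρ (QuotientGroup.mk g)))
  smul_mul g x y := congrArg Multiplicative.ofAdd (map_add (M.ρ (QuotientGroup.mk g)) x.toAdd y.toAdd)

theorem sec_quot {N : Subgroup G} [N.Normal] {π : Set ℕ} (M : Rep.{0} ℤ (G ⧸ N)) (hM : NiceRep π M) (φ : M → G)
    (h1 : ∀ m : M, φ m ∈ A) (h2 : ∀ m m' : M, (φ (m + m'))⁻¹ * (φ m * φ m') ∈ B)
    (h3 : ∀ t : G, t ∈ A → ∃ m : M, (φ m)⁻¹ * t ∈ B)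
    (h4 : ∀ (g : G) (m : M), (φ (M.ρ (QuotientGroup.mk g) m))⁻¹ * (g * φ m * g⁻¹) ∈ B) (n : ℕ) :
    PC N π (Hn ℤ G (Sec A B) n) := by
  let f : MM M →* Sec A B := MonoidHom.mk' (fun m => smk A B ⟨φ m.toAdd, h1 _⟩) (fun m m' => by
    rw [← map_mul]
    exact (smk_eq A B _ _).2 (h2 _ _))
  refine hn_quot (M := MM M) (niceAb_of hM.1 hM.2.1 hM.2.2 : NiceAb π M.V) ?_ f ?_ ?_ n
  · intro g hg x
    change Multiplicative.ofAdd (M.ρ (QuotientGroup.mk g) x.toAdd) = x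
    rw [(QuotientGroup.eq_one_iff g).2 hg, map_one]; rfl
  · intro g x
    exact (smk_eq A B _ _).2 (h4 g x.toAdd)
  · intro z
    obtain ⟨a, rfl⟩ := smk_surj A B z
    obtain ⟨m, hm⟩ := h3 a a.2
    exact ⟨Multiplicative.ofAdd m, (smk_eq A B _ _).2 hm⟩

theorem main_PC (N : Subgroup G) [N.Normal] {π : Set ℕ}
    (hser : ∃ (r : ℕ) (T : Fin (r + 1) → Subgroup G),
      Monotone T ∧ T 0 = ⊥ ∧ T (Fin.last r) = N ∧
      (∀ (i : Fin (r + 1)) (g t : G), t ∈ T i → g * t * g⁻¹ ∈ T i) ∧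
      (∀ (i : Fin r) (m t : G), m ∈ N → t ∈ T i.succ →
        m * t * m⁻¹ * t⁻¹ ∈ T i.castSucc) ∧
      (∀ i : Fin r, (T i.castSucc).relIndex (T i.succ) = 0 →
        ∃ M : Rep ℤ (G ⧸ N), NiceRep π M ∧
          ∃ φ : M → G,
            (∀ m : M, φ m ∈ T i.succ) ∧
            (∀ m m' : M, (φ (m + m'))⁻¹ * (φ m * φ m') ∈ T i.castSucc) ∧
            (∀ t : G, t ∈ T i.succ → ∃ m : M, (φ m)⁻¹ * t ∈ T i.castSucc) ∧
            (∀ (g : G) (m : M),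
              (φ (M.ρ (QuotientGroup.mk g) m))⁻¹ * (g * φ m * g⁻¹) ∈ T i.castSucc))) (n : ℕ) :
    PC N π (Hn ℤ G N n) := by
  obtain ⟨r, T, hmono, h0, hr, hnorm, hcen, hfac⟩ := hser
  have : ∀ i, (T i).Normal := fun i => ⟨fun t ht g => hnorm i g t ht⟩
  have key : ∀ j, ∀ n, PC N π (Hn ℤ G (Sec N (T j)) n) := by
    intro j
    induction j using Fin.reverseInduction with
    | last =>
      have : Subsingleton (Sec N (T (Fin.last r))) := ⟨fun x y => by
        obtain ⟨a, rfl⟩ := smk_surj _ _ x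
        obtain ⟨b, rfl⟩ := smk_surj _ _ y
        rw [smk_eq, hr]
        exact N.mul_mem (N.inv_mem a.2) b.2⟩
      exact hn_fin (fun x y => Subsingleton.elim _ _) (fun g hg x => Subsingleton.elim _ _)
    | cast i ih =>
      have hA : T i.succ ≤ N := hr ▸ hmono (Fin.le_last _)
      refine hnext_total (sec_ext hA (hmono (Fin.castSucc_lt_succ).le) (hcen i)) ih ?_
      intro n
      by_cases hi : (T i.castSucc).relIndex (T i.succ) = 0
      · obtain ⟨M, hM, φ, h1, h2, h3, h4⟩ := hfac i hi
        exact sec_quot M hM φ h1 h2 h3 h4 n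
      · have : Finite (Sec (T i.succ) (T i.castSucc)) := by
          have : ((T i.castSucc).subgroupOf (T i.succ)).FiniteIndex := ⟨hi⟩
          exact Subgroup.finite_quotient_of_finiteIndex
        exact hn_fin (sec_comm _ _ hA (hcen i)) (fun g hg => sec_triv _ _ (hcen i) g hg) n
  letI := subAct (G := G) (⊥ : Subgroup N) (fun g x hx => by
      rw [Subgroup.mem_bot] at *; rw [hx, smul_one])
  exact hnext_total (bot_ext h0) (key 0)
    (hn_fin (fun x y => Subsingleton.elim _ _) (fun g hg x => Subsingleton.elim _ _)) n

theorem main_PC' (N : Subgroup G) [N.Normal] {π : Set ℕ} (n : ℕ) (h : PC N π (Hn ℤ G N n)) :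
    PC N π ((lch ℤ (YG (PAE G N))).homology n) := (PP N π).prop_of_iso (EHn ℤ G N n).symm h

theorem main_nt (N : Subgroup G) [N.Normal] (n : ℕ) : NTriv N ((lch ℤ (YG (PAE G N))).homology n) :=
  hn_ntriv (fun g hg => ⟨⟨g, hg⟩, fun x => Subtype.ext (conjN_val N g x)⟩) n

end
end HNil

namespace HNil
open CategoryTheory.Limits MonoidalCategory Simplicial
set_option linter.unusedVariables false
set_option linter.unusedSectionVars false
set_option linter.style.haveILetI false

section gen
variable {C D : Type*} [Category C] [Category D] [Abelian C] [Abelian D] (F : C ⥤ D) [F.Additive] [F.PreservesHomology]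
variable {X : SimplicialObject C} {Y : SimplicialObject D} (a : ∀ n : ℕ, F.obj (X.obj (Opposite.op ⦋n⦌)) ⟶ Y.obj (Opposite.op ⦋n⦌))
  (ha : ∀ (n : ℕ) (i : Fin (n + 2)), a (n + 1) ≫ Y.δ i = F.map (X.δ i) ≫ a n)

def chm : (F.mapHomologicalComplex _).obj ((alternatingFaceMapComplex C).obj X) ⟶ (alternatingFaceMapComplex D).obj Y :=
  ChainComplex.ofHom (fun n => a n) (fun n => by
    rw [Functor.mapHomologicalComplex_obj_d]
    refine (congrArg (fun u => a (n + 1) ≫ u) (AlternatingFaceMapComplex.obj_d_eq Y n)).trans ?_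
    refine Eq.trans ?_ (congrArg (fun u => F.map u ≫ a n) (AlternatingFaceMapComplex.obj_d_eq X n)).symm
    simp only [F.map_sum, F.map_zsmul, Preadditive.comp_sum, Preadditive.sum_comp,
      Preadditive.comp_zsmul, Preadditive.zsmul_comp, ha])

theorem chm_f (n : ℕ) : (chm F a ha).f n = a n := rfl

theorem chm_iso (h : ∀ n, IsIso (a n)) : IsIso (chm F a ha) :=
  haveI : ∀ n, IsIso ((chm F a ha).f n) := h
  HomologicalComplex.Hom.isIso_of_components _

def mhi (K : ChainComplex C ℕ) (n : ℕ) : F.obj (K.homology n) ≅ ((F.mapHomologicalComplex _).obj K).homology n :=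
  ((K.sc n).mapHomologyIso F).symm

theorem mhi_nat (τ : F ⟶ F) (K : ChainComplex C ℕ) (n : ℕ) : τ.app (K.homology n) =
    (mhi F K n).hom ≫ HomologicalComplex.homologyMap ((NatTrans.mapHomologicalComplex τ _).app K) n ≫ (mhi F K n).inv :=
  NatTrans.app_homology τ (K.sc n)

/-- comparison on homology -/
def chh (n : ℕ) : F.obj (((alternatingFaceMapComplex C).obj X).homology n) ⟶ ((alternatingFaceMapComplex D).obj Y).homology n :=
  (mhi F _ n).hom ≫ HomologicalComplex.homologyMap (chm F a ha) n

theorem chh_iso (h : ∀ n, IsIso (a n)) (n : ℕ) : IsIso (chh F a ha n) := by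
  have := chm_iso F a ha h
  have : IsIso (HomologicalComplex.homologyMap (chm F a ha) n) :=
    inferInstanceAs (IsIso ((HomologicalComplex.homologyFunctor _ _ n).map (chm F a ha)))
  unfold chh
  infer_instance

theorem chh_nat (τ : F ⟶ F) (t : Y ⟶ Y) (h : ∀ n : ℕ, τ.app (X.obj (Opposite.op ⦋n⦌)) ≫ a n = a n ≫ t.app (Opposite.op ⦋n⦌)) (n : ℕ) :
    τ.app _ ≫ chh F a ha n = chh F a ha n ≫ HomologicalComplex.homologyMap ((alternatingFaceMapComplex D).map t) n := by
  have h1 : (NatTrans.mapHomologicalComplex τ _).app ((alternatingFaceMapComplex C).obj X) ≫ chm F a ha = chm F a ha ≫ (alternatingFaceMapComplex D).map t := by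
    apply HomologicalComplex.hom_ext
    intro n
    exact h n
  unfold chh
  rw [mhi_nat]
  rw [Category.assoc, Category.assoc, Category.assoc]
  refine congrArg _ ?_
  rw [Iso.inv_hom_id_assoc]
  rw [← HomologicalComplex.homologyMap_comp, ← HomologicalComplex.homologyMap_comp, h1]
end gen

section nerve
variable (k : Type) [CommRing k] {E : Type} [Group E]

/-- the composable arrows of a tuple -/
def nuF {n : ℕ} (w : Fin (n + 1) → E) : ComposableArrows (SingleObj E) n where
  obj _ := SingleObj.star E
  map {i j} _ := (w j)⁻¹ * w i
  map_id i := inv_mul_cancel _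
  map_comp {i j l} _ _ := by
    change (w l)⁻¹ * w i = ((w l)⁻¹ * w j) * ((w j)⁻¹ * w i)
    group

theorem ca_ext {n : ℕ} (F F' : ComposableArrows (SingleObj E) n)
    (h : ∀ (i j : Fin (n + 1)) (hij : i ⟶ j), (F.map hij : E) = (F'.map hij : E)) : F = F' :=
  CategoryTheory.Functor.ext (fun _ => rfl) (fun i j f => by
    simp only [eqToHom_refl, Category.comp_id, Category.id_comp]
    exact h i j f)

def nu {n : ℕ} : Yq (MonoidHom.id E) n → ComposableArrows (SingleObj E) n :=
  ylift nuF (fun z w => ca_ext _ _ fun i j _ => by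
    change (z * w j)⁻¹ * (z * w i) = (w j)⁻¹ * w i
    group)

theorem nu_bij (n : ℕ) : Function.Bijective (nu : Yq (MonoidHom.id E) n → _) := by
  constructor
  · intro x y h
    obtain ⟨w, rfl⟩ := ymk_surj _ x
    obtain ⟨w', rfl⟩ := ymk_surj _ y
    have h1 : ∀ j : Fin (n + 1), (w j)⁻¹ * w 0 = (w' j)⁻¹ * w' 0 := fun j => by
      have h2 : nuF w = nuF w' := h
      have := congrArg (fun F : ComposableArrows (SingleObj E) n => (F.map (homOfLE (Fin.zero_le j)) : E)) h2
      exact this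
    refine ymk_eq (w' 0 * (w 0)⁻¹) fun j => ?_
    change w' j = w' 0 * (w 0)⁻¹ * w j
    have := congrArg (fun u => w' j * u * (w 0)⁻¹ * w j) (h1 j)
    simpa [mul_assoc] using this
  · intro F
    refine ⟨ymk _ (fun j => ((F.map (homOfLE (Fin.zero_le j)) : E))⁻¹), ca_ext _ _ fun i j f => ?_⟩
    change ((F.map (homOfLE (Fin.zero_le j)) : E)⁻¹)⁻¹ * (F.map (homOfLE (Fin.zero_le i)) : E)⁻¹ = (F.map f : E)
    have h : (F.map (homOfLE (Fin.zero_le j)) : E) = (F.map f : E) * (F.map (homOfLE (Fin.zero_le i)) : E) := by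
      have : F.map (homOfLE (Fin.zero_le j)) = F.map (homOfLE (Fin.zero_le i)) ≫ F.map f := by
        rw [← F.map_comp]; rfl
      exact this
    rw [h]
    group

/-- the simplicial module of the nerve -/
def nvm (E : Type) [Group E] : SimplicialObject (ModuleCat.{0} k) :=
  ((SimplicialObject.whiskering _ _).obj (ModuleCat.free k)).obj (nerve (SingleObj E))

end nerve

end HNil

namespace HNil
open CategoryTheory.Limits MonoidalCategory Simplicial
set_option linter.unusedVariables false
set_option linter.unusedSectionVars false
set_option linter.style.haveILetI false

section
variable (k : Type) [CommRing k] (G : Type) [Group G] (E : Type) [Group E] [MulDistribMulAction G E]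

/-- group elements as natural endomorphisms of the forgetful functor -/
def tau (g : G) : forget₂ (Rep.{0} k G) (ModuleCat.{0} k) ⟶ forget₂ (Rep.{0} k G) (ModuleCat.{0} k) where
  app A := ModuleCat.ofHom (A.ρ g)
  naturality A B f := by
    ext x
    exact (Rep.hom_comm_apply f g x).symm

def aN (n : ℕ) : (forget₂ (Rep.{0} k G) (ModuleCat.{0} k)).obj ((lin k (YG (PAE G E))).obj (Opposite.op ⦋n⦌)) ⟶
    (nvm k E).obj (Opposite.op ⦋n⦌) :=
  ModuleCat.ofHom (X := Yq (MonoidHom.id E) n →₀ k) (Y := ComposableArrows (SingleObj E) n →₀ k) (lx k nu)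

theorem aN_single (n : ℕ) (y : Yq (MonoidHom.id E) n) (c : k) : (aN k G E n).hom (Finsupp.single y c : Yq (MonoidHom.id E) n →₀ k) =
    (Finsupp.single (nu y) c : ComposableArrows (SingleObj E) n →₀ k) := wmap_single _ _ _ _

theorem aN_ext {n : ℕ} {B : ModuleCat.{0} k} (f g : (forget₂ (Rep.{0} k G) (ModuleCat.{0} k)).obj ((lin k (YG (PAE G E))).obj (Opposite.op ⦋n⦌)) ⟶ B)
    (h : ∀ (w : Fin (n + 1) → E) (c : k), f.hom (Finsupp.single (ymk (MonoidHom.id E) w) c : Yq (MonoidHom.id E) n →₀ k) =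
      g.hom (Finsupp.single (ymk (MonoidHom.id E) w) c : Yq (MonoidHom.id E) n →₀ k)) : f = g := by
  apply ModuleCat.hom_ext
  have : ∀ (f g : (Yq (MonoidHom.id E) n →₀ k) →ₗ[k] B) (h : ∀ (w : Fin (n + 1) → E) (c : k), f (Finsupp.single (ymk (MonoidHom.id E) w) c) =
      g (Finsupp.single (ymk (MonoidHom.id E) w) c)), f = g := fun f g h => Finsupp.lhom_ext fun y c => by
    obtain ⟨w, rfl⟩ := ymk_surj _ y
    exact h w c
  exact this f.hom g.hom h

theorem free_single {S T : Type} (f : S ⟶ T) (s : S) (c : k) : ((ModuleCat.free k).map f).hom (Finsupp.single s c : S →₀ k) =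
    (Finsupp.single (f s) c : T →₀ k) := by
  exact Finsupp.mapDomain_single

theorem aN_iso (n : ℕ) : IsIso (aN k G E n) := by
  refine (ConcreteCategory.isIso_iff_bijective _).2 ?_
  exact ⟨lx_inj (nu_bij n).1, lx_surj (nu_bij n).2⟩

theorem nvm_map_single {m n : ℕ} (θ : ⦋m⦌ ⟶ ⦋n⦌) (F : ComposableArrows (SingleObj E) n) (c : k) :
    ((nvm k E).map θ.op).hom (Finsupp.single F c : ComposableArrows (SingleObj E) n →₀ k) =
    (Finsupp.single ((nerve (SingleObj E)).map θ.op F) c : ComposableArrows (SingleObj E) m →₀ k) := free_single k _ _ _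

theorem lin_map_single (S : GS G) {m n : ℕ} (θ : ⦋m⦌ ⟶ ⦋n⦌) (y : S.Y n) (c : k) :
    ((lin k S).map θ.op).hom (Finsupp.single y c : S.Y n →₀ k) =
    (Finsupp.single (S.pl θ.toOrderHom y) c : S.Y m →₀ k) := wmap_single _ _ _ _

theorem aN_nat (n : ℕ) (i : Fin (n + 2)) : aN k G E (n + 1) ≫ (nvm k E).δ i =
    (forget₂ (Rep.{0} k G) (ModuleCat.{0} k)).map ((lin k (YG (PAE G E))).δ i) ≫ aN k G E n := by
  refine aN_ext k G E _ _ fun w c => ?_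
  refine (congrArg ((nvm k E).δ i).hom (aN_single k G E (n + 1) (ymk _ w) c)).trans ?_
  refine (nvm_map_single k E (SimplexCategory.δ i) (nu (ymk _ w)) c).trans ?_
  refine Eq.trans ?_ (congrArg (aN k G E n).hom (lin_map_single k G (YG (PAE G E)) (SimplexCategory.δ i) (ymk _ w) c)).symm
  refine Eq.trans ?_ (aN_single k G E n (ymk (MonoidHom.id E) (w ∘ (SimplexCategory.δ i).toOrderHom)) c).symm
  refine congrArg (fun F => (Finsupp.single F c : ComposableArrows (SingleObj E) n →₀ k)) ?_
  exact ca_ext _ _ fun i j h => rfl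

/-- action on the nerve -/
def tN (f : E →* E) : nvm k E ⟶ nvm k E :=
  ((SimplicialObject.whiskering _ _).obj (ModuleCat.free k)).map (nerveMap (SingleObj.mapHom E E f))

theorem tN_single (f : E →* E) {n : ℕ} (w : Fin (n + 1) → E) (c : k) : ((tN k E f).app (Opposite.op ⦋n⦌)).hom
    (Finsupp.single (nuF w) c : ComposableArrows (SingleObj E) n →₀ k) = (Finsupp.single (nuF (f ∘ w)) c : ComposableArrows (SingleObj E) n →₀ k) := by
  refine (free_single k _ _ _).trans ?_
  refine congrArg (fun F => (Finsupp.single F c : ComposableArrows (SingleObj E) n →₀ k)) ?_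
  refine ca_ext _ _ fun i j h => ?_
  change f ((w j)⁻¹ * w i) = (f (w j))⁻¹ * f (w i)
  rw [map_mul, map_inv]

theorem tau_single (S : GS G) (n : ℕ) (g : G) (y : S.Y n) (c : k) : ((tau k G g).app ((lin k S).obj (Opposite.op ⦋n⦌))).hom
    (Finsupp.single y c : S.Y n →₀ k) = (Finsupp.single (g • y) c : S.Y n →₀ k) := wmap_single _ _ _ _

theorem aN_tau (g : G) (n : ℕ) : (tau k G g).app ((lin k (YG (PAE G E))).obj (Opposite.op ⦋n⦌)) ≫ aN k G E n =
    aN k G E n ≫ (tN k E (MulDistribMulAction.toMonoidHom E g)).app (Opposite.op ⦋n⦌) := by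
  refine aN_ext k G E _ _ fun w c => ?_
  refine (congrArg (aN k G E n).hom (tau_single k G (YG (PAE G E)) n g (ymk _ w) c)).trans ?_
  refine (aN_single k G E n _ c).trans ?_
  refine Eq.trans ?_ (congrArg ((tN k E (MulDistribMulAction.toMonoidHom E g)).app (Opposite.op ⦋n⦌)).hom (aN_single k G E n (ymk _ w) c)).symm
  exact (tN_single k E (MulDistribMulAction.toMonoidHom E g) w c).symm

/-- the comparison -/
def PsiM (n : ℕ) : (forget₂ (Rep.{0} k G) (ModuleCat.{0} k)).obj ((lch k (YG (PAE G E))).homology n) ⟶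
    ((alternatingFaceMapComplex (ModuleCat.{0} k)).obj (nvm k E)).homology n :=
  chh (forget₂ (Rep.{0} k G) (ModuleCat.{0} k)) (X := lin k (YG (PAE G E))) (Y := nvm k E) (aN k G E) (aN_nat k G E) n

def Psi (n : ℕ) : ((lch k (YG (PAE G E))).homology n).V → ((alternatingFaceMapComplex (ModuleCat.{0} k)).obj (nvm k E)).homology n :=
  (PsiM k G E n).hom

theorem Psi_add (n : ℕ) (x y) : Psi k G E n (x + y) = Psi k G E n x + Psi k G E n y := map_add (PsiM k G E n).hom x y

theorem Psi_bij (n : ℕ) : Function.Bijective (Psi k G E n) := by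
  have := chh_iso (forget₂ (Rep.{0} k G) (ModuleCat.{0} k)) (X := lin k (YG (PAE G E))) (Y := nvm k E) (aN k G E) (aN_nat k G E) (aN_iso k G E) n
  exact (ConcreteCategory.isIso_iff_bijective (PsiM k G E n)).1 this

theorem Psi_nat (g : G) (n : ℕ) (x) : Psi k G E n (((lch k (YG (PAE G E))).homology n).ρ g x) =
    (HomologicalComplex.homologyMap ((alternatingFaceMapComplex (ModuleCat.{0} k)).map (tN k E (MulDistribMulAction.toMonoidHom E g))) n).hom (Psi k G E n x) := by
  have := chh_nat (forget₂ (Rep.{0} k G) (ModuleCat.{0} k)) (X := lin k (YG (PAE G E))) (Y := nvm k E) (aN k G E) (aN_nat k G E) (tau k G g)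
    (tN k E (MulDistribMulAction.toMonoidHom E g)) (aN_tau k G E g) n
  exact congrArg (fun f => f.hom x) this

end
end HNil

namespace HNil
open CategoryTheory.Limits MonoidalCategory Simplicial
set_option linter.unusedVariables false
set_option linter.unusedSectionVars false
set_option linter.style.haveILetI false

section
local instance (priority := 2000) repMod2 {G : Type} [Group G] (A : Rep.{0} ℤ G) : Module ℤ A.V := A.hV2

theorem transport {Q : Type} [Group Q] (A : Rep.{0} ℤ Q) {H : Type} [AddCommGroup H] {mH : Module ℤ H} (e : A.V ≃+ H) :
    ∃ ρ : Representation ℤ Q H, (∀ q a, ρ q (e a) = e (A.ρ q a)) ∧ ∀ π, MemC Q π A → MemC Q π (Rep.of ρ) := by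
  let ρ : Representation ℤ Q H :=
    { toFun := fun q =>
        { toFun := fun x => e (A.ρ q (e.symm x))
          map_add' := fun x y => by simp
          map_smul' := fun c x => by
            have := map_intCast_smul ((e : A.V →+ H).comp ((A.ρ q).toAddMonoidHom.comp (e.symm : H →+ A.V))) ℤ ℤ c x
            simpa using this }
      map_one' := by ext x; simp
      map_mul' := fun q r => by ext x; simp }
  have hρ : ∀ q a, ρ q (e a) = e (A.ρ q a) := fun q a => congrArg (fun u => e (A.ρ q u)) (e.symm_apply_apply a)
  refine ⟨ρ, hρ, fun π h => ?_⟩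
  let φ : A.V →ₗ[ℤ] H :=
    { toFun := e
      map_add' := map_add e
      map_smul' := fun c x => by
        have := map_intCast_smul (e : A.V →+ H) ℤ ℤ c x
        simpa using this }
  refine MemC.quot A (Rep.of ρ) (Rep.ofHom ⟨φ, fun q => LinearMap.ext fun a => (hρ q a).symm⟩) e.surjective h

attribute [local instance] conjN

theorem finish {G : Type} [Group G] (N : Subgroup G) [N.Normal] {π : Set ℕ} (n : ℕ) (h : PC N π (Hn ℤ G N n)) :
    ∃ ρQ : Representation ℤ (G ⧸ N) ((groupHomologyFunctor n).obj (MonCat.of N)),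
      (∀ g : G, ρQ (QuotientGroup.mk g) =
        endOfHom ((groupHomologyFunctor n).map
          (MonCat.ofHom ((MulAut.conjNormal g : MulAut N) : N →* N)))) ∧
      MemC (G ⧸ N) π (Rep.of ρQ) := by
  have hm := (main_PC' N n h).memC (main_nt N n)
  let e : (desc _ (main_nt N n)).V ≃+ ((groupHomologyFunctor n).obj (MonCat.of N)) :=
    AddEquiv.ofBijective (AddMonoidHom.mk' (Psi ℤ G N n) (Psi_add ℤ G N n)) (Psi_bij ℤ G N n)
  obtain ⟨ρ, h1, h2⟩ := transport (desc _ (main_nt N n)) e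
  refine ⟨ρ, fun g => LinearMap.ext fun x => ?_, h2 π hm⟩
  obtain ⟨a, rfl⟩ := e.surjective x
  refine (h1 _ a).trans ?_
  exact Psi_nat ℤ G N g n a

end
end HNil

/-- Let `G` be a group with a nilpotent normal subgroup `N` of finite rank, let
`π` be the spectrum of `N` and `Q = G/N`.  Suppose `N` has a `G`-invariant
central series of finite length in which each infinite factor, viewed as a
`ℤQ`-module, is a quotient of some `ℤQ`-module whose underlying abelian group is
torsion-free of finite rank and `π`-spectral.  Then for every `n ≥ 0` the
integral homology `H_n(N)`, with the `ℤQ`-module structure coming from the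
conjugation action of `G` on `N`, belongs to `𝔠(Q, π)`. -/
theorem homology_of_nilpotent_normal_memC (G : Type) [Group G]
    (N : Subgroup G) (hN : N.Normal) (hnilp : Group.IsNilpotent N)
    (hrank : ∀ (H : Subgroup N) (K : Subgroup H) (_ : K.Normal),
      (∀ x y : H ⧸ K, x * y = y * x) → FiniteRankGroup (H ⧸ K))
    (hser : ∃ (r : ℕ) (T : Fin (r + 1) → Subgroup G),
      Monotone T ∧ T 0 = ⊥ ∧ T (Fin.last r) = N ∧
      (∀ (i : Fin (r + 1)) (g t : G), t ∈ T i → g * t * g⁻¹ ∈ T i) ∧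
      (∀ (i : Fin r) (m t : G), m ∈ N → t ∈ T i.succ →
        m * t * m⁻¹ * t⁻¹ ∈ T i.castSucc) ∧
      (∀ i : Fin r, (T i.castSucc).relIndex (T i.succ) = 0 →
        ∃ M : Rep ℤ (G ⧸ N), NiceRep (groupSpectrum N) M ∧
          ∃ φ : M → G,
            (∀ m : M, φ m ∈ T i.succ) ∧
            (∀ m m' : M, (φ (m + m'))⁻¹ * (φ m * φ m') ∈ T i.castSucc) ∧
            (∀ t : G, t ∈ T i.succ → ∃ m : M, (φ m)⁻¹ * t ∈ T i.castSucc) ∧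
            (∀ (g : G) (m : M),
              (φ (M.ρ (QuotientGroup.mk g) m))⁻¹ * (g * φ m * g⁻¹) ∈ T i.castSucc)))
    (n : ℕ) :
    ∃ ρQ : Representation ℤ (G ⧸ N) ((groupHomologyFunctor n).obj (MonCat.of N)),
      (∀ g : G, ρQ (QuotientGroup.mk g) =
        endOfHom ((groupHomologyFunctor n).map
          (MonCat.ofHom ((MulAut.conjNormal g : MulAut N) : N →* N)))) ∧
      MemC (G ⧸ N) (groupSpectrum N) (Rep.of ρQ) := by
  have := hN
  exact HNil.finish N n (HNil.main_PC N hser n)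

end
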